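/- arXiv:gr-qc/0204030 — 3 statements merged into one kernel-verified Lean document; each statement's English description precedes it below -/
import Mathlib

section
/- In a collapsing ARS model, if n = 1 or n = 2, or if n = 3 and ξ/α > ξ_c, then the central singularity is locally naked. -/
noncomputable section

open Real Set Filter Topology Asymptotics MeasureTheory intervalIntegral

/-- Data for an area-radius separable (ARS) spacetime: a size `r₀` of the comoving
coordinate range, generating functions `Ψ` (Misner–Sharp mass) and `Y`, the third-order
Taylor coefficients `h30, h21, h12, h03` of `G(r,R) = 2Ψ(r,R) + R(Y(r,R)² − 1)` at the
origin, together with all the regularity and positivity requirements. -/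
structure ARSData where
  r₀ : ℝ
  Ψ : ℝ → ℝ → ℝ
  Y : ℝ → ℝ → ℝ
  h30 : ℝ
  h21 : ℝ
  h12 : ℝ
  h03 : ℝ
  r₀_pos : 0 < r₀
  /-- `Ψ` and `Y` are `C^∞` on a neighborhood of `[0,r₀] × [0,r₀]`. -/
  smooth : ∃ U : Set (ℝ × ℝ), IsOpen U ∧ Icc 0 r₀ ×ˢ Icc 0 r₀ ⊆ U ∧
      ContDiffOn ℝ (⊤ : ℕ∞) (fun p : ℝ × ℝ => Ψ p.1 p.2) U ∧
      ContDiffOn ℝ (⊤ : ℕ∞) (fun p : ℝ × ℝ => Y p.1 p.2) U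
  Y_pos : ∀ r ∈ Icc (0:ℝ) r₀, ∀ R ∈ Icc (0:ℝ) r₀, 0 < Y r R
  Ψ_nonneg : ∀ r ∈ Icc (0:ℝ) r₀, ∀ R ∈ Icc (0:ℝ) r₀, 0 ≤ Ψ r R
  Ψr_nonneg : ∀ r ∈ Icc (0:ℝ) r₀, ∀ R ∈ Icc (0:ℝ) r₀, 0 ≤ deriv (fun s => Ψ s R) r
  ΨR_nonneg : ∀ r ∈ Icc (0:ℝ) r₀, ∀ R ∈ Icc (0:ℝ) r₀, 0 ≤ deriv (fun s => Ψ r s) R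
  Y_origin : Y 0 0 = 1
  Yr_origin : deriv (fun s => Y s 0) 0 = 0
  YR_origin : deriv (fun s => Y 0 s) 0 = 0
  Ψ_origin : Ψ 0 0 = 0
  Ψr_origin : deriv (fun s => Ψ s 0) 0 = 0
  ΨR_origin : deriv (fun s => Ψ 0 s) 0 = 0
  Ψrr_origin : deriv (deriv (fun s => Ψ s 0)) 0 = 0
  ΨrR_origin : deriv (fun s => deriv (fun t => Ψ s t) 0) 0 = 0
  ΨRR_origin : deriv (deriv (fun s => Ψ 0 s)) 0 = 0
  /-- Third-order Taylor expansion of `G(r,R) = 2Ψ + R(Y²−1)` at the origin. -/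
  taylor : (fun p : ℝ × ℝ =>
      (2 * Ψ p.1 p.2 + p.2 * ((Y p.1 p.2) ^ 2 - 1)) -
        (h30 * p.1 ^ 3 + h21 * p.1 ^ 2 * p.2 + h12 * p.1 * p.2 ^ 2 + h03 * p.2 ^ 3))
      =o[𝓝[Icc (0:ℝ) r₀ ×ˢ Icc (0:ℝ) r₀] (0, 0)] fun p : ℝ × ℝ => (p.1 + p.2) ^ 3
  /-- `α = h₃₀ > 0`. -/
  α_pos : 0 < h30
  /-- `P(τ) = Σ_{i+j=3} h_{ij} τ^j > 0` on `[0,1]`. -/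
  P_pos : ∀ τ ∈ Icc (0:ℝ) 1, 0 < h30 + h21 * τ + h12 * τ ^ 2 + h03 * τ ^ 3
  G_pos : ∀ r R : ℝ, 0 < R → R ≤ r → r ≤ r₀ →
      0 < 2 * Ψ r R + R * ((Y r R) ^ 2 - 1)

namespace ARSData

variable (a : ARSData)

/-- `G(r,R) := 2Ψ(r,R) + R(Y(r,R)² − 1)`. -/
def G (r R : ℝ) : ℝ := 2 * a.Ψ r R + R * ((a.Y r R) ^ 2 - 1)

/-- `H(r,R) := √(R/G(r,R))`. -/
def H (r R : ℝ) : ℝ := Real.sqrt (R / a.G r R)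

/-- `u(r,R) := √(G(r,R)/R)`. -/
def u (r R : ℝ) : ℝ := Real.sqrt (a.G r R / R)

/-- `√Δ(r,R) := ∫_R^r (1/Y(r,σ)) ∂H/∂r(r,σ) dσ + H(r,r)/Y(r,r)`. -/
def sqrtΔ (r R : ℝ) : ℝ :=
  (∫ σ in R..r, (a.Y r σ)⁻¹ * deriv (fun s => a.H s σ) r) + a.H r r / a.Y r r

/-- `P(τ) := Σ_{i+j=3} h_{ij} τ^j`. -/
def P (τ : ℝ) : ℝ := a.h30 + a.h21 * τ + a.h12 * τ ^ 2 + a.h03 * τ ^ 3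

end ARSData

/-- The critical value `ξ_c = (26 + 15√3)/2`. -/
def ξc : ℝ := (26 + 15 * Real.sqrt 3) / 2

/-- A collapsing ARS model: an ARS spacetime with no shell-crossing singularities
(`√Δ > 0`), the asymptotic expansion `√Δ(r,0) = ξ r^{n−1} + o(r^{n−1})`, and an
apparent horizon `R_h`. -/
structure CollapsingARS extends ARSData where
  ξ : ℝ
  n : ℕ
  Rh : ℝ → ℝ
  ξ_pos : 0 < ξ
  n_pos : 1 ≤ n
  sqrtΔ_pos : ∀ r ∈ Ioc (0:ℝ) r₀, ∀ R ∈ Icc (0:ℝ) r, 0 < toARSData.sqrtΔ r R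
  sqrtΔ_asym : (fun r : ℝ => toARSData.sqrtΔ r 0 - ξ * r ^ (n - 1))
      =o[𝓝[>] (0:ℝ)] fun r : ℝ => r ^ (n - 1)
  Rh_pos : ∀ r ∈ Ioc (0:ℝ) r₀, 0 < Rh r
  Rh_lt : ∀ r ∈ Ioc (0:ℝ) r₀, Rh r < r
  Rh_eq : ∀ r ∈ Ioc (0:ℝ) r₀, Rh r = 2 * Ψ r (Rh r)

namespace CollapsingARS

variable (c : CollapsingARS)

/-- The central singularity is locally naked: some radial null geodesic `R_g`
escapes from the apparent horizon back to the central singularity. -/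
def LocallyNaked : Prop :=
  ∃ r₁ ∈ Ioc (0:ℝ) c.r₀, ∃ Rg : ℝ → ℝ,
    (∀ r ∈ Ioc (0:ℝ) r₁, HasDerivAt Rg
      (c.u r (Rg r) * c.sqrtΔ r (Rg r) * (c.Y r (Rg r) - c.u r (Rg r))) r) ∧
    (∀ r ∈ Ioc (0:ℝ) r₁, c.Rh r < Rg r ∧ Rg r < r) ∧
    Tendsto Rg (𝓝[>] 0) (𝓝 0) ∧
    Tendsto (fun r => ∫ σ in (0:ℝ)..(Rg r), c.H r σ) (𝓝[>] 0) (𝓝 0)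

end CollapsingARS

/-- A time-dependent vector field on `(0, b]` which is uniformly bounded and
Lipschitz on each `[ε, b]` has a solution on all of `(0, b]` with prescribed value at `b`. -/
theorem exists_solution_Ioc {v : ℝ → ℝ → ℝ} {b : ℝ} (hb : 0 < b)
    (hv : ∀ ε ∈ Ioo 0 b, ∃ K L : NNReal, ∀ t ∈ Icc ε b, LipschitzWith K (v t) ∧ ∀ x, ‖v t x‖ ≤ L)
    (hc : ∀ x, ContinuousOn (fun t => v t x) (Ioc 0 b)) (x₀ : ℝ) :
    ∃ γ : ℝ → ℝ, γ b = x₀ ∧ ContinuousOn γ (Ioc 0 b) ∧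
      ∀ t ∈ Ioo 0 b, HasDerivAt γ (v t (γ t)) t := by
  have sol : ∀ ε ∈ Ioo 0 b, ∃ γ : ℝ → ℝ, γ b = x₀ ∧
      ∀ t ∈ Icc ε b, HasDerivWithinAt γ (v t (γ t)) (Icc ε b) t := by
    intro ε hε
    obtain ⟨K, L, hKL⟩ := hv ε hε
    have hpl : IsPicardLindelof v (⟨b, hε.2.le, le_rfl⟩ : Icc ε b) x₀
        (L * (b - ε).toNNReal) 0 L K :=
      { lipschitzOnWith := fun t ht => (hKL t ht).1.lipschitzOnWith
        continuousOn := fun x _ => (hc x).mono fun t ht => ⟨hε.1.trans_le ht.1, ht.2⟩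
        norm_le := fun t ht x _ => (hKL t ht).2 x
        mul_max_le := by
          have h1 : (0:ℝ) ≤ b - ε := by linarith [hε.2]
          simp [h1] }
    exact hpl.exists_eq_forall_mem_Icc_hasDerivWithinAt₀
  choose! g hgb hg using sol
  have agree : ∀ ε ∈ Ioo 0 b, ∀ ε' ∈ Ioo 0 b, ε ≤ ε' → EqOn (g ε) (g ε') (Icc ε' b) := by
    intro ε hε ε' hε' h
    obtain ⟨K, L, hKL⟩ := hv ε' hε'
    have left : ∀ δ ∈ Ioo 0 b, δ ≤ ε' → ∀ t ∈ Ioc ε' b,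
        HasDerivWithinAt (g δ) (v t (g δ t)) (Iic t) t := by
      intro δ hδ hle t ht
      refine (hg δ hδ t ⟨hle.trans ht.1.le, ht.2⟩).mono_of_mem_nhdsWithin ?_
      refine mem_of_superset (Icc_mem_nhdsLE (hle.trans_lt ht.1)) (Icc_subset_Icc_right ht.2)
    have cont : ∀ δ ∈ Ioo 0 b, δ ≤ ε' → ContinuousOn (g δ) (Icc ε' b) := fun δ hδ hle =>
      (HasDerivWithinAt.continuousOn (hg δ hδ)).mono (Icc_subset_Icc_left hle)
    exact ODE_solution_unique_of_mem_Icc_left (s := fun _ => univ) (K := K) (v := v)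
      (fun t ht => (hKL t ⟨ht.1.le, ht.2⟩).1.lipschitzOnWith)
      (cont ε hε h) (left ε hε h) (fun _ _ => trivial) (cont ε' hε' le_rfl)
      (left ε' hε' le_rfl) (fun _ _ => trivial) ((hgb ε hε).trans (hgb ε' hε').symm)
  have half : ∀ t ∈ Ioc 0 b, t / 2 ∈ Ioo 0 b := fun t ht => ⟨by linarith [ht.1], by
    linarith [ht.1, ht.2]⟩
  have loc : ∀ ε ∈ Ioo 0 b, ∀ t ∈ Icc (2 * ε) b, g (t / 2) t = g ε t := by
    intro ε hε t ht
    have ht0 : t ∈ Ioc 0 b := ⟨by linarith [hε.1, ht.1], ht.2⟩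
    exact (agree ε hε (t / 2) (half t ht0) (by linarith [ht.1])
      ⟨by linarith [ht0.1], ht.2⟩).symm
  refine ⟨fun t => g (t / 2) t, hgb _ (half b ⟨hb, le_rfl⟩), ?_, ?_⟩
  · intro t ht
    have hε : t / 4 ∈ Ioo 0 b := ⟨by linarith [ht.1], by linarith [ht.1, ht.2]⟩
    have h1 : ContinuousWithinAt (g (t / 4)) (Ioc 0 b) t := by
      refine ((hg _ hε t ⟨by linarith [ht.1], ht.2⟩).continuousWithinAt).mono_of_mem_nhdsWithin ?_
      refine mem_nhdsWithin.2 ⟨Ioi (t / 4), isOpen_Ioi, by simp; linarith [ht.1], ?_⟩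
      rintro s ⟨hs1, hs2⟩
      exact ⟨le_of_lt hs1, hs2.2⟩
    refine h1.congr_of_eventuallyEq ?_ (loc _ hε t ⟨by linarith [ht.1], ht.2⟩)
    refine mem_nhdsWithin.2 ⟨Ioi (t / 2), isOpen_Ioi, by simp; linarith [ht.1], ?_⟩
    rintro s ⟨hs1, hs2⟩
    have : t / 2 < s := hs1
    exact loc _ hε s ⟨by linarith, hs2.2⟩
  · intro t ht
    have hε : t / 4 ∈ Ioo 0 b := ⟨by linarith [ht.1], by linarith [ht.1, ht.2]⟩
    have h2 := loc _ hε t ⟨by linarith [ht.1], ht.2.le⟩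
    have h1 : HasDerivAt (g (t / 4)) (v t (g (t / 4) t)) t :=
      (hg _ hε t ⟨by linarith [ht.1], ht.2.le⟩).hasDerivAt
        (Icc_mem_nhds (by linarith [ht.1]) ht.2)
    rw [← h2] at h1
    refine h1.congr_of_eventuallyEq ?_
    filter_upwards [Ioo_mem_nhds (show t / 2 < t by linarith [ht.1]) ht.2] with s hs
    exact loc _ hε s ⟨by linarith [hs.1], hs.2.le⟩

/-- A function which is positive at `b` and has negative derivative at each of its zeros in
`(a, b)` is positive on `(a, b]`. -/
theorem pos_of_deriv_neg_at_zeros {g : ℝ → ℝ} {a b : ℝ} (hg : ContinuousOn g (Ioc a b))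
    (hb : 0 < g b) (hz : ∀ t ∈ Ioo a b, g t = 0 → ∃ g' < 0, HasDerivAt g g' t) :
    ∀ t ∈ Ioc a b, 0 < g t := by
  intro t ht
  by_contra! hneg
  have hsub : Icc t b ⊆ Ioc a b := fun s hs => ⟨ht.1.trans_le hs.1, hs.2⟩
  have hcont := hg.mono hsub
  have hcomp : IsCompact (Icc t b ∩ g ⁻¹' Iic 0) :=
    isCompact_Icc.of_isClosed_subset
      (hcont.preimage_isClosed_of_isClosed isClosed_Icc isClosed_Iic) inter_subset_left
  obtain ⟨s, ⟨hs, hgs⟩, hmax⟩ := hcomp.exists_isGreatest ⟨t, ⟨le_rfl, ht.2⟩, hneg⟩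
  have hsb : s < b := by
    refine lt_of_le_of_ne hs.2 fun h => ?_
    subst h
    exact absurd hgs (not_le.2 hb)
  have hright : ∀ᶠ x in 𝓝[>] s, 0 < g x := by
    filter_upwards [Ioo_mem_nhdsGT hsb] with x hx
    by_contra! hxneg
    exact absurd (hmax ⟨⟨hs.1.trans hx.1.le, hx.2.le⟩, hxneg⟩) (not_le.2 hx.1)
  have hlim : Tendsto g (𝓝[>] s) (𝓝 (g s)) := by
    refine (hcont s hs).mono_left (nhdsWithin_le_of_mem ?_)
    exact mem_of_superset (Ioo_mem_nhdsGT hsb) fun x hx => ⟨hs.1.trans hx.1.le, hx.2.le⟩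
  have hzero : g s = 0 :=
    le_antisymm hgs (ge_of_tendsto hlim (hright.mono fun x hx => hx.le))
  obtain ⟨g', hneg, hg'⟩ := hz s ⟨(hsub hs).1, hsb⟩ hzero
  have hslope := (hasDerivAt_iff_tendsto_slope.1 hg').mono_left
    (nhdsWithin_mono s (fun x hx => ne_of_gt hx : Ioi s ⊆ {s}ᶜ))
  obtain ⟨x, hx1, hx2, hx3⟩ := ((hslope.eventually (gt_mem_nhds hneg)).and
    (hright.and self_mem_nhdsWithin)).exists
  rw [slope_def_field, hzero, sub_zero] at hx1
  exact absurd hx1 (not_lt.2 (div_nonneg hx2.le (sub_nonneg.2 (le_of_lt hx3))))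

/-- If the lower curve `A` and the upper curve `B` are crossed in the outgoing sense by the flow
of `f`, backward in time solutions starting between the two curves exist down to time `0` and
stay between them. -/
theorem exists_solution_between {f : ℝ → ℝ → ℝ} {A B A' B' : ℝ → ℝ} {b : ℝ} (hb : 0 < b)
    (hA : ∀ t, HasDerivAt A (A' t) t) (hB : ∀ t, HasDerivAt B (B' t) t)
    (hAB : ∀ t ∈ Ioc 0 b, A t ≤ B t)
    (hf : ContinuousOn (fun p : ℝ × ℝ => f p.1 p.2)
      {p | p.1 ∈ Ioc 0 b ∧ p.2 ∈ Icc (A p.1) (B p.1)})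
    (hlip : ∀ ε ∈ Ioo 0 b, ∃ K : NNReal, ∀ t ∈ Icc ε b, LipschitzOnWith K (f t) (Icc (A t) (B t)))
    (hfA : ∀ t ∈ Ioo 0 b, f t (A t) < A' t) (hfB : ∀ t ∈ Ioo 0 b, B' t < f t (B t))
    {x₀ : ℝ} (hx₀ : x₀ ∈ Ioo (A b) (B b)) :
    ∃ γ : ℝ → ℝ, γ b = x₀ ∧ ContinuousOn γ (Ioc 0 b) ∧
      (∀ t ∈ Ioo 0 b, HasDerivAt γ (f t (γ t)) t) ∧ ∀ t ∈ Ioc 0 b, γ t ∈ Ioo (A t) (B t) := by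
  have cA : Continuous A := continuous_iff_continuousAt.2 fun t => (hA t).continuousAt
  have cB : Continuous B := continuous_iff_continuousAt.2 fun t => (hB t).continuousAt
  set cl : ℝ → ℝ → ℝ := fun t x => max (A t) (min x (B t)) with hcl
  have cl_mem : ∀ t ∈ Ioc 0 b, ∀ x, cl t x ∈ Icc (A t) (B t) := fun t ht x =>
    ⟨le_max_left _ _, max_le (hAB t ht) (min_le_right _ _)⟩
  have cl_of_mem : ∀ t x, x ∈ Icc (A t) (B t) → cl t x = x := fun t x hx => by
    simp [hcl, hx.1, hx.2]
  have cl_lip : ∀ t, LipschitzWith 1 (cl t) := fun t =>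
    (LipschitzWith.id.min_const (B t)).const_max (A t)
  have hv : ∀ ε ∈ Ioo 0 b, ∃ K L : NNReal, ∀ t ∈ Icc ε b,
      LipschitzWith K (fun x => f t (cl t x)) ∧ ∀ x, ‖f t (cl t x)‖ ≤ L := by
    intro ε hε
    obtain ⟨K, hK⟩ := hlip ε hε
    have pos : ∀ t ∈ Icc ε b, t ∈ Ioc 0 b := fun t ht => ⟨hε.1.trans_le ht.1, ht.2⟩
    have hcomp : IsCompact {p : ℝ × ℝ | p.1 ∈ Icc ε b ∧ p.2 ∈ Icc (A p.1) (B p.1)} := by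
      obtain ⟨m, hm⟩ := (isCompact_Icc (a := ε) (b := b)).bddBelow_image cA.continuousOn
      obtain ⟨M, hM⟩ := (isCompact_Icc (a := ε) (b := b)).bddAbove_image cB.continuousOn
      refine ((isCompact_Icc (a := ε) (b := b)).prod (isCompact_Icc (a := m) (b := M))).of_isClosed_subset ?_ ?_
      · refine IsClosed.inter ?_ (IsClosed.inter ?_ ?_)
        · exact isClosed_Icc.preimage continuous_fst
        · exact isClosed_le (cA.comp continuous_fst) continuous_snd
        · exact isClosed_le continuous_snd (cB.comp continuous_fst)
      · rintro ⟨t, x⟩ ⟨ht, hx⟩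
        exact ⟨ht, (hm (mem_image_of_mem A ht)).trans hx.1, hx.2.trans (hM (mem_image_of_mem B ht))⟩
    obtain ⟨L, hL⟩ := hcomp.exists_bound_of_continuousOn
      (hf.mono fun p hp => ⟨pos _ hp.1, hp.2⟩)
    refine ⟨K, L.toNNReal, fun t ht => ⟨?_, fun x => ?_⟩⟩
    · have := (hK t ht).comp ((cl_lip t).lipschitzOnWith (s := univ))
        (fun x _ => cl_mem t (pos t ht) x)
      simpa [Function.comp_def] using this
    · exact (hL (t, cl t x) ⟨ht, cl_mem t (pos t ht) x⟩).trans (le_coe_toNNReal L)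
  have hc : ∀ x, ContinuousOn (fun t => f t (cl t x)) (Ioc 0 b) := by
    intro x
    have h1 : Continuous fun t => (t, cl t x) := by fun_prop
    exact hf.comp h1.continuousOn fun t ht => ⟨ht, cl_mem t ht x⟩
  obtain ⟨γ, hγb, hγc, hγ⟩ := exists_solution_Ioc (v := fun t x => f t (cl t x)) hb hv hc x₀
  have upper : ∀ t ∈ Ioc 0 b, 0 < B t - γ t := by
    refine pos_of_deriv_neg_at_zeros (cB.continuousOn.sub hγc) (by rw [hγb]; linarith [hx₀.2]) ?_
    intro t ht h0
    have h : γ t = B t := by linarith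
    refine ⟨_, ?_, (hB t).sub (hγ t ht)⟩
    rw [h, cl_of_mem t _ ⟨hAB t ⟨ht.1, ht.2.le⟩, le_rfl⟩]
    linarith [hfB t ht]
  have lower : ∀ t ∈ Ioc 0 b, 0 < γ t - A t := by
    refine pos_of_deriv_neg_at_zeros (hγc.sub cA.continuousOn) (by rw [hγb]; linarith [hx₀.1]) ?_
    intro t ht h0
    have h : γ t = A t := by linarith
    refine ⟨_, ?_, (hγ t ht).sub (hA t)⟩
    rw [h, cl_of_mem t _ ⟨le_rfl, hAB t ⟨ht.1, ht.2.le⟩⟩]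
    linarith [hfA t ht]
  have mem : ∀ t ∈ Ioc 0 b, γ t ∈ Ioo (A t) (B t) := fun t ht =>
    ⟨by linarith [lower t ht], by linarith [upper t ht]⟩
  refine ⟨γ, hγb, hγc, fun t ht => ?_, mem⟩
  have := hγ t ht
  rwa [cl_of_mem t _ (Ioo_subset_Icc_self (mem t ⟨ht.1, ht.2.le⟩))] at this

section Partial

variable {F : ℝ → ℝ → ℝ} {U : Set (ℝ × ℝ)}

theorem hasDerivAt_comp_curve (hU : IsOpen U)
    (hF : ContDiffOn ℝ (⊤ : ℕ∞) (fun p : ℝ × ℝ => F p.1 p.2) U) {x y : ℝ → ℝ} {t x' y' : ℝ}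
    (hp : (x t, y t) ∈ U) (hx : HasDerivAt x x' t) (hy : HasDerivAt y y' t) :
    HasDerivAt (fun s => F (x s) (y s))
      (fderiv ℝ (fun p : ℝ × ℝ => F p.1 p.2) (x t, y t) (x', y')) t := by
  have h1 : DifferentiableAt ℝ (fun p : ℝ × ℝ => F p.1 p.2) (x t, y t) :=
    (hF.contDiffAt (hU.mem_nhds hp)).differentiableAt (by simp)
  exact h1.hasFDerivAt.comp_hasDerivAt t (hx.prodMk hy)

theorem deriv_fst_eq_fderiv (hU : IsOpen U)
    (hF : ContDiffOn ℝ (⊤ : ℕ∞) (fun p : ℝ × ℝ => F p.1 p.2) U) {p : ℝ × ℝ} (hp : p ∈ U) :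
    deriv (fun s => F s p.2) p.1 = fderiv ℝ (fun p : ℝ × ℝ => F p.1 p.2) p (1, 0) :=
  (hasDerivAt_comp_curve hU hF (x := id) (y := fun _ => p.2) hp (hasDerivAt_id _)
    (hasDerivAt_const _ _)).deriv

theorem deriv_snd_eq_fderiv (hU : IsOpen U)
    (hF : ContDiffOn ℝ (⊤ : ℕ∞) (fun p : ℝ × ℝ => F p.1 p.2) U) {p : ℝ × ℝ} (hp : p ∈ U) :
    deriv (fun s => F p.1 s) p.2 = fderiv ℝ (fun p : ℝ × ℝ => F p.1 p.2) p (0, 1) :=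
  (hasDerivAt_comp_curve hU hF (x := fun _ => p.1) (y := id) hp (hasDerivAt_const _ _)
    (hasDerivAt_id _)).deriv

theorem hasDerivAt_fst (hU : IsOpen U)
    (hF : ContDiffOn ℝ (⊤ : ℕ∞) (fun p : ℝ × ℝ => F p.1 p.2) U) {r R : ℝ} (hp : (r, R) ∈ U) :
    HasDerivAt (fun s => F s R) (deriv (fun s => F s R) r) r :=
  (hasDerivAt_comp_curve hU hF (x := id) (y := fun _ => R) hp (hasDerivAt_id _)
    (hasDerivAt_const _ _)).differentiableAt.hasDerivAt

theorem hasDerivAt_snd (hU : IsOpen U)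
    (hF : ContDiffOn ℝ (⊤ : ℕ∞) (fun p : ℝ × ℝ => F p.1 p.2) U) {r R : ℝ} (hp : (r, R) ∈ U) :
    HasDerivAt (fun s => F r s) (deriv (fun s => F r s) R) R :=
  (hasDerivAt_comp_curve hU hF (x := fun _ => r) (y := id) hp (hasDerivAt_const _ _)
    (hasDerivAt_id _)).differentiableAt.hasDerivAt

theorem hasDerivAt_along_graph (hU : IsOpen U)
    (hF : ContDiffOn ℝ (⊤ : ℕ∞) (fun p : ℝ × ℝ => F p.1 p.2) U) {γ : ℝ → ℝ} {t γ' : ℝ}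
    (hp : (t, γ t) ∈ U) (hγ : HasDerivAt γ γ' t) :
    HasDerivAt (fun s => F s (γ s))
      (deriv (fun s => F s (γ t)) t + γ' * deriv (fun s => F t s) (γ t)) t := by
  have h := hasDerivAt_comp_curve hU hF (x := id) (y := γ) hp (hasDerivAt_id t) hγ
  have e : ((1 : ℝ), (0 : ℝ)) + γ' • ((0 : ℝ), (1 : ℝ)) = (1, γ') := by simp
  rw [deriv_fst_eq_fderiv hU hF hp, deriv_snd_eq_fderiv hU hF hp, ← smul_eq_mul, ← map_smul,
    ← map_add, e]
  exact h

theorem contDiffOn_deriv_fst (hU : IsOpen U)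
    (hF : ContDiffOn ℝ (⊤ : ℕ∞) (fun p : ℝ × ℝ => F p.1 p.2) U) :
    ContDiffOn ℝ (⊤ : ℕ∞) (fun p : ℝ × ℝ => deriv (fun s => F s p.2) p.1) U :=
  ((hF.fderiv_of_isOpen hU (m := (⊤ : ℕ∞)) (by simp)).clm_apply contDiffOn_const).congr
    fun _ hp => deriv_fst_eq_fderiv hU hF hp

theorem contDiffOn_deriv_snd (hU : IsOpen U)
    (hF : ContDiffOn ℝ (⊤ : ℕ∞) (fun p : ℝ × ℝ => F p.1 p.2) U) :
    ContDiffOn ℝ (⊤ : ℕ∞) (fun p : ℝ × ℝ => deriv (fun s => F p.1 s) p.2) U :=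
  ((hF.fderiv_of_isOpen hU (m := (⊤ : ℕ∞)) (by simp)).clm_apply contDiffOn_const).congr
    fun _ hp => deriv_snd_eq_fderiv hU hF hp

end Partial

/-- Points `(r, R)` tending to the origin with `r > 0` and `0 ≤ R ≤ C r³`. -/
def cubicNhds (C : ℝ) : Filter (ℝ × ℝ) :=
  𝓝[{p | 0 < p.1 ∧ 0 ≤ p.2 ∧ p.2 ≤ C * p.1 ^ 3}] (0, 0)

theorem eventually_forall_of_cubicNhds {C : ℝ} {P : ℝ × ℝ → Prop}
    (h : ∀ᶠ p in cubicNhds C, P p) :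
    ∀ᶠ r in 𝓝[>] (0:ℝ), ∀ R ∈ Icc 0 (C * r ^ 3), P (r, R) := by
  rw [cubicNhds, eventually_nhdsWithin_iff, nhds_prod_eq, eventually_prod_iff] at h
  obtain ⟨p, hp, q, hq, hpq⟩ := h
  obtain ⟨δ, hδ, hδq⟩ := Metric.eventually_nhds_iff.1 hq
  have hlim : Tendsto (fun r : ℝ => C * r ^ 3) (𝓝[>] 0) (𝓝 0) :=
    (Continuous.tendsto' (by fun_prop) _ _ (by simp)).mono_left nhdsWithin_le_nhds
  filter_upwards [nhdsWithin_le_nhds hp, self_mem_nhdsWithin, hlim.eventually (gt_mem_nhds hδ)]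
    with r h1 h2 h3 R hR
  refine hpq h1 (hδq ?_) ⟨h2, hR.1, hR.2⟩
  rw [Real.dist_eq, sub_zero, abs_of_nonneg hR.1]
  exact hR.2.trans_lt h3

theorem tendsto_cubic_curve {c C : ℝ} (hc : 0 ≤ c) (hcC : c ≤ C) :
    Tendsto (fun r : ℝ => (r, c * r ^ 3)) (𝓝[>] 0) (cubicNhds C) := by
  refine tendsto_iff_eventually.2 fun P hs => ?_
  filter_upwards [eventually_forall_of_cubicNhds hs, self_mem_nhdsWithin] with r h1 h2
  have h3 : (0:ℝ) < r ^ 3 := pow_pos h2 3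
  exact h1 _ ⟨by positivity, by gcongr⟩

theorem tendsto_fst_cubicNhds (C : ℝ) : Tendsto Prod.fst (cubicNhds C) (𝓝[>] 0) := by
  refine tendsto_nhdsWithin_iff.2 ⟨?_, ?_⟩
  · exact (continuous_fst.tendsto' (0, 0) (0:ℝ) rfl).mono_left nhdsWithin_le_nhds
  · exact eventually_of_mem self_mem_nhdsWithin fun p hp => hp.1

theorem eventually_mem_cubicNhds (C : ℝ) :
    ∀ᶠ p in cubicNhds C, 0 < p.1 ∧ 0 ≤ p.2 ∧ p.2 ≤ C * p.1 ^ 3 :=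
  eventually_of_mem self_mem_nhdsWithin fun _ hp => hp

theorem tendsto_snd_div_fst_sq (C : ℝ) :
    Tendsto (fun p : ℝ × ℝ => p.2 / p.1 ^ 2) (cubicNhds C) (𝓝 0) := by
  have h0 : Tendsto (fun p : ℝ × ℝ => C * p.1) (cubicNhds C) (𝓝 0) := by
    simpa using ((tendsto_fst_cubicNhds C).mono_right nhdsWithin_le_nhds).const_mul C
  refine squeeze_zero' ?_ ?_ h0
  · filter_upwards [eventually_mem_cubicNhds C] with p hp
    have := hp.1
    have := hp.2.1
    positivity
  · filter_upwards [eventually_mem_cubicNhds C] with p hp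
    have := hp.1
    rw [div_le_iff₀ (by positivity)]
    calc p.2 ≤ C * p.1 ^ 3 := hp.2.2
      _ = _ := by ring

theorem tendsto_snd_div_fst (C : ℝ) :
    Tendsto (fun p : ℝ × ℝ => p.2 / p.1) (cubicNhds C) (𝓝 0) := by
  have h := (tendsto_snd_div_fst_sq C).mul
    ((tendsto_fst_cubicNhds C).mono_right nhdsWithin_le_nhds)
  rw [zero_mul] at h
  refine h.congr' ?_
  filter_upwards [eventually_mem_cubicNhds C] with p hp
  have := hp.1
  field_simp

/-- If `g` vanishes to third order at `0` in the sense that `g / r³ → l`, with `g`, `g'`, `g''`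
vanishing at `0` and `g''` differentiable there, then `g' / r² → 3 l`. -/
theorem tendsto_deriv_div_sq {g g' g'' : ℝ → ℝ} {l c : ℝ}
    (h1 : ∀ᶠ x in 𝓝 (0:ℝ), HasDerivAt g (g' x) x) (h2 : ∀ᶠ x in 𝓝 (0:ℝ), HasDerivAt g' (g'' x) x)
    (h3 : HasDerivAt g'' c 0) (g0 : g 0 = 0) (hg₁ : g' 0 = 0) (hg₂ : g'' 0 = 0)
    (hl : Tendsto (fun x => g x / x ^ 3) (𝓝[>] 0) (𝓝 l)) :
    Tendsto (fun x => g' x / x ^ 2) (𝓝[>] 0) (𝓝 (3 * l)) := by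
  have lim0 : ∀ {f : ℝ → ℝ}, ContinuousAt f 0 → f 0 = 0 → Tendsto f (𝓝[>] 0) (𝓝 0) := by
    intro f hf h0
    have := hf.tendsto.mono_left (nhdsWithin_le_nhds (s := Ioi 0))
    rwa [h0] at this
  have hdiv2 : Tendsto (fun x => g'' x / (2 * x)) (𝓝[>] 0) (𝓝 (c / 2)) := by
    have := ((hasDerivAt_iff_tendsto_slope.1 h3).mono_left
      (nhdsWithin_mono 0 (fun x hx => ne_of_gt hx : Ioi (0:ℝ) ⊆ {0}ᶜ))).div_const 2
    refine this.congr fun x => ?_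
    rw [slope_def_field, hg₂, sub_zero, sub_zero, div_div, mul_comm]
  have hdiv1 : Tendsto (fun x => g' x / x ^ 2) (𝓝[>] 0) (𝓝 (c / 2)) := by
    refine HasDerivAt.lhopital_zero_nhdsGT (f' := g'') (g' := fun x => 2 * x)
      (nhdsWithin_le_nhds h2) (Eventually.of_forall fun x => ?_) ?_
      (lim0 h2.self_of_nhds.continuousAt hg₁) (lim0 (by fun_prop) (by simp)) hdiv2
    · simpa using hasDerivAt_pow 2 x
    · filter_upwards [self_mem_nhdsWithin] with x hx
      exact mul_ne_zero two_ne_zero (ne_of_gt hx)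
  have hdiv0 : Tendsto (fun x => g x / x ^ 3) (𝓝[>] 0) (𝓝 (c / 2 / 3)) := by
    refine HasDerivAt.lhopital_zero_nhdsGT (f' := g') (g' := fun x => 3 * x ^ 2)
      (nhdsWithin_le_nhds h1) (Eventually.of_forall fun x => ?_) ?_
      (lim0 h1.self_of_nhds.continuousAt g0) (lim0 (by fun_prop) (by simp)) ?_
    · simpa using hasDerivAt_pow 3 x
    · filter_upwards [self_mem_nhdsWithin] with x hx
      exact mul_ne_zero three_ne_zero (pow_ne_zero 2 (ne_of_gt hx))
    · refine (hdiv1.div_const 3).congr fun x => ?_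
      rw [div_div, mul_comm]
  have hlc : l = c / 2 / 3 := tendsto_nhds_unique hl hdiv0
  have : 3 * l = c / 2 := by rw [hlc]; ring
  rwa [this]

namespace ARSData

/-- A neighborhood of `[0,r₀] × [0,r₀]` on which `Ψ` and `Y` are smooth. -/
def dom (a : ARSData) : Set (ℝ × ℝ) := a.smooth.choose

/-- The radial derivative of `G`. -/
def Gr (a : ARSData) (r R : ℝ) : ℝ := deriv (fun s => a.G s R) r

/-- The integrand `-(1/Y) ∂H/∂r` in closed form. -/
def shellKernel (a : ARSData) (r R : ℝ) : ℝ :=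
  √R * a.Gr r R / (2 * √(a.G r R) * a.G r R * a.Y r R)

/-- The part of the domain on which `G` and `Y` are positive. -/
def posDom (a : ARSData) : Set (ℝ × ℝ) :=
  {p | p ∈ a.dom ∧ 0 < a.G p.1 p.2 ∧ 0 < a.Y p.1 p.2}

variable (a : ARSData)

theorem isOpen_dom : IsOpen a.dom := a.smooth.choose_spec.1

theorem mem_dom {r R : ℝ} (hr : r ∈ Icc 0 a.r₀) (hR : R ∈ Icc 0 a.r₀) : (r, R) ∈ a.dom :=
  a.smooth.choose_spec.2.1 ⟨hr, hR⟩

theorem zero_mem_dom : ((0 : ℝ), (0 : ℝ)) ∈ a.dom :=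
  a.mem_dom ⟨le_rfl, a.r₀_pos.le⟩ ⟨le_rfl, a.r₀_pos.le⟩

theorem contDiffOn_Ψ : ContDiffOn ℝ (⊤ : ℕ∞) (fun p : ℝ × ℝ => a.Ψ p.1 p.2) a.dom :=
  a.smooth.choose_spec.2.2.1

theorem contDiffOn_Y : ContDiffOn ℝ (⊤ : ℕ∞) (fun p : ℝ × ℝ => a.Y p.1 p.2) a.dom :=
  a.smooth.choose_spec.2.2.2

theorem contDiffOn_G : ContDiffOn ℝ (⊤ : ℕ∞) (fun p : ℝ × ℝ => a.G p.1 p.2) a.dom :=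
  (contDiffOn_const.mul a.contDiffOn_Ψ).add
    (contDiffOn_snd.mul ((a.contDiffOn_Y.pow 2).sub contDiffOn_const))

theorem contDiffOn_Gr : ContDiffOn ℝ (⊤ : ℕ∞) (fun p : ℝ × ℝ => a.Gr p.1 p.2) a.dom :=
  contDiffOn_deriv_fst (F := a.G) a.isOpen_dom a.contDiffOn_G

theorem Gr_eq {r R : ℝ} (h : (r, R) ∈ a.dom) :
    a.Gr r R = 2 * deriv (fun s => a.Ψ s R) r
      + R * (2 * a.Y r R * deriv (fun s => a.Y s R) r) := by
  have h1 := hasDerivAt_fst a.isOpen_dom a.contDiffOn_Ψ h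
  have h2 := hasDerivAt_fst a.isOpen_dom a.contDiffOn_Y h
  have h3 := (h1.const_mul 2).add (((h2.pow 2).sub_const 1).const_mul R)
  have h4 : a.Gr r R = _ := h3.deriv
  simpa using h4

theorem isOpen_posDom : IsOpen a.posDom := by
  have h : a.posDom = (a.dom ∩ (fun p : ℝ × ℝ => a.G p.1 p.2) ⁻¹' Ioi 0) ∩
      (a.dom ∩ (fun p : ℝ × ℝ => a.Y p.1 p.2) ⁻¹' Ioi 0) := by
    ext p
    simp only [posDom, mem_ofPred_eq, mem_inter_iff, mem_preimage, mem_Ioi]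
    tauto
  rw [h]
  exact (a.contDiffOn_G.continuousOn.isOpen_inter_preimage a.isOpen_dom isOpen_Ioi).inter
    (a.contDiffOn_Y.continuousOn.isOpen_inter_preimage a.isOpen_dom isOpen_Ioi)

theorem posDom_subset : a.posDom ⊆ a.dom := fun _ h => h.1

theorem continuousOn_shellKernel :
    ContinuousOn (fun p : ℝ × ℝ => a.shellKernel p.1 p.2) a.posDom := by
  have hG := a.contDiffOn_G.continuousOn.mono a.posDom_subset
  have hY := a.contDiffOn_Y.continuousOn.mono a.posDom_subset
  have hGr := a.contDiffOn_Gr.continuousOn.mono a.posDom_subset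
  refine ((continuous_snd.sqrt.continuousOn).mul hGr).div
    (((continuousOn_const.mul hG.sqrt).mul hG).mul hY) fun p hp => ?_
  have h1 := hp.2.1
  have h2 := hp.2.2
  positivity

theorem inv_Y_mul_deriv_H {r R : ℝ} (hR : 0 ≤ R) (h : (r, R) ∈ a.posDom) :
    (a.Y r R)⁻¹ * deriv (fun s => a.H s R) r = -a.shellKernel r R := by
  have h1 : HasDerivAt (fun s => a.G s R) (a.Gr r R) r :=
    hasDerivAt_fst a.isOpen_dom a.contDiffOn_G h.1
  have hG := h.2.1
  have hY := h.2.2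
  simp only at hG hY
  have h2 := (hasDerivAt_const r (√R)).div (h1.sqrt hG.ne') (sqrt_ne_zero'.2 hG)
  have h3 : (fun s => a.H s R) = fun s => √R / √(a.G s R) := by
    funext s
    exact sqrt_div hR _
  rw [h3]
  erw [h2.deriv]
  have h4 : 0 < √(a.G r R) := sqrt_pos.2 hG
  rw [sq_sqrt hG.le, shellKernel]
  field_simp
  ring

theorem mem_Icc_eventually_cubicNhds (C : ℝ) :
    ∀ᶠ p in cubicNhds C, p.1 ∈ Ioc 0 a.r₀ ∧ p.2 ∈ Icc 0 a.r₀ := by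
  have h1 : ∀ᶠ p : ℝ × ℝ in 𝓝 (0, 0), p.1 < a.r₀ :=
    continuousAt_fst.eventually_lt continuousAt_const a.r₀_pos
  have h2 : ∀ᶠ p : ℝ × ℝ in 𝓝 (0, 0), p.2 < a.r₀ :=
    continuousAt_snd.eventually_lt continuousAt_const a.r₀_pos
  filter_upwards [eventually_mem_cubicNhds C, nhdsWithin_le_nhds h1, nhdsWithin_le_nhds h2]
    with p hp hp1 hp2
  exact ⟨⟨hp.1, hp1.le⟩, hp.2.1, hp2.le⟩

theorem tendsto_cubicNhds_of_continuousOn {F : ℝ × ℝ → ℝ} (hF : ContinuousOn F a.dom) (C : ℝ) :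
    Tendsto F (cubicNhds C) (𝓝 (F (0, 0))) :=
  ((hF.continuousAt (a.isOpen_dom.mem_nhds a.zero_mem_dom)).tendsto).mono_left nhdsWithin_le_nhds

theorem tendsto_G_div_cube (C : ℝ) :
    Tendsto (fun p : ℝ × ℝ => a.G p.1 p.2 / p.1 ^ 3) (cubicNhds C) (𝓝 a.h30) := by
  have hle : cubicNhds C ≤ 𝓝[Icc (0:ℝ) a.r₀ ×ˢ Icc (0:ℝ) a.r₀] (0, 0) := by
    refine le_inf nhdsWithin_le_nhds (le_principal_iff.2 ?_)
    filter_upwards [a.mem_Icc_eventually_cubicNhds C] with p hp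
    exact ⟨⟨hp.1.1.le, hp.1.2⟩, hp.2⟩
  have hτ := tendsto_snd_div_fst C
  have hO : (fun p : ℝ × ℝ => (p.1 + p.2) ^ 3) =O[cubicNhds C] fun p => p.1 ^ 3 := by
    refine IsBigO.pow (IsBigO.of_bound 2 ?_) 3
    filter_upwards [eventually_mem_cubicNhds C, hτ.eventually (gt_mem_nhds one_pos)] with p hp h1
    rw [div_lt_one hp.1] at h1
    rw [Real.norm_of_nonneg (add_nonneg hp.1.le hp.2.1), Real.norm_of_nonneg hp.1.le]
    linarith
  have hrem := ((a.taylor.mono hle).trans_isBigO hO).tendsto_div_nhds_zero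
  have hmain : Tendsto (fun p : ℝ × ℝ => a.h30 + a.h21 * (p.2 / p.1) + a.h12 * (p.2 / p.1) ^ 2
      + a.h03 * (p.2 / p.1) ^ 3) (cubicNhds C) (𝓝 a.h30) := by
    have := (((tendsto_const_nhds (x := a.h30)).add (hτ.const_mul a.h21)).add
      ((hτ.pow 2).const_mul a.h12)).add ((hτ.pow 3).const_mul a.h03)
    simpa using this
  have := hrem.add hmain
  rw [zero_add] at this
  refine this.congr' ?_
  filter_upwards [eventually_mem_cubicNhds C] with p hp
  have := hp.1
  simp only [G]
  field_simp
  ring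

theorem tendsto_Y (C : ℝ) : Tendsto (fun p : ℝ × ℝ => a.Y p.1 p.2) (cubicNhds C) (𝓝 1) := by
  have := a.tendsto_cubicNhds_of_continuousOn a.contDiffOn_Y.continuousOn C
  simpa only [a.Y_origin] using this

theorem tendsto_two_mul_Ψ_div_cube (C : ℝ) :
    Tendsto (fun p : ℝ × ℝ => 2 * a.Ψ p.1 p.2 / p.1 ^ 3) (cubicNhds C) (𝓝 a.h30) := by
  have hb : ∀ᶠ p in cubicNhds C, |p.2 / p.1 ^ 3| ≤ |C| := by
    filter_upwards [eventually_mem_cubicNhds C] with p hp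
    have h3 : 0 < p.1 ^ 3 := pow_pos hp.1 3
    rw [abs_of_nonneg (div_nonneg hp.2.1 h3.le), div_le_iff₀ h3]
    exact hp.2.2.trans (mul_le_mul_of_nonneg_right (le_abs_self C) h3.le)
  have hY0 : Tendsto (fun p : ℝ × ℝ => (a.Y p.1 p.2) ^ 2 - 1) (cubicNhds C) (𝓝 0) := by
    simpa using ((a.tendsto_Y C).pow 2).sub_const 1
  have hmul : Tendsto (fun p : ℝ × ℝ => p.2 / p.1 ^ 3 * ((a.Y p.1 p.2) ^ 2 - 1))
      (cubicNhds C) (𝓝 0) :=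
    bdd_le_mul_tendsto_zero' |C| hb hY0
  have := (a.tendsto_G_div_cube C).sub hmul
  rw [sub_zero] at this
  refine this.congr fun p => ?_
  simp only [G]
  ring

theorem tendsto_Ψr_div_sq (C : ℝ) :
    Tendsto (fun p : ℝ × ℝ => deriv (fun s => a.Ψ s p.2) p.1 / p.1 ^ 2) (cubicNhds C)
      (𝓝 (3 * (a.h30 / 2))) := by
  have hsm := contDiffOn_deriv_fst a.isOpen_dom a.contDiffOn_Ψ
  have hline : ∀ᶠ x in 𝓝 (0:ℝ), (x, (0:ℝ)) ∈ a.dom :=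
    (by fun_prop : Continuous fun x : ℝ => (x, (0:ℝ))).continuousAt.preimage_mem_nhds
      (a.isOpen_dom.mem_nhds a.zero_mem_dom)
  have h1D : Tendsto (fun x => deriv (fun s => a.Ψ s 0) x / x ^ 2) (𝓝[>] 0)
      (𝓝 (3 * (a.h30 / 2))) := by
    have hsm2 := contDiffOn_deriv_fst (F := fun r R => deriv (fun s => a.Ψ s R) r)
      a.isOpen_dom hsm
    refine tendsto_deriv_div_sq (g := fun x => a.Ψ x 0)
      (g'' := deriv (deriv (fun s => a.Ψ s 0)))
      (c := deriv (deriv (deriv (fun s => a.Ψ s 0))) 0) ?_ ?_ ?_ a.Ψ_origin a.Ψr_origin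
      a.Ψrr_origin ?_
    · filter_upwards [hline] with x hx
      exact hasDerivAt_fst a.isOpen_dom a.contDiffOn_Ψ hx
    · filter_upwards [hline] with x hx
      exact hasDerivAt_fst (F := fun r R => deriv (fun s => a.Ψ s R) r) a.isOpen_dom hsm hx
    · exact hasDerivAt_fst (F := fun r R => deriv (fun t => deriv (fun s => a.Ψ s R) t) r)
        a.isOpen_dom hsm2 a.zero_mem_dom
    · have := ((a.tendsto_two_mul_Ψ_div_cube 0).comp
        (tendsto_cubic_curve le_rfl le_rfl)).div_const 2
      refine this.congr fun x => ?_
      simp only [Function.comp, zero_mul]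
      ring
  obtain ⟨K, t, ht, hK⟩ := ((hsm.contDiffAt (a.isOpen_dom.mem_nhds a.zero_mem_dom)).of_le
    (show (1 : WithTop ℕ∞) ≤ _ by norm_num)).exists_lipschitzOnWith
  have hlineL : Tendsto (fun p : ℝ × ℝ => (p.1, (0:ℝ))) (cubicNhds C) (𝓝 (0, 0)) :=
    (Continuous.tendsto' (by fun_prop) _ _ rfl).mono_left nhdsWithin_le_nhds
  have hdiff : Tendsto (fun p : ℝ × ℝ => (deriv (fun s => a.Ψ s p.2) p.1
      - deriv (fun s => a.Ψ s 0) p.1) / p.1 ^ 2) (cubicNhds C) (𝓝 0) := by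
    refine squeeze_zero_norm' ?_ (by simpa using (tendsto_snd_div_fst_sq C).const_mul (K:ℝ))
    filter_upwards [eventually_mem_cubicNhds C, nhdsWithin_le_nhds ht, hlineL ht] with p hp hp1 hp2
    have h := hK.dist_le_mul _ hp1 _ hp2
    have h2 : dist p (p.1, (0:ℝ)) = p.2 := by
      rw [Prod.dist_eq]
      simp [hp.2.1, abs_of_nonneg]
    rw [h2, Real.dist_eq] at h
    have h3 : (0:ℝ) < p.1 ^ 2 := pow_pos hp.1 2
    rw [norm_div, Real.norm_eq_abs, Real.norm_of_nonneg h3.le, ← mul_div_assoc]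
    gcongr
  have := hdiff.add (h1D.comp (tendsto_fst_cubicNhds C))
  rw [zero_add] at this
  refine this.congr fun p => ?_
  simp only [Function.comp]
  ring

theorem tendsto_Gr_div_sq (C : ℝ) :
    Tendsto (fun p : ℝ × ℝ => a.Gr p.1 p.2 / p.1 ^ 2) (cubicNhds C) (𝓝 (3 * a.h30)) := by
  have hYr := a.tendsto_cubicNhds_of_continuousOn
    (contDiffOn_deriv_fst a.isOpen_dom a.contDiffOn_Y).continuousOn C
  have := ((a.tendsto_Ψr_div_sq C).const_mul 2).add
    ((tendsto_snd_div_fst_sq C).mul (((a.tendsto_Y C).const_mul 2).mul hYr))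
  rw [zero_mul, add_zero, show 2 * (3 * (a.h30 / 2)) = 3 * a.h30 by ring] at this
  refine this.congr' ?_
  filter_upwards [a.mem_Icc_eventually_cubicNhds C] with p hp
  rw [a.Gr_eq (a.mem_dom ⟨hp.1.1.le, hp.1.2⟩ hp.2)]
  ring

theorem eventually_posDom (C : ℝ) : ∀ᶠ p in cubicNhds C, p ∈ a.posDom := by
  filter_upwards [a.mem_Icc_eventually_cubicNhds C,
    (a.tendsto_G_div_cube C).eventually (lt_mem_nhds a.α_pos)] with p hp hG
  have hp1 : p.1 ∈ Icc 0 a.r₀ := ⟨hp.1.1.le, hp.1.2⟩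
  exact ⟨a.mem_dom hp1 hp.2, (div_pos_iff_of_pos_right (pow_pos hp.1.1 3)).1 hG,
    a.Y_pos _ hp1 _ hp.2⟩

end ARSData

namespace ARSData

variable (a : ARSData)

theorem mem_posDom_of_mem_Icc {r : ℝ} (hr : r ∈ Ioc 0 a.r₀) (h0 : (r, (0:ℝ)) ∈ a.posDom) :
    ∀ R ∈ Icc 0 r, (r, R) ∈ a.posDom := by
  intro R hR
  rcases hR.1.eq_or_lt with h | h
  · exact h ▸ h0
  · have hr0 : r ∈ Icc 0 a.r₀ := Ioc_subset_Icc_self hr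
    have hR0 : R ∈ Icc 0 a.r₀ := ⟨hR.1, hR.2.trans hr.2⟩
    exact ⟨a.mem_dom hr0 hR0, a.G_pos r R h hR.2 hr.2, a.Y_pos r hr0 R hR0⟩

theorem continuousOn_shellKernel_snd {r : ℝ} (h : ∀ R ∈ Icc 0 r, (r, R) ∈ a.posDom) :
    ContinuousOn (a.shellKernel r) (Icc 0 r) :=
  a.continuousOn_shellKernel.comp (f := fun R : ℝ => (r, R)) (by fun_prop) h

theorem sqrtΔ_eq {r R : ℝ} (h : ∀ R ∈ Icc 0 r, (r, R) ∈ a.posDom) (hR : R ∈ Icc 0 r) :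
    a.sqrtΔ r R = -(∫ σ in R..r, a.shellKernel r σ) + a.H r r / a.Y r r := by
  rw [sqrtΔ, ← intervalIntegral.integral_neg]
  congr 1
  refine intervalIntegral.integral_congr fun σ hσ => ?_
  rw [uIcc_of_le hR.2] at hσ
  have hσ0 : 0 ≤ σ := hR.1.trans hσ.1
  exact a.inv_Y_mul_deriv_H hσ0 (h σ ⟨hσ0, hσ.2⟩)

theorem intervalIntegrable_shellKernel {r R₁ R₂ : ℝ} (h : ∀ R ∈ Icc 0 r, (r, R) ∈ a.posDom)
    (h₁ : R₁ ∈ Icc 0 r) (h₂ : R₂ ∈ Icc 0 r) :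
    IntervalIntegrable (a.shellKernel r) volume R₁ R₂ :=
  ((a.continuousOn_shellKernel_snd h).mono
    (uIcc_subset_Icc h₁ h₂)).intervalIntegrable

theorem sqrtΔ_sub_sqrtΔ {r R₁ R₂ : ℝ} (h : ∀ R ∈ Icc 0 r, (r, R) ∈ a.posDom)
    (h₁ : R₁ ∈ Icc 0 r) (h₂ : R₂ ∈ Icc 0 r) :
    a.sqrtΔ r R₂ - a.sqrtΔ r R₁ = ∫ σ in R₁..R₂, a.shellKernel r σ := by
  have hr : r ∈ Icc 0 r := ⟨h₁.1.trans h₁.2, le_rfl⟩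
  rw [a.sqrtΔ_eq h h₁, a.sqrtΔ_eq h h₂, ← intervalIntegral.integral_add_adjacent_intervals
    (a.intervalIntegrable_shellKernel h h₁ h₂) (a.intervalIntegrable_shellKernel h h₂ hr)]
  ring

theorem isCompact_triangle (ε b : ℝ) :
    IsCompact {p : ℝ × ℝ | p.1 ∈ Icc ε b ∧ p.2 ∈ Icc 0 p.1} := by
  refine ((isCompact_Icc (a := ε) (b := b)).prod
    (isCompact_Icc (a := 0) (b := b))).of_isClosed_subset ?_ ?_
  · exact (isClosed_Icc.preimage continuous_fst).inter
      ((isClosed_le continuous_const continuous_snd).inter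
        (isClosed_le continuous_snd continuous_fst))
  · exact fun p hp => ⟨hp.1, hp.2.1, hp.2.2.trans hp.1.2⟩

theorem continuousOn_sqrtΔ_of_pos {ε b : ℝ} (hε : 0 < ε) (hεb : ε ≤ b)
    (h : ∀ r ∈ Ioc 0 b, ∀ R ∈ Icc 0 r, (r, R) ∈ a.posDom) :
    ContinuousOn (fun p : ℝ × ℝ => a.sqrtΔ p.1 p.2)
      {p | p.1 ∈ Icc ε b ∧ p.2 ∈ Icc 0 p.1} := by
  set q : ℝ → ℝ := fun r => max ε (min r b) with hq
  have hqc : Continuous q := by fun_prop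
  have hqmem : ∀ r, q r ∈ Icc ε b := fun r => ⟨le_max_left _ _, max_le hεb (min_le_right _ _)⟩
  have hqid : ∀ r ∈ Icc ε b, q r = r := fun r hr => by simp [hq, hr.1, hr.2]
  have hqpos : ∀ r, q r ∈ Ioc 0 b := fun r => ⟨hε.trans_le (hqmem r).1, (hqmem r).2⟩
  set k : ℝ → ℝ → ℝ := fun r σ => a.shellKernel (q r) (max 0 (min σ (q r))) with hk
  have hkc : Continuous (Function.uncurry k) := by
    have h1 : Continuous fun p : ℝ × ℝ => (q p.1, max 0 (min p.2 (q p.1))) := by fun_prop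
    refine a.continuousOn_shellKernel.comp_continuous h1 fun p => ?_
    exact h _ (hqpos p.1) _ ⟨le_max_left _ _, max_le (hqpos p.1).1.le (min_le_right _ _)⟩
  have hint : Continuous fun p : ℝ × ℝ =>
      (∫ σ in (0:ℝ)..p.1, k p.1 σ) - ∫ σ in (0:ℝ)..p.2, k p.1 σ := by
    have h2 : Continuous (Function.uncurry fun (p : ℝ × ℝ) σ => k p.1 σ) :=
      hkc.comp (by fun_prop : Continuous fun z : (ℝ × ℝ) × ℝ => (z.1.1, z.2))
    exact (continuous_parametric_intervalIntegral_of_continuous h2 continuous_fst).sub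
      (continuous_parametric_intervalIntegral_of_continuous h2 continuous_snd)
  have hdiag : ContinuousOn (fun p : ℝ × ℝ => a.H p.1 p.1 / a.Y p.1 p.1)
      {p | p.1 ∈ Icc ε b ∧ p.2 ∈ Icc 0 p.1} := by
    have hm : MapsTo (fun p : ℝ × ℝ => (p.1, p.1)) {p | p.1 ∈ Icc ε b ∧ p.2 ∈ Icc 0 p.1}
        a.posDom := fun p hp =>
      h p.1 ⟨hε.trans_le hp.1.1, hp.1.2⟩ p.1 ⟨hε.le.trans hp.1.1, le_rfl⟩
    have hc : ContinuousOn (fun p : ℝ × ℝ => (p.1, p.1))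
        {p | p.1 ∈ Icc ε b ∧ p.2 ∈ Icc 0 p.1} := by fun_prop
    have hG := (a.contDiffOn_G.continuousOn.mono a.posDom_subset).comp hc hm
    have hY := (a.contDiffOn_Y.continuousOn.mono a.posDom_subset).comp hc hm
    exact (continuousOn_fst.div hG fun p hp => (hm hp).2.1.ne').sqrt.div hY
      fun p hp => (hm hp).2.2.ne'
  refine (hint.continuousOn.neg.add hdiag).congr fun p hp => ?_
  have hp1 : p.1 ∈ Ioc 0 b := ⟨hε.trans_le hp.1.1, hp.1.2⟩
  have hk' : ∀ σ ∈ Icc 0 p.1, k p.1 σ = a.shellKernel p.1 σ := fun σ hσ => by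
    simp only [hk, hqid _ hp.1]
    rw [min_eq_left hσ.2, max_eq_right hσ.1]
  have hzero : (0:ℝ) ∈ Icc 0 p.1 := ⟨le_rfl, hp1.1.le⟩
  have hlast : p.1 ∈ Icc 0 p.1 := ⟨hp1.1.le, le_rfl⟩
  have e : ∀ R ∈ Icc 0 p.1, ∫ σ in (0:ℝ)..R, k p.1 σ = ∫ σ in (0:ℝ)..R, a.shellKernel p.1 σ :=
    fun R hR => intervalIntegral.integral_congr fun σ hσ =>
      hk' σ (uIcc_subset_Icc hzero hR hσ)
  have hH := h p.1 hp1
  rw [a.sqrtΔ_eq hH hp.2]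
  simp only [Pi.add_apply, Pi.neg_apply]
  rw [e _ hlast, e _ hp.2, intervalIntegral.integral_interval_sub_left
    (a.intervalIntegrable_shellKernel hH hzero hlast)
    (a.intervalIntegrable_shellKernel hH hzero hp.2)]

theorem continuousOn_sqrtΔ {b : ℝ} (h : ∀ r ∈ Ioc 0 b, ∀ R ∈ Icc 0 r, (r, R) ∈ a.posDom) :
    ContinuousOn (fun p : ℝ × ℝ => a.sqrtΔ p.1 p.2)
      {p | p.1 ∈ Ioc 0 b ∧ p.2 ∈ Icc 0 p.1} := by
  intro p hp
  have h1 := hp.1.1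
  have hc := a.continuousOn_sqrtΔ_of_pos (half_pos h1) (by linarith [hp.1.2]) h p
    ⟨⟨by linarith, hp.1.2⟩, hp.2⟩
  refine hc.mono_of_mem_nhdsWithin (mem_nhdsWithin.2 ⟨{z | p.1 / 2 < z.1},
    isOpen_lt continuous_const continuous_fst, half_lt_self h1, ?_⟩)
  rintro z ⟨hz1, hz2⟩
  exact ⟨⟨le_of_lt hz1, hz2.1.2⟩, hz2.2⟩

theorem exists_bound_sqrtΔ_sub {ε b : ℝ} (hε : 0 < ε)
    (h : ∀ r ∈ Ioc 0 b, ∀ R ∈ Icc 0 r, (r, R) ∈ a.posDom) :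
    ∃ M, ∀ r ∈ Icc ε b, ∀ R₁ ∈ Icc 0 r, ∀ R₂ ∈ Icc 0 r,
      |a.sqrtΔ r R₂ - a.sqrtΔ r R₁| ≤ M * |R₂ - R₁| := by
  obtain ⟨M, hM⟩ := (isCompact_triangle ε b).exists_bound_of_continuousOn
    (a.continuousOn_shellKernel.mono fun p hp => h p.1 ⟨hε.trans_le hp.1.1, hp.1.2⟩ p.2 hp.2)
  refine ⟨M, fun r hr R₁ h₁ R₂ h₂ => ?_⟩
  rw [a.sqrtΔ_sub_sqrtΔ (h r ⟨hε.trans_le hr.1, hr.2⟩) h₁ h₂]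
  exact intervalIntegral.norm_integral_le_of_norm_le_const (E := ℝ) (C := M) fun σ hσ =>
    hM (r, σ) ⟨hr, uIcc_subset_Icc h₁ h₂ (uIoc_subset_uIcc hσ)⟩

/-- The right-hand side of the radial null geodesic equation. -/
def nullSlope (r R : ℝ) : ℝ := a.u r R * a.sqrtΔ r R * (a.Y r R - a.u r R)

theorem contDiffOn_u_mul :
    ContDiffOn ℝ 1 (fun p : ℝ × ℝ => a.u p.1 p.2 * (a.Y p.1 p.2 - a.u p.1 p.2))
      (a.posDom ∩ {p | 0 < p.2}) := by
  have hsub : a.posDom ∩ {p : ℝ × ℝ | 0 < p.2} ⊆ a.dom := fun p hp => hp.1.1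
  have hle : (1 : WithTop ℕ∞) ≤ ((⊤ : ℕ∞) : WithTop ℕ∞) := by norm_num
  have hG := (a.contDiffOn_G.of_le hle).mono hsub
  have hY := (a.contDiffOn_Y.of_le hle).mono hsub
  have hu : ContDiffOn ℝ 1 (fun p : ℝ × ℝ => a.u p.1 p.2) (a.posDom ∩ {p | 0 < p.2}) :=
    (hG.div contDiffOn_snd fun p hp => ne_of_gt hp.2).sqrt
      fun p hp => (div_pos hp.1.2.1 hp.2).ne'
  exact hu.mul (hY.sub hu)

theorem continuousOn_nullSlope {b : ℝ}
    (h : ∀ r ∈ Ioc 0 b, ∀ R ∈ Icc 0 r, (r, R) ∈ a.posDom) :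
    ContinuousOn (fun p : ℝ × ℝ => a.nullSlope p.1 p.2)
      {p | p.1 ∈ Ioc 0 b ∧ 0 < p.2 ∧ p.2 ≤ p.1} := by
  have h1 := a.contDiffOn_u_mul.continuousOn.mono
    (t := {p : ℝ × ℝ | p.1 ∈ Ioc 0 b ∧ 0 < p.2 ∧ p.2 ≤ p.1})
    fun p hp => ⟨h p.1 hp.1 p.2 ⟨hp.2.1.le, hp.2.2⟩, hp.2.1⟩
  have h2 := (a.continuousOn_sqrtΔ h).mono
    (t := {p : ℝ × ℝ | p.1 ∈ Ioc 0 b ∧ 0 < p.2 ∧ p.2 ≤ p.1})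
    fun p hp => ⟨hp.1, hp.2.1.le, hp.2.2⟩
  refine (h1.mul h2).congr fun p _ => ?_
  simp only [nullSlope, Pi.mul_apply]
  ring

theorem exists_lipschitzOnWith_nullSlope {A B : ℝ → ℝ} (hA : Continuous A) (hB : Continuous B)
    {ε b : ℝ} (hε : 0 < ε) (hpos : ∀ r ∈ Icc ε b, 0 < A r) (hle : ∀ r ∈ Icc ε b, B r ≤ r)
    (h : ∀ r ∈ Ioc 0 b, ∀ R ∈ Icc 0 r, (r, R) ∈ a.posDom) :
    ∃ K : NNReal, ∀ r ∈ Icc ε b, LipschitzOnWith K (a.nullSlope r) (Icc (A r) (B r)) := by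
  set S : Set (ℝ × ℝ) := {p | p.1 ∈ Icc ε b ∧ p.2 ∈ Icc (A p.1) (B p.1)} with hS
  have htri : ∀ p ∈ S, p.1 ∈ Icc ε b ∧ p.2 ∈ Icc 0 p.1 := fun p hp =>
    ⟨hp.1, (hpos _ hp.1).le.trans hp.2.1, hp.2.2.trans (hle _ hp.1)⟩
  have hcomp : IsCompact S := by
    refine (isCompact_triangle ε b).of_isClosed_subset ?_ htri
    exact (isClosed_Icc.preimage continuous_fst).inter
      ((isClosed_le (hA.comp continuous_fst) continuous_snd).inter
        (isClosed_le continuous_snd (hB.comp continuous_fst)))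
  have hmem : S ⊆ a.posDom ∩ {p | 0 < p.2} := fun p hp =>
    ⟨h p.1 ⟨hε.trans_le hp.1.1, hp.1.2⟩ p.2 (htri p hp).2, (hpos _ hp.1).trans_le hp.2.1⟩
  have hopen : IsOpen (a.posDom ∩ {p : ℝ × ℝ | 0 < p.2}) :=
    a.isOpen_posDom.inter (isOpen_lt continuous_const continuous_snd)
  set w : ℝ × ℝ → ℝ := fun p => a.u p.1 p.2 * (a.Y p.1 p.2 - a.u p.1 p.2) with hw
  have hlocal : LocallyLipschitzOn S w := by
    intro p hp
    obtain ⟨K, t, ht, hK⟩ :=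
      (a.contDiffOn_u_mul.contDiffAt (hopen.mem_nhds (hmem hp))).exists_lipschitzOnWith
    exact ⟨K, t, nhdsWithin_le_nhds ht, hK⟩
  obtain ⟨K₁, hK₁⟩ := hlocal.exists_lipschitzOnWith_of_compact hcomp
  obtain ⟨W, hW⟩ := hcomp.exists_bound_of_continuousOn hlocal.continuousOn
  obtain ⟨M, hM⟩ := a.exists_bound_sqrtΔ_sub hε h
  obtain ⟨D, hD⟩ := hcomp.exists_bound_of_continuousOn
    ((a.continuousOn_sqrtΔ h).mono fun p hp =>
      ⟨⟨hε.trans_le hp.1.1, hp.1.2⟩, (htri p hp).2⟩)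
  refine ⟨(W * M + D * K₁).toNNReal, fun r hr => LipschitzOnWith.of_dist_le_mul
    fun R₂ h₂ R₁ h₁ => ?_⟩
  have p₁ : (r, R₁) ∈ S := ⟨hr, h₁⟩
  have p₂ : (r, R₂) ∈ S := ⟨hr, h₂⟩
  have e1 := hK₁.dist_le_mul _ p₂ _ p₁
  have e2 := hM r hr R₁ (htri _ p₁).2 R₂ (htri _ p₂).2
  have e3 := hW _ p₂
  have e4 := hD _ p₁
  simp only [Prod.dist_eq, dist_self, Real.dist_eq, Real.norm_eq_abs] at e1 e2 e3 e4 ⊢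
  rw [max_eq_right (abs_nonneg _)] at e1
  have split : a.nullSlope r R₂ - a.nullSlope r R₁ =
      w (r, R₂) * (a.sqrtΔ r R₂ - a.sqrtΔ r R₁) + a.sqrtΔ r R₁ * (w (r, R₂) - w (r, R₁)) := by
    simp only [nullSlope, hw]
    ring
  rw [split]
  calc _ ≤ |w (r, R₂)| * |a.sqrtΔ r R₂ - a.sqrtΔ r R₁|
        + |a.sqrtΔ r R₁| * |w (r, R₂) - w (r, R₁)| := by
        rw [← abs_mul, ← abs_mul]
        exact abs_add_le _ _
    _ ≤ W * (M * |R₂ - R₁|) + D * (K₁ * |R₂ - R₁|) :=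
        add_le_add (mul_le_mul e3 e2 (abs_nonneg _) ((abs_nonneg _).trans e3))
          (mul_le_mul e4 e1 (abs_nonneg _) ((abs_nonneg _).trans e4))
    _ = (W * M + D * K₁) * |R₂ - R₁| := by ring
    _ ≤ _ := mul_le_mul_of_nonneg_right (le_coe_toNNReal _) (abs_nonneg _)

end ARSData

theorem eventually_mul_cube_lt (C : ℝ) : ∀ᶠ r in 𝓝[>] (0:ℝ), C * r ^ 3 < r := by
  have h : Tendsto (fun r : ℝ => C * r ^ 2) (𝓝[>] 0) (𝓝 0) :=
    (Continuous.tendsto' (by fun_prop) _ _ (by simp)).mono_left nhdsWithin_le_nhds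
  filter_upwards [h.eventually (gt_mem_nhds one_pos), self_mem_nhdsWithin] with r h1 hr
  calc C * r ^ 3 = C * r ^ 2 * r := by ring
    _ < 1 * r := mul_lt_mul_of_pos_right h1 hr
    _ = r := one_mul r

namespace ARSData

variable (a : ARSData)

theorem Y_lt_u {r R : ℝ} (hR : 0 < R) (hΨ : R < 2 * a.Ψ r R) (hY : 0 < a.Y r R) :
    a.Y r R < a.u r R := by
  rw [u, lt_sqrt hY.le, lt_div_iff₀ hR, G]
  linarith

theorem u_eq_Y {r R : ℝ} (hR : 0 < R) (hΨ : R = 2 * a.Ψ r R) (hY : 0 < a.Y r R) :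
    a.u r R = a.Y r R := by
  have : a.G r R / R = a.Y r R ^ 2 := by
    rw [div_eq_iff hR.ne', G, ← hΨ]
    ring
  rw [u, this, sqrt_sq hY.le]

theorem strictMonoOn_sub_two_mul_Ψ {r : ℝ} (hr : r ∈ Icc 0 a.r₀)
    (h : ∀ R ∈ Icc 0 r, deriv (fun s => a.Ψ r s) R < 1 / 2) :
    StrictMonoOn (fun R => R - 2 * a.Ψ r R) (Icc 0 r) := by
  have hd : ∀ R ∈ Icc 0 r, HasDerivAt (fun R => R - 2 * a.Ψ r R)
      (1 - 2 * deriv (fun s => a.Ψ r s) R) R := fun R hR =>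
    (hasDerivAt_id R).sub ((hasDerivAt_snd a.isOpen_dom a.contDiffOn_Ψ
      (a.mem_dom hr ⟨hR.1, hR.2.trans hr.2⟩)).const_mul 2)
  refine strictMonoOn_of_deriv_pos (convex_Icc 0 r)
    (fun R hR => (hd R hR).continuousAt.continuousWithinAt) fun R hR => ?_
  have hR' := interior_subset hR
  rw [(hd R hR').deriv]
  linarith [h R hR']

theorem eventually_ΨR_lt :
    ∀ᶠ r in 𝓝[>] (0:ℝ), ∀ R ∈ Icc 0 r, deriv (fun s => a.Ψ r s) R < 1 / 2 := by
  have hc := (contDiffOn_deriv_snd a.isOpen_dom a.contDiffOn_Ψ).continuousOn.continuousAt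
    (a.isOpen_dom.mem_nhds a.zero_mem_dom)
  have h0 : deriv (fun s => a.Ψ ((0:ℝ), (0:ℝ)).1 s) ((0:ℝ), (0:ℝ)).2 < 1 / 2 := by
    simp only [a.ΨR_origin]
    norm_num
  obtain ⟨δ, hδ, hball⟩ := Metric.eventually_nhds_iff.1 (hc.eventually_lt continuousAt_const h0)
  filter_upwards [Ioo_mem_nhdsGT hδ] with r hr R hR
  refine hball (y := (r, R)) ?_
  rw [Prod.dist_eq, max_lt_iff, Real.dist_eq, Real.dist_eq]
  simp only [sub_zero]
  rw [abs_of_pos hr.1, abs_of_nonneg hR.1]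
  exact ⟨hr.2, hR.2.trans_lt hr.2⟩

theorem integral_sqrt_eq {b : ℝ} (hb : 0 ≤ b) : ∫ x in (0:ℝ)..b, √x = 2 / 3 * (b * √b) := by
  simp_rw [sqrt_eq_rpow]
  rw [integral_rpow (Or.inl (by norm_num))]
  rcases hb.eq_or_lt with rfl | hb
  · norm_num
  · rw [show (1:ℝ) / 2 + 1 = 1 + 1 / 2 by ring, rpow_add hb, rpow_one, zero_rpow (by norm_num)]
    ring

theorem eventually_le_shellKernel {m : ℝ} (hm : m < 3 / (2 * √a.h30)) (C : ℝ) :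
    ∀ᶠ p in cubicNhds C, m * √p.2 / (p.1 * √(p.1 ^ 3)) ≤ a.shellKernel p.1 p.2 := by
  have hα := a.α_pos
  have hs := sqrt_pos.2 hα
  have hlim := (a.tendsto_Gr_div_sq C).div
    ((((a.tendsto_G_div_cube C).sqrt.const_mul 2).mul (a.tendsto_G_div_cube C)).mul
      (a.tendsto_Y C)) (by positivity)
  have hval : 3 * a.h30 / (2 * √a.h30 * a.h30 * 1) = 3 / (2 * √a.h30) := by
    field_simp
  rw [hval] at hlim
  filter_upwards [hlim.eventually (lt_mem_nhds hm), a.eventually_posDom C,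
    eventually_mem_cubicNhds C] with p hmp hpos hp
  have hr := hp.1
  have hG := hpos.2.1
  have hY := hpos.2.2
  have hr3 : 0 < p.1 ^ 3 := pow_pos hr 3
  have key : a.shellKernel p.1 p.2 = √p.2 / (p.1 * √(p.1 ^ 3)) *
      (a.Gr p.1 p.2 / p.1 ^ 2 / (2 * √(a.G p.1 p.2 / p.1 ^ 3) * (a.G p.1 p.2 / p.1 ^ 3)
        * a.Y p.1 p.2)) := by
    have h1 : 0 < √(a.G p.1 p.2) := sqrt_pos.2 hG
    have h2 : 0 < √(p.1 ^ 3) := sqrt_pos.2 hr3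
    rw [sqrt_div hG.le, shellKernel]
    field_simp
  rw [key, mul_comm m, mul_div_right_comm]
  exact mul_le_mul_of_nonneg_left hmp.le (by positivity)

theorem eventually_le_sqrtΔ_sub {m C : ℝ} (hm : m < 3 / (2 * √a.h30)) (hC : 0 ≤ C) :
    ∀ᶠ r in 𝓝[>] (0:ℝ), m * (2 / 3 * (C * √C)) * r ^ 2 ≤
      a.sqrtΔ r (C * r ^ 3) - a.sqrtΔ r 0 := by
  filter_upwards [eventually_forall_of_cubicNhds (a.eventually_le_shellKernel hm C),
    eventually_forall_of_cubicNhds (a.eventually_posDom C), eventually_mul_cube_lt C,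
    Ioc_mem_nhdsGT a.r₀_pos] with r hk hp hlt hr
  have hr3 : 0 < r ^ 3 := pow_pos hr.1 3
  have hb : 0 ≤ C * r ^ 3 := by positivity
  have hpos := a.mem_posDom_of_mem_Icc hr (hp 0 ⟨le_rfl, hb⟩)
  have h0 : (0:ℝ) ∈ Icc 0 r := ⟨le_rfl, hr.1.le⟩
  have h1 : C * r ^ 3 ∈ Icc 0 r := ⟨hb, hlt.le⟩
  have hs : 0 < √(r ^ 3) := sqrt_pos.2 hr3
  rw [a.sqrtΔ_sub_sqrtΔ hpos h0 h1]
  calc m * (2 / 3 * (C * √C)) * r ^ 2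
      = ∫ σ in (0:ℝ)..C * r ^ 3, m / (r * √(r ^ 3)) * √σ := by
        rw [intervalIntegral.integral_const_mul, integral_sqrt_eq hb, sqrt_mul hC]
        have := hr.1
        field_simp
    _ ≤ _ := by
        refine intervalIntegral.integral_mono_on hb
          (Continuous.intervalIntegrable (by fun_prop) _ _)
          (a.intervalIntegrable_shellKernel hpos h0 h1) fun σ hσ => ?_
        rw [div_mul_eq_mul_div]
        exact hk σ hσ

theorem tendsto_u_cubic_curve {y : ℝ} (hy : 0 < y) :
    Tendsto (fun r => a.u r (y ^ 2 * a.h30 * r ^ 3)) (𝓝[>] 0) (𝓝 y⁻¹) := by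
  have hα := a.α_pos
  have hC : 0 < y ^ 2 * a.h30 := by positivity
  have h := (((a.tendsto_G_div_cube _).comp (tendsto_cubic_curve hC.le le_rfl)).div_const
    (y ^ 2 * a.h30)).sqrt
  have e : √(a.h30 / (y ^ 2 * a.h30)) = y⁻¹ := by
    rw [show a.h30 / (y ^ 2 * a.h30) = y⁻¹ ^ 2 by field_simp, sqrt_sq (by positivity)]
  rw [e] at h
  refine h.congr fun r => ?_
  simp only [Function.comp, u, div_div]
  congr 2
  ring

/-- The cubic `y² α r³` is a strict subsolution of the null geodesic equation as soon as
`√Δ(r,0)` exceeds `l r²` for some `l` above the threshold determined by `y`. -/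
theorem eventually_lt_nullSlope {l y : ℝ} (hy : 1 < y)
    (hl : ∀ᶠ r in 𝓝[>] (0:ℝ), l * r ^ 2 ≤ a.sqrtΔ r 0)
    (hly : 3 * y ^ 4 / (y - 1) * a.h30 < l + a.h30 * y ^ 3) :
    ∀ᶠ r in 𝓝[>] (0:ℝ), 3 * (y ^ 2 * a.h30) * r ^ 2 < a.nullSlope r (y ^ 2 * a.h30 * r ^ 3) := by
  have hα := a.α_pos
  have hy0 : 0 < y := one_pos.trans hy
  set C := y ^ 2 * a.h30 with hCdef
  have hC : 0 < C := by positivity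
  have hsα := sqrt_pos.2 hα
  have hw := (a.tendsto_u_cubic_curve hy0).mul
    (((a.tendsto_Y C).comp (tendsto_cubic_curve hC.le le_rfl)).sub (a.tendsto_u_cubic_curve hy0))
  have hwpos : 0 < y⁻¹ * (1 - y⁻¹) := mul_pos (by positivity) (sub_pos.2 (inv_lt_one_of_one_lt₀ hy))
  have hsC : √C = y * √a.h30 := by rw [hCdef, sqrt_mul (by positivity), sqrt_sq hy0.le]
  have hthr : 3 * C < y⁻¹ * (1 - y⁻¹) *
      (l + 3 / (2 * √a.h30) * (2 / 3 * (C * √C))) := by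
    have e1 : 3 / (2 * √a.h30) * (2 / 3 * (C * √C)) = a.h30 * y ^ 3 := by
      rw [hsC, hCdef]
      field_simp
    have e2 : 3 * C = y⁻¹ * (1 - y⁻¹) * (3 * y ^ 4 / (y - 1) * a.h30) := by
      have : y - 1 ≠ 0 := (sub_pos.2 hy).ne'
      rw [hCdef]
      field_simp
    rw [e1, e2]
    exact mul_lt_mul_of_pos_left hly hwpos
  obtain ⟨m, hm, hmlt⟩ : ∃ m, 3 * C < y⁻¹ * (1 - y⁻¹) * (l + m * (2 / 3 * (C * √C))) ∧
      m < 3 / (2 * √a.h30) := by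
    have hc : Continuous fun m : ℝ => y⁻¹ * (1 - y⁻¹) * (l + m * (2 / 3 * (C * √C))) := by
      fun_prop
    exact (((hc.continuousAt.eventually (lt_mem_nhds hthr)).filter_mono
      (nhdsWithin_le_nhds (s := Iio _))).and self_mem_nhdsWithin).exists
  filter_upwards [(hw.mul_const (l + m * (2 / 3 * (C * √C)))).eventually (lt_mem_nhds hm),
    hw.eventually (lt_mem_nhds hwpos), hl, a.eventually_le_sqrtΔ_sub hmlt hC.le,
    self_mem_nhdsWithin] with r h1 h2 h3 h4 hr
  have hr2 : (0:ℝ) < r ^ 2 := pow_pos hr 2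
  simp only [Function.comp] at h1 h2
  calc 3 * C * r ^ 2 < a.u r (C * r ^ 3) * (a.Y r (C * r ^ 3) - a.u r (C * r ^ 3))
        * (l + m * (2 / 3 * (C * √C))) * r ^ 2 := mul_lt_mul_of_pos_right h1 hr2
    _ = a.u r (C * r ^ 3) * (a.Y r (C * r ^ 3) - a.u r (C * r ^ 3))
        * (l * r ^ 2 + m * (2 / 3 * (C * √C)) * r ^ 2) := by ring
    _ ≤ a.u r (C * r ^ 3) * (a.Y r (C * r ^ 3) - a.u r (C * r ^ 3)) * a.sqrtΔ r (C * r ^ 3) :=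
        mul_le_mul_of_nonneg_left (by linarith) h2.le
    _ = a.nullSlope r (C * r ^ 3) := by
        simp only [nullSlope]
        ring

theorem eventually_abs_integral_H_le {C : ℝ} (hC : 0 ≤ C) :
    ∀ᶠ r in 𝓝[>] (0:ℝ), ∀ R ∈ Icc 0 (C * r ^ 3),
      |∫ σ in (0:ℝ)..R, a.H r σ| ≤ √(2 * C / a.h30) * R := by
  have hα := a.α_pos
  filter_upwards [eventually_forall_of_cubicNhds ((a.tendsto_G_div_cube C).eventually
    (lt_mem_nhds (half_lt_self hα))), self_mem_nhdsWithin] with r hG hr R hR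
  have hr3 : (0:ℝ) < r ^ 3 := pow_pos hr 3
  have := intervalIntegral.norm_integral_le_of_norm_le_const (E := ℝ) (a := 0) (b := R)
    (f := a.H r) (C := √(2 * C / a.h30)) fun σ hσ => ?_
  · rwa [sub_zero, abs_of_nonneg hR.1] at this
  · rw [uIoc_of_le hR.1] at hσ
    have hσC : σ ≤ C * r ^ 3 := hσ.2.trans hR.2
    have h := hG σ ⟨hσ.1.le, hσC⟩
    rw [lt_div_iff₀ hr3] at h
    rw [H, Real.norm_of_nonneg (sqrt_nonneg _)]
    refine sqrt_le_sqrt ?_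
    have hGpos : 0 < a.G r σ := lt_trans (by positivity) h
    rw [div_le_div_iff₀ hGpos hα]
    nlinarith

end ARSData

theorem one_lt_half_add_sqrt_three : 1 < (1 + √3) / 2 := by
  have : 1 < √3 := by rw [lt_sqrt] <;> norm_num
  linarith

theorem ξc_add_pow_three :
    ξc + ((1 + √3) / 2) ^ 3 = 3 * ((1 + √3) / 2) ^ 4 / ((1 + √3) / 2 - 1) := by
  have h1 : (1 + √3) / 2 - 1 ≠ 0 := (sub_pos.2 one_lt_half_add_sqrt_three).ne'
  have h3 : √3 ^ 2 = 3 := sq_sqrt (by norm_num)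
  rw [eq_div_iff h1, ξc]
  grind

namespace CollapsingARS

variable (c : CollapsingARS)

theorem eventually_le_sqrtΔ_zero {m : ℝ} (hm : m < c.ξ) :
    ∀ᶠ r in 𝓝[>] (0:ℝ), m * r ^ (c.n - 1) ≤ c.sqrtΔ r 0 := by
  filter_upwards [c.sqrtΔ_asym.bound (sub_pos.2 hm), self_mem_nhdsWithin] with r h hr
  have hp : (0:ℝ) < r ^ (c.n - 1) := pow_pos hr _
  rw [Real.norm_of_nonneg hp.le, Real.norm_eq_abs] at h
  linarith [neg_abs_le (c.sqrtΔ r 0 - c.ξ * r ^ (c.n - 1))]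

theorem exists_supercritical_bound (h : c.n = 1 ∨ c.n = 2 ∨ (c.n = 3 ∧ c.ξ / c.h30 > ξc)) :
    ∃ l > ξc * c.h30, ∀ᶠ r in 𝓝[>] (0:ℝ), l * r ^ 2 ≤ c.sqrtΔ r 0 := by
  have low : c.n - 1 ≤ 1 → ∃ l > ξc * c.h30, ∀ᶠ r in 𝓝[>] (0:ℝ), l * r ^ 2 ≤ c.sqrtΔ r 0 := by
    intro hn
    refine ⟨ξc * c.h30 + 1, lt_add_one _, ?_⟩
    have hξ := c.ξ_pos
    have hlim : Tendsto (fun r : ℝ => (ξc * c.h30 + 1) * r) (𝓝[>] 0) (𝓝 0) :=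
      (Continuous.tendsto' (by fun_prop) _ _ (by simp)).mono_left nhdsWithin_le_nhds
    filter_upwards [c.eventually_le_sqrtΔ_zero (half_lt_self hξ), Ioc_mem_nhdsGT one_pos,
      hlim.eventually (gt_mem_nhds (half_pos hξ))] with r h1 hr h2
    have hpow : r ^ 1 ≤ r ^ (c.n - 1) := pow_le_pow_of_le_one hr.1.le hr.2 hn
    calc (ξc * c.h30 + 1) * r ^ 2 = (ξc * c.h30 + 1) * r * r ^ 1 := by ring
      _ ≤ c.ξ / 2 * r ^ 1 := mul_le_mul_of_nonneg_right h2.le (pow_nonneg hr.1.le 1)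
      _ ≤ c.ξ / 2 * r ^ (c.n - 1) := mul_le_mul_of_nonneg_left hpow (half_pos hξ).le
      _ ≤ _ := h1
  rcases h with h | h | ⟨h, hξ⟩
  · exact low (by omega)
  · exact low (by omega)
  · rw [gt_iff_lt, lt_div_iff₀ c.α_pos] at hξ
    obtain ⟨l, hl, hlξ⟩ := exists_between hξ
    have := c.eventually_le_sqrtΔ_zero hlξ
    rw [h] at this
    exact ⟨l, hl, this⟩

end CollapsingARS

namespace ARSData

variable (a : ARSData)

/-- A curve solving the null geodesic equation that starts at `r = b` above the apparent horizon
stays above it when followed back towards `r = 0`. -/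
theorem horizon_lt_of_hasDerivAt {γ : ℝ → ℝ} {b : ℝ} (hb : b ≤ a.r₀)
    (hγc : ContinuousOn γ (Ioc 0 b))
    (hγ : ∀ t ∈ Ioo 0 b, HasDerivAt γ (a.nullSlope t (γ t)) t)
    (hmem : ∀ t ∈ Ioc 0 b, γ t ∈ Ioc 0 t)
    (hΨr : ∀ t ∈ Ioc 0 b, 0 < deriv (fun s => a.Ψ s (γ t)) t)
    (hend : 2 * a.Ψ b (γ b) < γ b) :
    ∀ t ∈ Ioc 0 b, 2 * a.Ψ t (γ t) < γ t := by
  have hIcc : ∀ t ∈ Ioc 0 b, t ∈ Icc 0 a.r₀ ∧ γ t ∈ Icc 0 a.r₀ := fun t ht =>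
    ⟨⟨ht.1.le, ht.2.trans hb⟩, (hmem t ht).1.le, (hmem t ht).2.trans (ht.2.trans hb)⟩
  have hdom : ∀ t ∈ Ioc 0 b, (t, γ t) ∈ a.dom := fun t ht => a.mem_dom (hIcc t ht).1 (hIcc t ht).2
  have hcont : ContinuousOn (fun t => γ t - 2 * a.Ψ t (γ t)) (Ioc 0 b) :=
    hγc.sub (continuousOn_const.mul
      (a.contDiffOn_Ψ.continuousOn.comp (continuousOn_id.prodMk hγc) hdom))
  have := pos_of_deriv_neg_at_zeros hcont (sub_pos.2 hend) fun t ht h0 => ?_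
  · exact fun t ht => sub_pos.1 (this t ht)
  have ht' := Ioo_subset_Ioc_self ht
  have hslope : a.nullSlope t (γ t) = 0 := by
    rw [nullSlope, a.u_eq_Y (hmem t ht').1 (sub_eq_zero.1 h0)
      (a.Y_pos _ (hIcc t ht').1 _ (hIcc t ht').2), sub_self, mul_zero]
  have hd := hγ t ht
  rw [hslope] at hd
  have h := hd.sub ((hasDerivAt_along_graph a.isOpen_dom a.contDiffOn_Ψ (hdom t ht') hd).const_mul 2)
  exact ⟨_, by linarith [hΨr t ht'], h⟩

theorem eventually_lt_two_mul_Ψ {c : ℝ} (hc : 0 ≤ c) (h : c < a.h30) :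
    ∀ᶠ r in 𝓝[>] (0:ℝ), c * r ^ 3 < 2 * a.Ψ r (c * r ^ 3) := by
  filter_upwards [((a.tendsto_two_mul_Ψ_div_cube c).comp
    (tendsto_cubic_curve hc le_rfl)).eventually (lt_mem_nhds h), self_mem_nhdsWithin] with r h1 hr
  exact (lt_div_iff₀ (pow_pos hr 3)).1 h1

theorem eventually_two_mul_Ψ_lt {c : ℝ} (h : a.h30 < c) :
    ∀ᶠ r in 𝓝[>] (0:ℝ), 2 * a.Ψ r (c * r ^ 3) < c * r ^ 3 := by
  filter_upwards [((a.tendsto_two_mul_Ψ_div_cube c).comp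
    (tendsto_cubic_curve (a.α_pos.trans h).le le_rfl)).eventually (gt_mem_nhds h),
    self_mem_nhdsWithin] with r h1 hr
  exact (div_lt_iff₀ (pow_pos hr 3)).1 h1

theorem eventually_Ψr_pos (C : ℝ) :
    ∀ᶠ r in 𝓝[>] (0:ℝ), ∀ R ∈ Icc 0 (C * r ^ 3), 0 < deriv (fun s => a.Ψ s R) r := by
  have hα : 0 < 3 * (a.h30 / 2) := by linarith [a.α_pos]
  filter_upwards [eventually_forall_of_cubicNhds ((a.tendsto_Ψr_div_sq C).eventually
    (lt_mem_nhds hα)), self_mem_nhdsWithin] with r h hr R hR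
  exact (div_pos_iff_of_pos_right (pow_pos hr 2)).1 (h R hR)

end ARSData

namespace CollapsingARS

variable (c : CollapsingARS)

theorem exists_geodesic {C : ℝ} (hC : 3 / 2 * c.h30 < C)
    (hbar : ∀ᶠ r in 𝓝[>] (0:ℝ), 3 * C * r ^ 2 < c.nullSlope r (C * r ^ 3)) :
    ∃ b ∈ Ioc 0 c.r₀, ∃ γ : ℝ → ℝ, (∀ t ∈ Ioo 0 b, HasDerivAt γ (c.nullSlope t (γ t)) t) ∧
      ∀ t ∈ Ioc 0 b, c.Rh t < γ t ∧ γ t < t ∧ γ t ∈ Icc 0 (C * t ^ 3) := by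
  have hα := c.α_pos
  have hC0 : 0 < C := by linarith
  have hev := (((((((hbar.and (c.eventually_Ψr_pos C)).and
    (c.eventually_lt_two_mul_Ψ (half_pos hα).le (half_lt_self hα))).and
    (c.eventually_two_mul_Ψ_lt (c := 3 / 2 * c.h30) (by linarith))).and
    c.eventually_ΨR_lt).and (eventually_forall_of_cubicNhds (c.eventually_posDom C))).and
    (eventually_mul_cube_lt C)).and (Ioc_mem_nhdsGT c.r₀_pos))
  obtain ⟨b, hb, hsub⟩ := mem_nhdsGT_iff_exists_Ioc_subset.1 hev
  replace hb : 0 < b := hb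
  have hbr : b ≤ c.r₀ := (hsub ⟨hb, le_rfl⟩).2.2
  have hr₀ : ∀ t ∈ Ioc 0 b, t ∈ Ioc 0 c.r₀ := fun t ht => ⟨ht.1, ht.2.trans hbr⟩
  have hslope : ∀ t ∈ Ioc 0 b, 3 * C * t ^ 2 < c.nullSlope t (C * t ^ 3) :=
    fun t ht => (hsub ht).1.1.1.1.1.1.1
  have hΨr : ∀ t ∈ Ioc 0 b, ∀ R ∈ Icc 0 (C * t ^ 3), 0 < deriv (fun s => c.Ψ s R) t :=
    fun t ht => (hsub ht).1.1.1.1.1.1.2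
  have hlow : ∀ t ∈ Ioc 0 b, c.h30 / 2 * t ^ 3 < 2 * c.Ψ t (c.h30 / 2 * t ^ 3) :=
    fun t ht => (hsub ht).1.1.1.1.1.2
  have hmid : ∀ t ∈ Ioc 0 b, 2 * c.Ψ t (3 / 2 * c.h30 * t ^ 3) < 3 / 2 * c.h30 * t ^ 3 :=
    fun t ht => (hsub ht).1.1.1.1.2
  have hmono : ∀ t ∈ Ioc 0 b, StrictMonoOn (fun R => R - 2 * c.Ψ t R) (Icc 0 t) :=
    fun t ht => c.strictMonoOn_sub_two_mul_Ψ (Ioc_subset_Icc_self (hr₀ t ht))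
      (hsub ht).1.1.1.2
  have hCt : ∀ t ∈ Ioc 0 b, C * t ^ 3 < t := fun t ht => (hsub ht).1.2
  have hpos : ∀ t ∈ Ioc 0 b, ∀ R ∈ Icc 0 t, (t, R) ∈ c.posDom := fun t ht =>
    c.mem_posDom_of_mem_Icc (hr₀ t ht)
      ((hsub ht).1.1.2 0 ⟨le_rfl, mul_nonneg hC0.le (pow_nonneg ht.1.le 3)⟩)
  have hcube : ∀ k t : ℝ, HasDerivAt (fun t => k * t ^ 3) (3 * k * t ^ 2) t := fun k t =>
    ((hasDerivAt_pow 3 t).const_mul k).congr_deriv (by push_cast; ring)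
  have hord : ∀ t ∈ Ioc 0 b, 0 < c.h30 / 2 * t ^ 3 ∧
      c.h30 / 2 * t ^ 3 < 3 / 2 * c.h30 * t ^ 3 ∧ 3 / 2 * c.h30 * t ^ 3 < C * t ^ 3 := by
    intro t ht
    have h3 : 0 < t ^ 3 := pow_pos ht.1 3
    exact ⟨by positivity, mul_lt_mul_of_pos_right (by linarith) h3,
      mul_lt_mul_of_pos_right hC h3⟩
  have hbmem : b ∈ Ioc 0 b := ⟨hb, le_rfl⟩
  obtain ⟨γ, hγb, hγc, hγd, hγm⟩ := exists_solution_between hb (hcube (c.h30 / 2)) (hcube C)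
    (f := c.nullSlope) (x₀ := 3 / 2 * c.h30 * b ^ 3)
    (fun t ht => ((hord t ht).2.1.trans (hord t ht).2.2).le)
    ((c.continuousOn_nullSlope hpos).mono fun p hp =>
      ⟨hp.1, (hord _ hp.1).1.trans_le hp.2.1, hp.2.2.trans (hCt _ hp.1).le⟩)
    (fun ε hε => c.exists_lipschitzOnWith_nullSlope (by fun_prop) (by fun_prop) hε.1
      (fun t ht => (hord t ⟨hε.1.trans_le ht.1, ht.2⟩).1)
      (fun t ht => (hCt t ⟨hε.1.trans_le ht.1, ht.2⟩).le) hpos)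
    (fun t ht => by
      have ht' := Ioo_subset_Ioc_self ht
      have hR := (hord t ht').1
      have hRt : c.h30 / 2 * t ^ 3 < t :=
        ((hord t ht').2.1.trans (hord t ht').2.2).trans (hCt t ht')
      have hp := hpos t ht' _ ⟨hR.le, hRt.le⟩
      have hu := c.Y_lt_u hR (hlow t ht') hp.2.2
      have hneg : c.nullSlope t (c.h30 / 2 * t ^ 3) < 0 :=
        mul_neg_of_pos_of_neg (mul_pos (hp.2.2.trans hu)
          (c.sqrtΔ_pos t (hr₀ t ht') _ ⟨hR.le, hRt.le⟩)) (sub_neg.2 hu)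
      have := ht.1
      exact hneg.trans (by positivity))
    (fun t ht => hslope t (Ioo_subset_Ioc_self ht)) ⟨(hord b hbmem).2.1, (hord b hbmem).2.2⟩
  have hγ0 : ∀ t ∈ Ioc 0 b, 0 < γ t := fun t ht => (hord t ht).1.trans (hγm t ht).1
  have hγt : ∀ t ∈ Ioc 0 b, γ t < t := fun t ht => (hγm t ht).2.trans (hCt t ht)
  have habove := c.horizon_lt_of_hasDerivAt hbr hγc hγd
    (fun t ht => ⟨hγ0 t ht, (hγt t ht).le⟩)
    (fun t ht => hΨr t ht _ ⟨(hγ0 t ht).le, (hγm t ht).2.le⟩) (hγb ▸ hmid b hbmem)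
  refine ⟨b, hr₀ b hbmem, γ, hγd, fun t ht => ⟨?_, hγt t ht, (hγ0 t ht).le, (hγm t ht).2.le⟩⟩
  refine ((hmono t ht).lt_iff_lt ⟨(c.Rh_pos t (hr₀ t ht)).le, (c.Rh_lt t (hr₀ t ht)).le⟩
    ⟨(hγ0 t ht).le, (hγt t ht).le⟩).1 ?_
  have := c.Rh_eq t (hr₀ t ht)
  have := habove t ht
  linarith

theorem locallyNaked_of_barrier {C : ℝ} (hC : 3 / 2 * c.h30 < C)
    (hbar : ∀ᶠ r in 𝓝[>] (0:ℝ), 3 * C * r ^ 2 < c.nullSlope r (C * r ^ 3)) :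
    c.LocallyNaked := by
  obtain ⟨b, hb, γ, hd, hγ⟩ := c.exists_geodesic hC hbar
  have hC0 : 0 ≤ C := by linarith [c.α_pos]
  have hlim : Tendsto γ (𝓝[>] 0) (𝓝 0) := by
    refine squeeze_zero' (t₀ := 𝓝[>] 0) (g := fun t : ℝ => C * t ^ 3) ?_ ?_ ?_
    · filter_upwards [Ioc_mem_nhdsGT hb.1] with t ht using (hγ t ht).2.2.1
    · filter_upwards [Ioc_mem_nhdsGT hb.1] with t ht using (hγ t ht).2.2.2
    · exact (Continuous.tendsto' (by fun_prop) _ _ (by simp)).mono_left nhdsWithin_le_nhds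
  have hhalf : ∀ r ∈ Ioc 0 (b / 2), r ∈ Ioo 0 b := fun r hr =>
    ⟨hr.1, hr.2.trans_lt (half_lt_self hb.1)⟩
  refine ⟨b / 2, ⟨half_pos hb.1, (half_le_self hb.1.le).trans hb.2⟩, γ,
    fun r hr => hd r (hhalf r hr), fun r hr => ?_, hlim, ?_⟩
  · have h := hγ r (Ioo_subset_Ioc_self (hhalf r hr))
    exact ⟨h.1, h.2.1⟩
  · refine squeeze_zero_norm' ?_ (by simpa using hlim.const_mul √(2 * C / c.h30))
    filter_upwards [c.eventually_abs_integral_H_le hC0, Ioc_mem_nhdsGT hb.1] with t h ht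
    exact h _ (hγ t ht).2.2

end CollapsingARS

/-- **Theorem (sufficient conditions for nakedness).** In a collapsing ARS model,
if `n = 1` or `n = 2`, or if `n = 3` and `ξ/α > ξ_c`, then the central singularity
is locally naked. -/
theorem naked_of_n_le_two_or_n_eq_three_supercritical (c : CollapsingARS)
    (h : c.n = 1 ∨ c.n = 2 ∨ (c.n = 3 ∧ c.ξ / c.h30 > ξc)) :
    c.LocallyNaked := by
  have hα := c.α_pos
  have hy := one_lt_half_add_sqrt_three
  obtain ⟨l, hl, hle⟩ := c.exists_supercritical_bound h
  refine c.locallyNaked_of_barrier (C := ((1 + √3) / 2) ^ 2 * c.h30) ?_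
    (c.eventually_lt_nullSlope hy hle ?_)
  · have h3 : √3 ^ 2 = 3 := sq_sqrt (by norm_num)
    exact mul_lt_mul_of_pos_right (by nlinarith) hα
  · rw [← ξc_add_pow_three]
    linarith
end
end

section
/- In a collapsing ARS model, if the central singularity is locally naked, then n ≤ 3; moreover, if n = 3 then ξ/α ≥ ξ_c. -/
noncomputable section

open Real Set Filter Topology Asymptotics MeasureTheory intervalIntegral

/-- A function vanishing at `0` whose derivative is at most `K s^m` is at most `K s^(m+1)`. -/
lemma abs_le_mul_pow_succ_of_abs_deriv_le {f f' : ℝ → ℝ} {K : ℝ} {m : ℕ} (hK : 0 ≤ K)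
    (hf : ∀ s ∈ Icc (0:ℝ) 1, HasDerivAt f (f' s) s) (h0 : f 0 = 0)
    (hb : ∀ s ∈ Icc (0:ℝ) 1, |f' s| ≤ K * s ^ m) :
    ∀ s ∈ Icc (0:ℝ) 1, |f s| ≤ K * s ^ (m + 1) := by
  intro s hs
  have hsub : ∀ x ∈ Icc (0:ℝ) s, x ∈ Icc (0:ℝ) 1 := fun x hx => ⟨hx.1, hx.2.trans hs.2⟩
  have h := (convex_Icc (0:ℝ) s).norm_image_sub_le_of_norm_hasDerivWithin_le
    (f := f) (f' := f') (C := K * s ^ m) (x := 0) (y := s)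
    (fun x hx => (hf x (hsub x hx)).hasDerivWithinAt)
    (fun x hx => (hb x (hsub x hx)).trans
      (mul_le_mul_of_nonneg_left (pow_le_pow_left₀ hx.1 hx.2 m) hK))
    ⟨le_rfl, hs.1⟩ ⟨hs.1, le_rfl⟩
  rw [h0, sub_zero, sub_zero, Real.norm_eq_abs, Real.norm_eq_abs, abs_of_nonneg hs.1] at h
  rw [pow_succ, ← mul_assoc]
  exact h

lemma eq_zero_of_abs_le_mul {a D : ℝ} (h : ∀ s ∈ Ioc (0:ℝ) 1, |a| ≤ D * s) : a = 0 := by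
  have ht : Tendsto (fun s : ℝ => D * s) (𝓝[>] 0) (𝓝 0) := by
    have : Tendsto (fun s : ℝ => D * s) (𝓝 0) (𝓝 (D * 0)) :=
      (by fun_prop : Continuous fun s : ℝ => D * s).tendsto 0
    rw [mul_zero] at this
    exact this.mono_left nhdsWithin_le_nhds
  have := ge_of_tendsto ht (Filter.eventually_of_mem (Ioc_mem_nhdsGT zero_lt_one) h)
  exact abs_eq_zero.1 (le_antisymm this (abs_nonneg a))

lemma eq_zero_of_abs_add_mul_le {a b D : ℝ}
    (h : ∀ s ∈ Ioc (0:ℝ) 1, |a * s + b * s ^ 2| ≤ D * s ^ 3) : a = 0 ∧ b = 0 := by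
  have hD : 0 ≤ D := by simpa using (abs_nonneg _).trans (h 1 ⟨one_pos, le_rfl⟩)
  have ha : a = 0 := by
    refine eq_zero_of_abs_le_mul (D := D + |b|) fun s hs => ?_
    have h1 := h s hs
    have e : a * s + b * s ^ 2 = s * (a + b * s) := by ring
    rw [e, abs_mul, abs_of_pos hs.1] at h1
    have h2 : |a + b * s| ≤ D * s ^ 2 := by
      refine le_of_mul_le_mul_left (h1.trans_eq ?_) hs.1
      ring
    have h3 : |a| ≤ |a + b * s| + |b * s| := by
      simpa using abs_sub (a + b * s) (b * s)
    rw [abs_mul, abs_of_pos hs.1] at h3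
    have h4 : D * s ^ 2 ≤ D * s := by
      rw [sq]
      exact mul_le_mul_of_nonneg_left (mul_le_of_le_one_left hs.1.le hs.2) hD
    linarith
  refine ⟨ha, eq_zero_of_abs_le_mul (D := D) fun s hs => ?_⟩
  have h1 := h s hs
  rw [ha, zero_mul, zero_add, abs_mul, abs_of_pos (pow_pos hs.1 2)] at h1
  refine le_of_mul_le_mul_right (h1.trans_eq ?_) (pow_pos hs.1 2)
  ring

/-- A `C⁴` function on `[0,1]` which is `O(s³)` has vanishing first and second derivatives at `0`,
and satisfies Euler's relation for cubics up to a bound on its fourth derivative. -/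
lemma euler_relation_of_abs_le_cube {g g₁ g₂ g₃ g₄ : ℝ → ℝ} {M C : ℝ}
    (hg : ∀ s ∈ Icc (0:ℝ) 1, HasDerivAt g (g₁ s) s)
    (hg₁ : ∀ s ∈ Icc (0:ℝ) 1, HasDerivAt g₁ (g₂ s) s)
    (hg₂ : ∀ s ∈ Icc (0:ℝ) 1, HasDerivAt g₂ (g₃ s) s)
    (hg₃ : ∀ s ∈ Icc (0:ℝ) 1, HasDerivAt g₃ (g₄ s) s)
    (hM : ∀ s ∈ Icc (0:ℝ) 1, |g₄ s| ≤ M) (hC : ∀ s ∈ Icc (0:ℝ) 1, |g s| ≤ C * s ^ 3) :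
    g₁ 0 = 0 ∧ g₂ 0 = 0 ∧ |g₁ 1 - 3 * g 1| ≤ M := by
  have z : (0:ℝ) ∈ Icc (0:ℝ) 1 := ⟨le_rfl, zero_le_one⟩
  have o : (1:ℝ) ∈ Icc (0:ℝ) 1 := ⟨zero_le_one, le_rfl⟩
  have M0 : 0 ≤ M := (abs_nonneg _).trans (hM 0 z)
  have g0 : g 0 = 0 := by
    have := hC 0 z
    simpa using this
  have b₃ : ∀ s ∈ Icc (0:ℝ) 1, |g₃ s| ≤ |g₃ 0| + M := by
    intro s hs
    have h := abs_le_mul_pow_succ_of_abs_deriv_le (f := fun s => g₃ s - g₃ 0) (m := 0) M0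
      (fun s hs => (hg₃ s hs).sub_const _) (sub_self _) (fun s hs => by simpa using hM s hs) s hs
    have h1 : |g₃ s| ≤ |g₃ s - g₃ 0| + |g₃ 0| := by
      simpa using abs_add_le (g₃ s - g₃ 0) (g₃ 0)
    have h2 : M * s ^ (0 + 1) ≤ M := by simpa using mul_le_of_le_one_right M0 hs.2
    linarith
  have L0 : 0 ≤ |g₃ 0| + M := by positivity
  have b₂ := abs_le_mul_pow_succ_of_abs_deriv_le (f := fun s => g₂ s - g₂ 0) (m := 0) L0
    (fun s hs => (hg₂ s hs).sub_const _) (sub_self _) (fun s hs => by simpa using b₃ s hs)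
  have b₁ := abs_le_mul_pow_succ_of_abs_deriv_le (f := fun s => g₁ s - g₁ 0 - g₂ 0 * s) L0
    (fun s hs => (((hg₁ s hs).sub_const _).sub ((hasDerivAt_id s).const_mul _)).congr_deriv
      (by simp)) (by simp) b₂
  have b := abs_le_mul_pow_succ_of_abs_deriv_le
    (f := fun s => g s - g₁ 0 * s - g₂ 0 / 2 * s ^ 2) L0
    (fun s hs => (((hg s hs).sub ((hasDerivAt_id s).const_mul _)).sub
      ((hasDerivAt_pow 2 s).const_mul _)).congr_deriv
      (show _ = g₁ s - g₁ 0 - g₂ 0 * s by simp; ring)) (by simp [g0]) b₁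
  obtain ⟨h₁, h₂⟩ := eq_zero_of_abs_add_mul_le (a := g₁ 0) (b := g₂ 0 / 2)
    (D := C + (|g₃ 0| + M)) fun s hs => by
      have hs' := Ioc_subset_Icc_self hs
      have h1 := hC s hs'
      have h2 := b s hs'
      have h3 := abs_sub (g s) (g s - g₁ 0 * s - g₂ 0 / 2 * s ^ 2)
      have e : g s - (g s - g₁ 0 * s - g₂ 0 / 2 * s ^ 2) = g₁ 0 * s + g₂ 0 / 2 * s ^ 2 := by ring
      rw [e] at h3
      norm_num at h2
      linarith
  have h₂' : g₂ 0 = 0 := by linarith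
  refine ⟨h₁, h₂', ?_⟩
  have e₂ := abs_le_mul_pow_succ_of_abs_deriv_le (f := fun s => s * g₃ s - g₂ s) (m := 1) M0
    (fun s hs => (((hasDerivAt_id s).mul (hg₃ s hs)).sub (hg₂ s hs)).congr_deriv
      (show _ = s * g₄ s by simp)) (by simp [h₂'])
    (fun s hs => by
      rw [abs_mul, abs_of_nonneg hs.1, pow_one, mul_comm]
      exact mul_le_mul_of_nonneg_right (hM s hs) hs.1)
  have e₁ := abs_le_mul_pow_succ_of_abs_deriv_le (f := fun s => s * g₂ s - 2 * g₁ s) M0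
    (fun s hs => (((hasDerivAt_id s).mul (hg₂ s hs)).sub ((hg₁ s hs).const_mul 2)).congr_deriv
      (show _ = s * g₃ s - g₂ s by simp; ring)) (by simp [h₁]) e₂
  have e₀ := abs_le_mul_pow_succ_of_abs_deriv_le (f := fun s => s * g₁ s - 3 * g s) M0
    (fun s hs => (((hasDerivAt_id s).mul (hg₁ s hs)).sub ((hg s hs).const_mul 3)).congr_deriv
      (show _ = s * g₂ s - 2 * g₁ s by simp; ring)) (by simp [g0]) e₁ 1 o
  simpa using e₀

lemma hasDerivAt_comp_smul {V : Type*} [NormedAddCommGroup V] [NormedSpace ℝ V] {Φ : ℝ × ℝ → V}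
    {p : ℝ × ℝ} {s : ℝ} (h : DifferentiableAt ℝ Φ (s • p)) :
    HasDerivAt (fun t : ℝ => Φ (t • p)) (fderiv ℝ Φ (s • p) p) s := by
  have h1 : HasDerivAt (fun t : ℝ => t • p) p s := by
    simpa using (hasDerivAt_id s).smul_const p
  exact h.hasFDerivAt.comp_hasDerivAt s h1

lemma clm_eq_zero_of_basis {V : Type*} [NormedAddCommGroup V] [NormedSpace ℝ V]
    {A : ℝ × ℝ →L[ℝ] V} (h₁ : A (1, 0) = 0) (h₂ : A (0, 1) = 0) : A = 0 := by
  ext <;> simp [h₁, h₂]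

lemma clm_apply_prod (A : ℝ × ℝ →L[ℝ] ℝ) (r R : ℝ) :
    A (r, R) = r * A (1, 0) + R * A (0, 1) := by
  have : ((r, R) : ℝ × ℝ) = r • (1, 0) + R • (0, 1) := by simp
  rw [this, map_add, map_smul, map_smul, smul_eq_mul, smul_eq_mul]

set_option maxSynthPendingDepth 3 in
set_option maxHeartbeats 400000 in
/-- A smooth function of two variables which is `O(‖p‖³)` on the quadrant near the origin has
a derivative of order `O(‖p‖²)` and satisfies Euler's relation for homogeneous cubics up to
`O(‖p‖⁴)`. -/
lemma exists_euler_bound {F : ℝ × ℝ → ℝ} {U : Set (ℝ × ℝ)} (hU : IsOpen U) (h0 : (0, 0) ∈ U)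
    (hF : ContDiffOn ℝ (⊤ : ℕ∞) F U) {C ρ₀ : ℝ} (hρ₀ : 0 < ρ₀)
    (hC : ∀ p : ℝ × ℝ, 0 ≤ p.1 → 0 ≤ p.2 → ‖p‖ ≤ ρ₀ → |F p| ≤ C * ‖p‖ ^ 3) :
    ∃ ρ > 0, ∃ K > 0, ∀ p : ℝ × ℝ, 0 ≤ p.1 → 0 ≤ p.2 → ‖p‖ ≤ ρ →
      p ∈ U ∧ |fderiv ℝ F p p - 3 * F p| ≤ K * ‖p‖ ^ 4 ∧ ‖fderiv ℝ F p‖ ≤ K * ‖p‖ ^ 2 := by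
  have hs : ((⊤ : ℕ∞) : WithTop ℕ∞) + 1 ≤ ((⊤ : ℕ∞) : WithTop ℕ∞) := by simp
  have hne : ((⊤ : ℕ∞) : WithTop ℕ∞) ≠ 0 := by simp
  have hF₁ := hF.fderiv_of_isOpen hU hs
  have hF₂ := hF₁.fderiv_of_isOpen hU hs
  have hF₃ := hF₂.fderiv_of_isOpen hU hs
  have hF₄ := hF₃.fderiv_of_isOpen hU hs
  set F₁ := fderiv ℝ F with hF₁'
  set F₂ := fderiv ℝ F₁ with hF₂'
  set F₃ := fderiv ℝ F₂ with hF₃'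
  set F₄ := fderiv ℝ F₃ with hF₄'
  have hUn : U ∈ 𝓝 ((0, 0) : ℝ × ℝ) := hU.mem_nhds h0
  have c₃ := (hF₃.continuousOn.continuousAt hUn).norm.eventually (gt_mem_nhds (lt_add_one _))
  have c₄ := (hF₄.continuousOn.continuousAt hUn).norm.eventually (gt_mem_nhds (lt_add_one _))
  obtain ⟨ρ₁, hρ₁, hball⟩ := Metric.eventually_nhds_iff_ball.1 ((c₃.and c₄).and hUn)
  set M₃ := ‖F₃ (0, 0)‖ + 1 with hM₃
  set M₄ := ‖F₄ (0, 0)‖ + 1 with hM₄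
  have M₃0 : 0 < M₃ := by positivity
  have M₄0 : 0 < M₄ := by positivity
  have hz : ((0, 0) : ℝ × ℝ) = 0 := rfl
  have hb : ∀ p : ℝ × ℝ, ‖p‖ < ρ₁ → ‖F₃ p‖ ≤ M₃ ∧ ‖F₄ p‖ ≤ M₄ ∧ p ∈ U := by
    intro p hp
    have := hball p (by rw [hz]; simpa using hp)
    exact ⟨this.1.1.le, this.1.2.le, this.2⟩
  set ρ := min ρ₀ (ρ₁ / 2) with hρ
  have ρ0 : 0 < ρ := by positivity
  have ρlt : ρ < ρ₁ := (min_le_right _ _).trans_lt (by linarith)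
  have key : ∀ p : ℝ × ℝ, 0 ≤ p.1 → 0 ≤ p.2 → ‖p‖ ≤ ρ →
      F₁ 0 p = 0 ∧ F₂ 0 p p = 0 ∧ |F₁ p p - 3 * F p| ≤ M₄ * ‖p‖ ^ 4 := by
    intro p hp1 hp2 hp
    have hns : ∀ s ∈ Icc (0:ℝ) 1, ‖s • p‖ ≤ ‖p‖ := fun s hs => by
      rw [norm_smul, Real.norm_eq_abs, abs_of_nonneg hs.1]
      exact mul_le_of_le_one_left (norm_nonneg _) hs.2
    have hin : ∀ s ∈ Icc (0:ℝ) 1, ‖s • p‖ < ρ₁ := fun s hs => (hns s hs).trans_lt (hp.trans_lt ρlt)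
    have hUs : ∀ s ∈ Icc (0:ℝ) 1, U ∈ 𝓝 (s • p) := fun s hs =>
      hU.mem_nhds (hb _ (hin s hs)).2.2
    have r := euler_relation_of_abs_le_cube (g := fun s => F (s • p)) (g₁ := fun s => F₁ (s • p) p)
      (g₂ := fun s => F₂ (s • p) p p) (g₃ := fun s => F₃ (s • p) p p p)
      (g₄ := fun s => F₄ (s • p) p p p p) (M := M₄ * ‖p‖ ^ 4) (C := C * ‖p‖ ^ 3)
      (fun s hs => hasDerivAt_comp_smul ((hF.contDiffAt (hUs s hs)).differentiableAt hne))
      (fun s hs => by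
        simpa using (hasDerivAt_comp_smul
          ((hF₁.contDiffAt (hUs s hs)).differentiableAt hne)).clm_apply (hasDerivAt_const s p))
      (fun s hs => by
        simpa using ((hasDerivAt_comp_smul
          ((hF₂.contDiffAt (hUs s hs)).differentiableAt hne)).clm_apply
            (hasDerivAt_const s p)).clm_apply (hasDerivAt_const s p))
      (fun s hs => by
        simpa using (((hasDerivAt_comp_smul
          ((hF₃.contDiffAt (hUs s hs)).differentiableAt hne)).clm_apply
            (hasDerivAt_const s p)).clm_apply (hasDerivAt_const s p)).clm_apply
              (hasDerivAt_const s p))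
      (fun s hs => by
        have h1 := (hb _ (hin s hs)).2.1
        rw [← Real.norm_eq_abs]
        calc ‖F₄ (s • p) p p p p‖ ≤ ‖F₄ (s • p) p p p‖ * ‖p‖ := ContinuousLinearMap.le_opNorm _ _
          _ ≤ ‖F₄ (s • p) p p‖ * ‖p‖ * ‖p‖ := by
            gcongr; exact ContinuousLinearMap.le_opNorm _ _
          _ ≤ ‖F₄ (s • p) p‖ * ‖p‖ * ‖p‖ * ‖p‖ := by
            gcongr; exact ContinuousLinearMap.le_opNorm _ _
          _ ≤ ‖F₄ (s • p)‖ * ‖p‖ * ‖p‖ * ‖p‖ * ‖p‖ := by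
            gcongr; exact ContinuousLinearMap.le_opNorm _ _
          _ ≤ M₄ * ‖p‖ * ‖p‖ * ‖p‖ * ‖p‖ := by gcongr
          _ = M₄ * ‖p‖ ^ 4 := by ring)
      (fun s hs => by
        have := hC (s • p) (mul_nonneg hs.1 hp1) (mul_nonneg hs.1 hp2)
          ((hns s hs).trans (hp.trans (min_le_left _ _)))
        rw [norm_smul, Real.norm_eq_abs, abs_of_nonneg hs.1] at this
        exact this.trans_eq (by ring))
    simpa using r
  have norm₁ : ‖((ρ, 0) : ℝ × ℝ)‖ ≤ ρ := by simp [Prod.norm_def, abs_of_pos ρ0, ρ0.le]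
  have norm₂ : ‖((0, ρ) : ℝ × ℝ)‖ ≤ ρ := by simp [Prod.norm_def, abs_of_pos ρ0, ρ0.le]
  have norm₃ : ‖((ρ, ρ) : ℝ × ℝ)‖ ≤ ρ := by simp [Prod.norm_def, abs_of_pos ρ0]
  have k₁ := key (ρ, 0) ρ0.le le_rfl norm₁
  have k₂ := key (0, ρ) le_rfl ρ0.le norm₂
  have k₃ := key (ρ, ρ) ρ0.le ρ0.le norm₃
  have x₁ : ((ρ, 0) : ℝ × ℝ) = ρ • (1, 0) := by simp
  have x₂ : ((0, ρ) : ℝ × ℝ) = ρ • (0, 1) := by simp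
  have x₃ : ((ρ, ρ) : ℝ × ℝ) = ρ • (1, 0) + ρ • (0, 1) := by simp
  rw [x₁] at k₁
  rw [x₂] at k₂
  rw [x₃] at k₃
  simp only [map_smul, map_add, smul_eq_mul, _root_.add_apply,
    _root_.smul_apply, mul_eq_zero, ρ0.ne', false_or] at k₁ k₂ k₃
  have F₁0 : F₁ 0 = 0 := clm_eq_zero_of_basis k₁.1 k₂.1
  have symm : F₂ 0 (1, 0) (0, 1) = F₂ 0 (0, 1) (1, 0) :=
    ((hF.contDiffAt hUn).isSymmSndFDerivAt (by
      rw [minSmoothness_of_isRCLikeNormedField]; exact WithTop.coe_le_coe.2 (le_top : (2 : ℕ∞) ≤ ⊤))) _ _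
  have mixed : F₂ 0 (1, 0) (0, 1) = 0 := by
    have h := k₃.2.1
    rw [k₁.2.1, k₂.2.1, ← symm] at h
    have : ρ * (ρ * F₂ 0 (1, 0) (0, 1)) = 0 := by linarith
    simpa [ρ0.ne'] using this
  have F₂0 : F₂ 0 = 0 := clm_eq_zero_of_basis
    (clm_eq_zero_of_basis k₁.2.1 mixed) (clm_eq_zero_of_basis (symm ▸ mixed) k₂.2.1)
  have bF₂ : ∀ p : ℝ × ℝ, ‖p‖ < ρ₁ → ‖F₂ p‖ ≤ M₃ * ‖p‖ := by
    intro p hp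
    have := (convex_ball (0 : ℝ × ℝ) ρ₁).norm_image_sub_le_of_norm_fderiv_le (𝕜 := ℝ) (f := F₂)
      (C := M₃) (x := 0) (y := p)
      (fun q hq => ((hF₂.contDiffAt (hU.mem_nhds (hb q (by simpa using hq)).2.2)).differentiableAt
        hne)) (fun q hq => (hb q (by simpa using hq)).1) (by simpa using hρ₁) (by simpa using hp)
    simpa [F₂0] using this
  have bF₁ : ∀ p : ℝ × ℝ, ‖p‖ < ρ₁ → ‖F₁ p‖ ≤ M₃ * ‖p‖ ^ 2 := by
    intro p hp
    have := (convex_closedBall (0 : ℝ × ℝ) ‖p‖).norm_image_sub_le_of_norm_fderiv_le (𝕜 := ℝ)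
      (f := F₁) (C := M₃ * ‖p‖) (x := 0) (y := p)
      (fun q hq => ((hF₁.contDiffAt (hU.mem_nhds (hb q
        ((by simpa using hq : ‖q‖ ≤ ‖p‖).trans_lt hp)).2.2)).differentiableAt hne))
      (fun q hq => by
        have hq' : ‖q‖ ≤ ‖p‖ := by simpa using hq
        exact (bF₂ q (hq'.trans_lt hp)).trans (by gcongr))
      (by simp) (by simp)
    rw [F₁0, sub_zero, sub_zero] at this
    exact this.trans_eq (by ring)
  refine ⟨ρ, ρ0, max M₃ M₄, by positivity, fun p hp1 hp2 hp => ⟨(hb p (hp.trans_lt ρlt)).2.2,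
    (key p hp1 hp2 hp).2.2.trans ?_, (bF₁ p (hp.trans_lt ρlt)).trans ?_⟩⟩
  · gcongr; exact le_max_right _ _
  · gcongr; exact le_max_left _ _
namespace ARSData

/-- Uniform estimates for `G`, its partial derivatives `Gr`, `GR`, and `Y` on a small triangle
`0 ≤ R ≤ r ≤ ρ`. -/
structure LocalBounds (a : ARSData) (Gr GR : ℝ → ℝ → ℝ) (ρ K c C : ℝ) : Prop where
  ρ_pos : 0 < ρ
  ρ_le : ρ ≤ a.r₀
  K_pos : 0 < K
  c_pos : 0 < c
  C_pos : 0 < C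
  K_mul_le : K * ρ ≤ 1 / 2
  hasDerivAt_left : ∀ r R, 0 < r → r ≤ ρ → 0 ≤ R → R ≤ r →
    HasDerivAt (fun s => a.G s R) (Gr r R) r
  hasDerivAt_right : ∀ r R, 0 < r → r ≤ ρ → 0 ≤ R → R ≤ r →
    HasDerivAt (fun s => a.G r s) (GR r R) R
  euler_le : ∀ r R, 0 < r → r ≤ ρ → 0 ≤ R → R ≤ r →
    |r * Gr r R + R * GR r R - 3 * a.G r R| ≤ K * r ^ 4
  Gr_le : ∀ r R, 0 < r → r ≤ ρ → 0 ≤ R → R ≤ r → |Gr r R| ≤ K * r ^ 2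
  le_G : ∀ r R, 0 < r → r ≤ ρ → 0 ≤ R → R ≤ r → c * r ^ 3 ≤ a.G r R
  G_le : ∀ r R, 0 < r → r ≤ ρ → 0 ≤ R → R ≤ r → a.G r R ≤ C * r ^ 3
  Y_le : ∀ r R, 0 < r → r ≤ ρ → 0 ≤ R → R ≤ r → |a.Y r R - 1| ≤ K * r
  continuousOn_Gr : ∀ r, 0 < r → r ≤ ρ → ContinuousOn (Gr r) (Icc 0 r)
  continuousOn_GR : ∀ r, 0 < r → r ≤ ρ → ContinuousOn (GR r) (Icc 0 r)
  continuousOn_Y : ∀ r, 0 < r → r ≤ ρ → ContinuousOn (a.Y r) (Icc 0 r)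

lemma exists_abs_G_sub_le (a : ARSData) {ε : ℝ} (hε : 0 < ε) :
    ∃ ρ > 0, ∀ r R, 0 ≤ r → r ≤ ρ → 0 ≤ R → R ≤ ρ →
      |a.G r R - (a.h30 * r ^ 3 + a.h21 * r ^ 2 * R + a.h12 * r * R ^ 2 + a.h03 * R ^ 3)|
        ≤ ε * (r + R) ^ 3 := by
  have h := (isLittleO_iff.1 a.taylor) hε
  rw [eventually_nhdsWithin_iff, Metric.eventually_nhds_iff_ball] at h
  obtain ⟨δ, hδ, h⟩ := h
  have r0 := a.r₀_pos
  refine ⟨min (δ / 2) a.r₀, by positivity, fun r R hr hrρ hR hRρ => ?_⟩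
  have h1 : r < δ := by linarith [hrρ.trans (min_le_left _ _)]
  have h2 : R < δ := by linarith [hRρ.trans (min_le_left _ _)]
  have h3 := h (r, R) (by
    rw [Metric.mem_ball, Prod.dist_eq]
    simp [abs_of_nonneg hr, abs_of_nonneg hR, h1, h2])
    ⟨⟨hr, hrρ.trans (min_le_right _ _)⟩, ⟨hR, hRρ.trans (min_le_right _ _)⟩⟩
  simp only [Real.norm_eq_abs] at h3
  rwa [abs_of_nonneg (by positivity : 0 ≤ (r + R) ^ 3)] at h3

lemma exists_abs_G_sub_P_le (a : ARSData) {ε : ℝ} (hε : 0 < ε) :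
    ∃ ρ > 0, ∀ r R, 0 < r → r ≤ ρ → 0 ≤ R → R ≤ r →
      |a.G r R - r ^ 3 * a.P (R / r)| ≤ ε * r ^ 3 := by
  obtain ⟨ρ, hρ, h⟩ := a.exists_abs_G_sub_le (ε := ε / 8) (by positivity)
  refine ⟨ρ, hρ, fun r R hr hrρ hR hRr => ?_⟩
  have h1 := h r R hr.le hrρ hR (hRr.trans hrρ)
  have e : r ^ 3 * a.P (R / r) =
      a.h30 * r ^ 3 + a.h21 * r ^ 2 * R + a.h12 * r * R ^ 2 + a.h03 * R ^ 3 := by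
    unfold P
    field_simp
  rw [e]
  have h2 : (r + R) ^ 3 ≤ (2 * r) ^ 3 := pow_le_pow_left₀ (by positivity) (by linarith) 3
  nlinarith

lemma exists_G_cube_bounds (a : ARSData) :
    ∃ ρ > 0, ∃ c > 0, ∃ C > 0, ∀ r R, 0 < r → r ≤ ρ → 0 ≤ R → R ≤ r →
      c * r ^ 3 ≤ a.G r R ∧ a.G r R ≤ C * r ^ 3 := by
  have hc : Continuous a.P := by unfold P; fun_prop
  have hne : (Icc (0:ℝ) 1).Nonempty := ⟨0, le_rfl, zero_le_one⟩
  obtain ⟨x, hx, hmin⟩ := isCompact_Icc.exists_isMinOn hne hc.continuousOn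
  obtain ⟨y, hy, hmax⟩ := isCompact_Icc.exists_isMaxOn hne hc.continuousOn
  have px : 0 < a.P x := a.P_pos x hx
  have py : 0 < a.P y := a.P_pos y hy
  obtain ⟨ρ, hρ, h⟩ := a.exists_abs_G_sub_P_le (ε := a.P x / 2) (by positivity)
  refine ⟨ρ, hρ, a.P x / 2, by positivity, a.P x / 2 + a.P y, by positivity,
    fun r R hr hrρ hR hRr => ?_⟩
  have h1 := abs_le.1 (h r R hr hrρ hR hRr)
  have hm : R / r ∈ Icc (0:ℝ) 1 := ⟨by positivity, (div_le_one hr).2 hRr⟩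
  have h2 : a.P x ≤ a.P (R / r) := hmin hm
  have h3 : a.P (R / r) ≤ a.P y := hmax hm
  have r3 : 0 < r ^ 3 := by positivity
  constructor <;> nlinarith

lemma exists_abs_G_le (a : ARSData) : ∃ ρ > 0, ∃ C, ∀ p : ℝ × ℝ, 0 ≤ p.1 → 0 ≤ p.2 → ‖p‖ ≤ ρ →
    |a.G p.1 p.2| ≤ C * ‖p‖ ^ 3 := by
  obtain ⟨ρ, hρ, h⟩ := a.exists_abs_G_sub_le one_pos
  refine ⟨ρ, hρ, |a.h30| + |a.h21| + |a.h12| + |a.h03| + 8, ?_⟩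
  rintro ⟨r, R⟩ hr hR hp
  simp only at hr hR ⊢
  set N := ‖((r, R) : ℝ × ℝ)‖ with hN
  have hrN : r ≤ N := (le_abs_self r).trans (norm_fst_le (r, R))
  have hRN : R ≤ N := (le_abs_self R).trans (norm_snd_le (r, R))
  have N0 : 0 ≤ N := norm_nonneg _
  have h1 := h r R hr (hrN.trans hp) hR (hRN.trans hp)
  have h2 : (r + R) ^ 3 ≤ (2 * N) ^ 3 := pow_le_pow_left₀ (by positivity) (by linarith) 3
  have m : ∀ k x : ℝ, 0 ≤ x → x ≤ N ^ 3 → |k * x| ≤ |k| * N ^ 3 := fun k x hx hxN => by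
    rw [abs_mul, abs_of_nonneg hx]
    exact mul_le_mul_of_nonneg_left hxN (abs_nonneg _)
  have t1 := m a.h30 (r ^ 3) (by positivity) (by gcongr)
  have t2 := m a.h21 (r ^ 2 * R) (by positivity) (by
    calc r ^ 2 * R ≤ N ^ 2 * N := by gcongr
      _ = N ^ 3 := by ring)
  have t3 := m a.h12 (r * R ^ 2) (by positivity) (by
    calc r * R ^ 2 ≤ N * N ^ 2 := by gcongr
      _ = N ^ 3 := by ring)
  have t4 := m a.h03 (R ^ 3) (by positivity) (by gcongr)
  rw [abs_le] at *
  constructor <;> nlinarith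

lemma exists_localBounds (a : ARSData) : ∃ Gr GR ρ K c C, a.LocalBounds Gr GR ρ K c C := by
  obtain ⟨U, hU, hsub, hΨ, hY⟩ := a.smooth
  set F : ℝ × ℝ → ℝ := fun p => a.G p.1 p.2 with hFdef
  have hF : ContDiffOn ℝ (⊤ : ℕ∞) F U :=
    (contDiffOn_const.mul hΨ).add (contDiffOn_snd.mul ((hY.pow 2).sub contDiffOn_const))
  have r0 := a.r₀_pos
  have h0 : ((0, 0) : ℝ × ℝ) ∈ U := hsub ⟨⟨le_rfl, r0.le⟩, ⟨le_rfl, r0.le⟩⟩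
  have hne : ((⊤ : ℕ∞) : WithTop ℕ∞) ≠ 0 := by simp
  have hs : ((⊤ : ℕ∞) : WithTop ℕ∞) + 1 ≤ ((⊤ : ℕ∞) : WithTop ℕ∞) := by simp
  obtain ⟨ρ₀, hρ₀, C₀, hC₀⟩ := a.exists_abs_G_le
  obtain ⟨ρ₁, hρ₁, K₁, hK₁, h₁⟩ := exists_euler_bound hU h0 hF hρ₀ hC₀
  obtain ⟨ρ₂, hρ₂, c, hc, C, hC, h₂⟩ := a.exists_G_cube_bounds
  have hYd : DifferentiableAt ℝ (fun p : ℝ × ℝ => a.Y p.1 p.2) (0, 0) :=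
    (hY.contDiffAt (hU.mem_nhds h0)).differentiableAt hne
  obtain ⟨K₂, hK₂, hO⟩ := (hYd.hasFDerivAt.isBigO_sub).exists_pos
  obtain ⟨ρ₃, hρ₃, h₃⟩ := Metric.eventually_nhds_iff_ball.1 hO.bound
  set K := max K₁ K₂ with hK
  have K0 : 0 < K := lt_max_of_lt_left hK₁
  set ρ := min (min (min ρ₁ ρ₂) (min (ρ₃ / 2) a.r₀)) (1 / (2 * K)) with hρ
  have ρ0 : 0 < ρ := by positivity
  have ρ₁le : ρ ≤ ρ₁ := (min_le_left _ _).trans ((min_le_left _ _).trans (min_le_left _ _))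
  have ρ₂le : ρ ≤ ρ₂ := (min_le_left _ _).trans ((min_le_left _ _).trans (min_le_right _ _))
  have ρ₃le : ρ ≤ ρ₃ / 2 := (min_le_left _ _).trans ((min_le_right _ _).trans (min_le_left _ _))
  have ρle : ρ ≤ a.r₀ := (min_le_left _ _).trans ((min_le_right _ _).trans (min_le_right _ _))
  have ρK : ρ ≤ 1 / (2 * K) := min_le_right _ _
  have hnorm : ∀ r R : ℝ, 0 < r → 0 ≤ R → R ≤ r → ‖((r, R) : ℝ × ℝ)‖ = r := by
    intro r R hr hR hRr
    simp [Prod.norm_def, abs_of_pos hr, abs_of_nonneg hR, hRr]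
  have h₁' : ∀ r R, 0 < r → r ≤ ρ → 0 ≤ R → R ≤ r → (r, R) ∈ U ∧
      |fderiv ℝ F (r, R) (r, R) - 3 * F (r, R)| ≤ K₁ * r ^ 4 ∧
        ‖fderiv ℝ F (r, R)‖ ≤ K₁ * r ^ 2 := by
    intro r R hr hrρ hR hRr
    have := h₁ (r, R) hr.le hR (by rw [hnorm r R hr hR hRr]; exact hrρ.trans ρ₁le)
    rwa [hnorm r R hr hR hRr] at this
  have hd : ∀ r R, 0 < r → r ≤ ρ → 0 ≤ R → R ≤ r → HasFDerivAt F (fderiv ℝ F (r, R)) (r, R) :=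
    fun r R hr hrρ hR hRr => ((hF.contDiffAt (hU.mem_nhds (h₁' r R hr hrρ hR hRr).1)).differentiableAt
      hne).hasFDerivAt
  have hcF' : ∀ r, 0 < r → r ≤ ρ → ContinuousOn (fun R => fderiv ℝ F (r, R)) (Icc 0 r) :=
    fun r hr hrρ => (hF.fderiv_of_isOpen hU hs).continuousOn.comp (by fun_prop)
      fun R hR => (h₁' r R hr hrρ hR.1 hR.2).1
  refine ⟨fun r R => fderiv ℝ F (r, R) (1, 0), fun r R => fderiv ℝ F (r, R) (0, 1), ρ, K, c, C,
    ρ0, ρle, K0, hc, hC, ?_, fun r R hr hrρ hR hRr => ?_, fun r R hr hrρ hR hRr => ?_,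
    fun r R hr hrρ hR hRr => ?_, fun r R hr hrρ hR hRr => ?_, fun r R hr hrρ hR hRr => ?_,
    fun r R hr hrρ hR hRr => ?_, fun r R hr hrρ hR hRr => ?_, fun r hr hrρ => ?_,
    fun r hr hrρ => ?_, fun r hr hrρ => ?_⟩
  · calc K * ρ ≤ K * (1 / (2 * K)) := by gcongr
      _ = 1 / 2 := by field_simp
  · exact (hd r R hr hrρ hR hRr).comp_hasDerivAt r ((hasDerivAt_id r).prodMk (hasDerivAt_const r R))
  · exact (hd r R hr hrρ hR hRr).comp_hasDerivAt R ((hasDerivAt_const R r).prodMk (hasDerivAt_id R))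
  · have h := (h₁' r R hr hrρ hR hRr).2.1
    rw [clm_apply_prod] at h
    exact h.trans (by gcongr; exact le_max_left _ _)
  · have h := (h₁' r R hr hrρ hR hRr).2.2
    have h' := (fderiv ℝ F (r, R)).le_opNorm (1, 0)
    have e : ‖((1, 0) : ℝ × ℝ)‖ = 1 := by simp [Prod.norm_def]
    rw [e, mul_one, Real.norm_eq_abs] at h'
    exact h'.trans (h.trans (by gcongr; exact le_max_left _ _))
  · exact (h₂ r R hr (hrρ.trans ρ₂le) hR hRr).1
  · exact (h₂ r R hr (hrρ.trans ρ₂le) hR hRr).2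
  · have h := h₃ (r, R) (by
      rw [Metric.mem_ball, show ((0, 0) : ℝ × ℝ) = 0 from rfl, dist_zero_right, hnorm r R hr hR hRr]
      linarith)
    rw [show ((0, 0) : ℝ × ℝ) = 0 from rfl, sub_zero, hnorm r R hr hR hRr] at h
    simp only [Prod.fst_zero, Prod.snd_zero, a.Y_origin, Real.norm_eq_abs] at h
    exact h.trans (by gcongr; exact le_max_right _ _)
  · exact (hcF' r hr hrρ).clm_apply continuousOn_const
  · exact (hcF' r hr hrρ).clm_apply continuousOn_const
  · exact hY.continuousOn.comp (f := fun R => (r, R)) (by fun_prop)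
      fun R hR => (h₁' r R hr hrρ hR.1 hR.2).1

namespace LocalBounds

variable {a : ARSData} {Gr GR : ℝ → ℝ → ℝ} {ρ K c C r R : ℝ}

lemma G_pos (b : a.LocalBounds Gr GR ρ K c C) (hr : 0 < r) (hrρ : r ≤ ρ) (hR : 0 ≤ R)
    (hRr : R ≤ r) : 0 < a.G r R :=
  (mul_pos b.c_pos (pow_pos hr 3)).trans_le (b.le_G r R hr hrρ hR hRr)

lemma continuousOn_G (b : a.LocalBounds Gr GR ρ K c C) (hr : 0 < r) (hrρ : r ≤ ρ) :
    ContinuousOn (a.G r) (Icc 0 r) := fun R hR =>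
  (b.hasDerivAt_right r R hr hrρ hR.1 hR.2).continuousAt.continuousWithinAt

lemma continuousOn_H (b : a.LocalBounds Gr GR ρ K c C) (hr : 0 < r) (hrρ : r ≤ ρ) :
    ContinuousOn (a.H r) (Icc 0 r) :=
  (continuousOn_id.div (b.continuousOn_G hr hrρ) fun _ hR =>
    (b.G_pos hr hrρ hR.1 hR.2).ne').sqrt

lemma half_le_Y (b : a.LocalBounds Gr GR ρ K c C) (hr : 0 < r) (hrρ : r ≤ ρ) (hR : 0 ≤ R)
    (hRr : R ≤ r) : 1 / 2 ≤ a.Y r R := by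
  have h1 := (abs_le.1 (b.Y_le r R hr hrρ hR hRr)).1
  have h2 : K * r ≤ K * ρ := mul_le_mul_of_nonneg_left hrρ b.K_pos.le
  linarith [b.K_mul_le]

lemma deriv_H_left (b : a.LocalBounds Gr GR ρ K c C) (hr : 0 < r) (hrρ : r ≤ ρ) (hR : 0 ≤ R)
    (hRr : R ≤ r) : deriv (fun s => a.H s R) r = -(a.H r R * Gr r R / (2 * a.G r R)) := by
  rcases hR.eq_or_lt with rfl | hR0
  · simp [H]
  · have G0 := b.G_pos hr hrρ hR hRr
    have q0 : 0 < R / a.G r R := div_pos hR0 G0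
    have h := (((hasDerivAt_const r R).div (b.hasDerivAt_left r R hr hrρ hR hRr) G0.ne').sqrt
      q0.ne')
    rw [show (fun s => a.H s R) = fun s => √(R / a.G s R) from rfl]
    refine h.deriv.trans ?_
    have hs : √(R / a.G r R) ^ 2 = R / a.G r R := Real.sq_sqrt q0.le
    have s0 : 0 < √(R / a.G r R) := Real.sqrt_pos.2 q0
    simp only [Pi.div_apply]
    unfold H
    set w := √(R / a.G r R)
    have hRw : R = w ^ 2 * a.G r R := by rw [hs]; field_simp
    field_simp
    linear_combination -Gr r R * hRw

lemma hasDerivAt_mul_H (b : a.LocalBounds Gr GR ρ K c C) (hr : 0 < r) (hrρ : r ≤ ρ) (hR : 0 < R)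
    (hRr : R ≤ r) : HasDerivAt (fun s => s * a.H r s)
      (a.H r R * (3 * a.G r R - R * GR r R) / (2 * a.G r R)) R := by
  have G0 := b.G_pos hr hrρ hR.le hRr
  have q0 : 0 < R / a.G r R := div_pos hR G0
  have h := (hasDerivAt_id R).mul (((hasDerivAt_id R).div
    (b.hasDerivAt_right r R hr hrρ hR.le hRr) G0.ne').sqrt q0.ne')
  refine h.congr_deriv ?_
  have hs : √(R / a.G r R) ^ 2 = R / a.G r R := Real.sq_sqrt q0.le
  have s0 : 0 < √(R / a.G r R) := Real.sqrt_pos.2 q0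
  unfold H
  simp only [Pi.div_apply, id]
  set w := √(R / a.G r R)
  have hRw : R = w ^ 2 * a.G r R := by rw [hs]; field_simp
  field_simp
  linear_combination (a.G r R - R * GR r R) * hRw

lemma H_le_of_le (b : a.LocalBounds Gr GR ρ K c C) (hr : 0 < r) (hrρ : r ≤ ρ) (hRr : R ≤ r)
    {σ : ℝ} (hσ : 0 ≤ σ) (hσR : σ ≤ R) : a.H r σ ≤ √(C / c) * a.H r R := by
  have hc := b.c_pos
  have hC := b.C_pos
  have Gσ := b.le_G r σ hr hrρ hσ (hσR.trans hRr)
  have GRl := b.G_le r R hr hrρ (hσ.trans hσR) hRr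
  have G0 := b.G_pos hr hrρ (hσ.trans hσR) hRr
  have R0 := hσ.trans hσR
  unfold H
  rw [← Real.sqrt_mul (by positivity)]
  refine Real.sqrt_le_sqrt ?_
  calc σ / a.G r σ ≤ R / (c * r ^ 3) := by gcongr
    _ = C / c * (R / (C * r ^ 3)) := by field_simp
    _ ≤ C / c * (R / a.G r R) := by gcongr

lemma neg_mul_deriv_H_le (b : a.LocalBounds Gr GR ρ K c C) (hr : 0 < r) (hrρ : r ≤ ρ)
    (hR : 0 ≤ R) (hRr : R ≤ r) :
    -(r * ((a.Y r R)⁻¹ * deriv (fun s => a.H s R) r)) ≤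
      a.H r R * (3 * a.G r R - R * GR r R) / (2 * a.G r R) +
        (2 * K ^ 2 + K) / (2 * c) * r * a.H r R := by
  have hc := b.c_pos
  have hK := b.K_pos
  have G0 := b.G_pos hr hrρ hR hRr
  have Y0 := b.half_le_Y hr hrρ hR hRr
  have H0 : 0 ≤ a.H r R := Real.sqrt_nonneg _
  have hE := (abs_le.1 (b.euler_le r R hr hrρ hR hRr)).2
  have hY := b.Y_le r R hr hrρ hR hRr
  have hG := b.Gr_le r R hr hrρ hR hRr
  have hcG := b.le_G r R hr hrρ hR hRr
  rw [b.deriv_H_left hr hrρ hR hRr]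
  have hYi : |(a.Y r R)⁻¹ - 1| ≤ 2 * (K * r) := by
    have e : (a.Y r R)⁻¹ - 1 = -(a.Y r R - 1) * (a.Y r R)⁻¹ := by field_simp; ring
    have i : (a.Y r R)⁻¹ ≤ 2 := by
      rw [inv_le_comm₀ (by linarith) two_pos]; linarith
    rw [e, abs_mul, abs_neg, abs_of_pos (inv_pos.2 (by linarith : 0 < a.Y r R)), mul_comm]
    exact mul_le_mul i hY (abs_nonneg _) two_pos.le
  have hprod : r * Gr r R * ((a.Y r R)⁻¹ - 1) ≤ 2 * K ^ 2 * r ^ 4 := by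
    refine (le_abs_self _).trans ?_
    rw [abs_mul, abs_mul, abs_of_pos hr]
    calc r * |Gr r R| * |(a.Y r R)⁻¹ - 1| ≤ r * (K * r ^ 2) * (2 * (K * r)) := by gcongr
      _ = _ := by ring
  have key : r * Gr r R * (a.Y r R)⁻¹ ≤
      3 * a.G r R - R * GR r R + (2 * K ^ 2 + K) / c * r * a.G r R := by
    have h1 : (2 * K ^ 2 + K) * r ^ 4 ≤ (2 * K ^ 2 + K) / c * r * a.G r R := by
      calc (2 * K ^ 2 + K) * r ^ 4 = (2 * K ^ 2 + K) / c * r * (c * r ^ 3) := by field_simp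
        _ ≤ _ := by gcongr
    nlinarith
  calc -(r * ((a.Y r R)⁻¹ * -(a.H r R * Gr r R / (2 * a.G r R))))
      = a.H r R / (2 * a.G r R) * (r * Gr r R * (a.Y r R)⁻¹) := by ring
    _ ≤ a.H r R / (2 * a.G r R) *
        (3 * a.G r R - R * GR r R + (2 * K ^ 2 + K) / c * r * a.G r R) := by gcongr
    _ = _ := by field_simp

lemma continuousOn_inv_Y_mul_deriv_H (b : a.LocalBounds Gr GR ρ K c C) (hr : 0 < r)
    (hrρ : r ≤ ρ) :
    ContinuousOn (fun σ => (a.Y r σ)⁻¹ * deriv (fun s => a.H s σ) r) (Icc 0 r) := by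
  have h : ContinuousOn (fun σ => (a.Y r σ)⁻¹ * -(a.H r σ * Gr r σ / (2 * a.G r σ)))
      (Icc 0 r) := by
    refine ((b.continuousOn_Y r hr hrρ).inv₀ fun σ hσ => ?_).mul
      (((b.continuousOn_H hr hrρ).mul (b.continuousOn_Gr r hr hrρ)).div
        (continuousOn_const.mul (b.continuousOn_G hr hrρ)) fun σ hσ => ?_).neg
    · linarith [b.half_le_Y hr hrρ hσ.1 hσ.2]
    · exact (mul_pos two_pos (b.G_pos hr hrρ hσ.1 hσ.2)).ne'
  exact h.congr fun σ hσ => by simp only [b.deriv_H_left hr hrρ hσ.1 hσ.2]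

/-- `√Δ(r,R)` exceeds `√Δ(r,0)` by at most `R H(r,R) / r`, up to a relative error `O(r)`. -/
lemma exists_mul_sqrtΔ_le (b : a.LocalBounds Gr GR ρ K c C) : ∃ κ > 0, ∀ r R, 0 < r → r ≤ ρ →
    0 < R → R ≤ r → r * a.sqrtΔ r R ≤ r * a.sqrtΔ r 0 + (1 + κ * r) * (R * a.H r R) := by
  have hc := b.c_pos
  have hC := b.C_pos
  have hK := b.K_pos
  refine ⟨(2 * K ^ 2 + K) / (2 * c) * √(C / c), by positivity, fun r R hr hrρ hR hRr => ?_⟩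
  have hcont := b.continuousOn_inv_Y_mul_deriv_H hr hrρ
  have sub₁ : uIcc 0 R ⊆ Icc 0 r := by
    rw [uIcc_of_le hR.le]; exact Icc_subset_Icc_right hRr
  have sub₂ : uIcc R r ⊆ Icc 0 r := by
    rw [uIcc_of_le hRr]; exact Icc_subset_Icc_left hR.le
  have i₁ := (hcont.mono sub₁).intervalIntegrable (μ := volume)
  have i₂ := (hcont.mono sub₂).intervalIntegrable (μ := volume)
  have split := integral_add_adjacent_intervals i₁ i₂
  have cψ : ContinuousOn (fun σ => a.H r σ * (3 * a.G r σ - σ * GR r σ) / (2 * a.G r σ))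
      (Icc 0 r) := by
    refine ((b.continuousOn_H hr hrρ).mul ((continuousOn_const.mul (b.continuousOn_G hr hrρ)).sub
      (continuousOn_id.mul (b.continuousOn_GR r hr hrρ)))).div
        (continuousOn_const.mul (b.continuousOn_G hr hrρ)) fun σ hσ => ?_
    exact (mul_pos two_pos (b.G_pos hr hrρ hσ.1 hσ.2)).ne'
  have iψ := (cψ.mono sub₁).intervalIntegrable (μ := volume)
  have ftc := integral_eq_sub_of_hasDerivAt_of_le hR.le (f := fun s => s * a.H r s)
    (continuousOn_id.mul ((b.continuousOn_H hr hrρ).mono (Icc_subset_Icc_right hRr)))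
    (fun σ hσ => b.hasDerivAt_mul_H hr hrρ hσ.1 (hσ.2.le.trans hRr)) iψ
  set D := (2 * K ^ 2 + K) / (2 * c) * r * (√(C / c) * a.H r R) with hD
  have mono := integral_mono_on hR.le ((i₁.const_mul r).neg)
    (iψ.add (intervalIntegrable_const (c := D))) fun σ hσ => by
      refine (b.neg_mul_deriv_H_le hr hrρ hσ.1 (hσ.2.trans hRr)).trans ?_
      refine add_le_add le_rfl ?_
      exact mul_le_mul_of_nonneg_left (b.H_le_of_le hr hrρ hRr hσ.1 hσ.2) (by positivity)
  rw [intervalIntegral.integral_add iψ intervalIntegrable_const, ftc] at mono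
  simp only [Pi.neg_apply, intervalIntegral.integral_neg, intervalIntegral.integral_const_mul,
    intervalIntegral.integral_const, smul_eq_mul, sub_zero, zero_mul] at mono
  unfold sqrtΔ
  rw [← split]
  rw [hD] at mono
  linarith

/-- Lower bound for the collapse time `∫₀^R H(r,σ) dσ`. -/
lemma pow_three_le_integral_H (b : a.LocalBounds Gr GR ρ K c C) (hr : 0 < r) (hrρ : r ≤ ρ)
    (hR : 0 < R) (hRr : R ≤ r) : (R / r) ^ 3 ≤ 4 * C * (∫ σ in (0:ℝ)..R, a.H r σ) ^ 2 := by
  have hC := b.C_pos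
  set k := √(1 / (R * (C * r ^ 3))) with hk
  have hle : ∀ σ ∈ Icc 0 R, k * σ ≤ a.H r σ := by
    intro σ hσ
    have G0 := b.G_pos hr hrρ hσ.1 (hσ.2.trans hRr)
    have hG := b.G_le r σ hr hrρ hσ.1 (hσ.2.trans hRr)
    have h0 := hσ.1
    refine Real.le_sqrt_of_sq_le ?_
    rw [mul_pow, hk, Real.sq_sqrt (by positivity)]
    calc 1 / (R * (C * r ^ 3)) * σ ^ 2 = σ / R * (σ / (C * r ^ 3)) := by ring
      _ ≤ 1 * (σ / (C * r ^ 3)) := by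
        gcongr; exact (div_le_one hR).2 hσ.2
      _ = σ / (C * r ^ 3) := one_mul _
      _ ≤ σ / a.G r σ := by gcongr
  have mono := integral_mono_on (μ := volume) hR.le
    ((by fun_prop : Continuous fun σ : ℝ => k * σ).intervalIntegrable 0 R)
    (((b.continuousOn_H hr hrρ).mono (by
      rw [uIcc_of_le hR.le]; exact Icc_subset_Icc_right hRr)).intervalIntegrable) hle
  rw [intervalIntegral.integral_const_mul, integral_id, zero_pow two_ne_zero, sub_zero] at mono
  have h2 := pow_le_pow_left₀ (by positivity) mono 2
  rw [mul_pow, hk, Real.sq_sqrt (by positivity)] at h2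
  calc (R / r) ^ 3 = 4 * C * (1 / (R * (C * r ^ 3)) * (R ^ 2 / 2) ^ 2) := by
        field_simp; ring
    _ ≤ _ := by gcongr

end LocalBounds

end ARSData

/-- Grönwall-type lower bound: if `r R' ≤ (m + κ r) R` then `R` decays at most like `r^m`. -/
lemma exists_pos_mul_rpow_le {R R' : ℝ → ℝ} {m κ r₂ : ℝ} (hr₂ : 0 < r₂) (hκ : 0 ≤ κ)
    (hR : ∀ r ∈ Ioc 0 r₂, HasDerivAt R (R' r) r) (hpos : ∀ r ∈ Ioc 0 r₂, 0 < R r)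
    (hle : ∀ r ∈ Ioc 0 r₂, r * R' r ≤ (m + κ * r) * R r) :
    ∃ C > 0, ∀ r ∈ Ioc 0 r₂, C * r ^ m ≤ R r := by
  have hd : ∀ r ∈ Ioc 0 r₂, HasDerivAt (fun s => R s * (s ^ (-m) * exp (-κ * s)))
      (r ^ (-m - 1) * exp (-κ * r) * (r * R' r - (m + κ * r) * R r)) r := by
    intro r hr
    have h := (hR r hr).mul ((Real.hasDerivAt_rpow_const (p := -m) (Or.inl hr.1.ne')).mul
      (((hasDerivAt_id r).const_mul (-κ)).exp))
    refine h.congr_deriv ?_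
    have e : r ^ (-m) = r ^ (-m - 1) * r := by
      rw [← Real.rpow_add_one hr.1.ne', sub_add_cancel]
    simp only [id, Pi.mul_apply]
    rw [e]
    ring
  have anti : AntitoneOn (fun s => R s * (s ^ (-m) * exp (-κ * s))) (Ioc 0 r₂) := by
    refine antitoneOn_of_deriv_nonpos (convex_Ioc 0 r₂)
      (fun r hr => (hd r hr).continuousAt.continuousWithinAt)
      (fun r hr => (hd r (interior_subset hr)).differentiableAt.differentiableWithinAt)
      fun r hr => ?_
    have hr' := interior_subset hr
    rw [(hd r hr').deriv]
    exact mul_nonpos_of_nonneg_of_nonpos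
      (mul_nonneg (Real.rpow_nonneg hr'.1.le _) (exp_pos _).le) (sub_nonpos.2 (hle r hr'))
  have hmem : r₂ ∈ Ioc 0 r₂ := ⟨hr₂, le_rfl⟩
  refine ⟨R r₂ * (r₂ ^ (-m) * exp (-κ * r₂)),
    mul_pos (hpos r₂ hmem) (mul_pos (Real.rpow_pos_of_pos hr₂ _) (exp_pos _)), fun r hr => ?_⟩
  have h := anti hr hmem hr.2
  simp only at h
  have he : exp (-κ * r) ≤ 1 := Real.exp_le_one_iff.2 (by nlinarith [hr.1])
  have hp := Real.rpow_pos_of_pos hr.1 m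
  have hRr := hpos r hr
  calc _ ≤ R r * (r ^ (-m) * exp (-κ * r)) * r ^ m := by gcongr
    _ = R r * exp (-κ * r) * (r ^ (-m) * r ^ m) := by ring
    _ = R r * exp (-κ * r) := by rw [← Real.rpow_add hr.1]; simp
    _ ≤ R r := mul_le_of_le_one_right hRr.le he

lemma ξc_pos : 0 < ξc := by unfold ξc; positivity

lemma one_lt_ξc : 1 < ξc := by
  unfold ξc
  linarith [Real.sqrt_nonneg 3]

/-- `ξc` is the critical coupling of the reduced geodesic equation. -/
lemma ξc_mul_cube_add_one_mul_le {u : ℝ} (hu : 0 ≤ u) : (ξc * u ^ 3 + 1) * (1 - u) ≤ 3 := by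
  have hs : √3 ^ 2 = (3:ℝ) := Real.sq_sqrt (by norm_num)
  have s0 : 0 ≤ √(3:ℝ) := Real.sqrt_nonneg 3
  unfold ξc
  set s := √(3:ℝ)
  have h : 0 ≤ (u - (s - 1)) ^ 2 * ((26 + 15 * s) / 2 * u ^ 2 + (12 + 7 * s) / 2 * u + (2 + s)) := by
    positivity
  have e : 3 - ((26 + 15 * s) / 2 * u ^ 3 + 1) * (1 - u) =
      (u - (s - 1)) ^ 2 * ((26 + 15 * s) / 2 * u ^ 2 + (12 + 7 * s) / 2 * u + (2 + s)) := by
    have hs3 : s ^ 3 = 3 * s := by rw [pow_succ, hs]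
    ring_nf
    rw [hs3, hs]
    ring
  linarith

lemma subcritical_bound {ζ u ε : ℝ} (hζ : 0 < ζ) (hζc : ζ < ξc) (hu : 0 < u) (hε : 0 ≤ ε)
    (hε1 : ε ≤ 1) (huε : u ≤ 1 + ε) (hsmall : ε * (8 * ζ + 4) ≤ 1 - ζ / ξc) :
    (ζ * u ^ 3 + 1 + ε) * (1 + ε - u) ≤ 2 + ζ / ξc := by
  have hc := ξc_pos
  set l := ζ / ξc with hl
  have l0 : 0 < l := by positivity
  have l1 : l < 1 := (div_lt_one hc).2 hζc
  have e : ζ = l * ξc := by rw [hl]; field_simp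
  have hu3 : u ^ 3 ≤ 8 := by
    calc u ^ 3 ≤ 2 ^ 3 := pow_le_pow_left₀ hu.le (by linarith) 3
      _ = 8 := by norm_num
  have main : (ζ * u ^ 3 + 1) * (1 - u) ≤ 1 + 2 * l := by
    have h := ξc_mul_cube_add_one_mul_le hu.le
    rw [e]
    nlinarith
  have h3 : ζ * u ^ 3 ≤ ζ * 8 := mul_le_mul_of_nonneg_left hu3 hζ.le
  nlinarith

namespace CollapsingARS

/-- A geodesic escaping from the centre cannot exist if `r √Δ(r,0) ≤ ζ G` along it with `ζ`
below the critical value. -/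
lemma false_of_subcritical (c : CollapsingARS) {Gr GR : ℝ → ℝ → ℝ} {ρ K c₀ C : ℝ}
    (b : c.LocalBounds Gr GR ρ K c₀ C) {r₁ : ℝ} (hr₁ : 0 < r₁) (hr₁c : r₁ ≤ c.r₀) {Rg : ℝ → ℝ}
    (hgeo : ∀ r ∈ Ioc (0:ℝ) r₁, HasDerivAt Rg
      (c.u r (Rg r) * c.sqrtΔ r (Rg r) * (c.Y r (Rg r) - c.u r (Rg r))) r)
    (hpos : ∀ r ∈ Ioc (0:ℝ) r₁, 0 < Rg r) (hlt : ∀ r ∈ Ioc (0:ℝ) r₁, Rg r < r)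
    (hz : Tendsto (fun r => Rg r / r) (𝓝[>] 0) (𝓝 0)) {ζ : ℝ} (hζ : 0 < ζ) (hζc : ζ < ξc)
    (hsub : ∀ᶠ r in 𝓝[>] (0:ℝ), r * c.sqrtΔ r 0 ≤ ζ * c.G r (Rg r)) : False := by
  obtain ⟨κ₀, hκ₀, hκ₀le⟩ := b.exists_mul_sqrtΔ_le
  have hρ := b.ρ_pos
  have hC := b.C_pos
  set κ := max κ₀ K with hκdef
  have hκ : 0 < κ := lt_max_of_lt_left hκ₀
  have hc := ξc_pos
  set l := ζ / ξc with hl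
  have l0 : 0 < l := by positivity
  have l1 : l < 1 := (div_lt_one hc).2 hζc
  set R' := fun r => c.u r (Rg r) * c.sqrtΔ r (Rg r) * (c.Y r (Rg r) - c.u r (Rg r)) with hR'
  have small : ∀ {x : ℝ}, 0 < x → ∀ᶠ r in 𝓝[>] (0:ℝ), r ∈ Ioc 0 x := fun hx =>
    Ioc_mem_nhdsGT hx
  have basic : ∀ r ∈ Ioc (0:ℝ) r₁, r ≤ ρ → r * c.sqrtΔ r 0 ≤ ζ * c.G r (Rg r) →
      0 < c.u r (Rg r) ∧ c.u r (Rg r) ^ 2 * Rg r = c.G r (Rg r) ∧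
      (r * R' r ≤ 0 ∨ c.u r (Rg r) ≤ 1 + κ * r ∧ r * R' r ≤
        (ζ * c.u r (Rg r) ^ 3 + 1 + κ * r) * (1 + κ * r - c.u r (Rg r)) * Rg r) := by
    intro r hr hrρ hs
    have r0 := hr.1
    have R0 := hpos r hr
    have Rr := (hlt r hr).le
    have G0 := b.G_pos r0 hrρ R0.le Rr
    have u0 : 0 < c.u r (Rg r) := Real.sqrt_pos.2 (div_pos G0 R0)
    have usq : c.u r (Rg r) ^ 2 * Rg r = c.G r (Rg r) := by
      rw [show c.u r (Rg r) = √(c.G r (Rg r) / Rg r) from rfl,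
        Real.sq_sqrt (div_pos G0 R0).le, div_mul_cancel₀ _ R0.ne']
    have uH : c.u r (Rg r) * c.H r (Rg r) = 1 := by
      unfold ARSData.u ARSData.H
      rw [← Real.sqrt_mul (div_pos G0 R0).le, div_mul_div_cancel₀ R0.ne', div_self G0.ne',
        Real.sqrt_one]
    have Δ0 : 0 < c.sqrtΔ r (Rg r) := c.sqrtΔ_pos r ⟨r0, hr.2.trans hr₁c⟩ _ ⟨R0.le, Rr⟩
    refine ⟨u0, usq, ?_⟩
    have hΔ := hκ₀le r (Rg r) r0 hrρ R0 Rr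
    have hY := (abs_le.1 (b.Y_le r (Rg r) r0 hrρ R0.le Rr)).2
    set u := c.u r (Rg r) with hu
    have hRdef : R' r = u * c.sqrtΔ r (Rg r) * (c.Y r (Rg r) - u) := rfl
    have κr : κ₀ * r ≤ κ * r := by gcongr; exact le_max_left _ _
    have Kr : K * r ≤ κ * r := by gcongr; exact le_max_right _ _
    rcases le_or_gt (c.Y r (Rg r)) u with hYu | hYu
    · left
      rw [hRdef]
      exact mul_nonpos_of_nonneg_of_nonpos r0.le
        (mul_nonpos_of_nonneg_of_nonpos (mul_pos u0 Δ0).le (by linarith))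
    · right
      refine ⟨by linarith, ?_⟩
      have h1 : r * (u * c.sqrtΔ r (Rg r)) ≤ (ζ * u ^ 3 + 1 + κ * r) * Rg r := by
        calc r * (u * c.sqrtΔ r (Rg r)) = u * (r * c.sqrtΔ r (Rg r)) := by ring
          _ ≤ u * (r * c.sqrtΔ r 0 + (1 + κ₀ * r) * (Rg r * c.H r (Rg r))) := by gcongr
          _ = u * (r * c.sqrtΔ r 0) + (1 + κ₀ * r) * Rg r * (u * c.H r (Rg r)) := by ring
          _ ≤ u * (ζ * c.G r (Rg r)) + (1 + κ * r) * Rg r * 1 := by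
            rw [uH]; gcongr
          _ = (ζ * u ^ 3 + 1 + κ * r) * Rg r := by rw [← usq]; ring
      calc r * R' r = r * (u * c.sqrtΔ r (Rg r)) * (c.Y r (Rg r) - u) := by rw [hRdef]; ring
        _ ≤ (ζ * u ^ 3 + 1 + κ * r) * Rg r * (1 + κ * r - u) :=
          mul_le_mul h1 (by linarith) (by linarith) (by positivity)
        _ = _ := by ring
  obtain ⟨δ, hδ, hδsub⟩ := mem_nhdsGT_iff_exists_Ioc_subset.1 hsub
  have hδ0 : 0 < δ := hδ
  set r₂ := min (min (min r₁ ρ) (min δ (1 / κ))) (min 1 ((1 - l) / (κ * (8 * ζ + 4)))) with hr₂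
  have l1' : 0 < 1 - l := by linarith
  have r₂0 : 0 < r₂ := by positivity
  have m₁ : r₂ ≤ r₁ := (min_le_left _ _).trans ((min_le_left _ _).trans (min_le_left _ _))
  have m₂ : r₂ ≤ ρ := (min_le_left _ _).trans ((min_le_left _ _).trans (min_le_right _ _))
  have m₃ : r₂ ≤ δ := (min_le_left _ _).trans ((min_le_right _ _).trans (min_le_left _ _))
  have m₄ : r₂ ≤ 1 / κ := (min_le_left _ _).trans ((min_le_right _ _).trans (min_le_right _ _))
  have m₅ : r₂ ≤ 1 := (min_le_right _ _).trans (min_le_left _ _)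
  have m₆ : r₂ ≤ (1 - l) / (κ * (8 * ζ + 4)) := (min_le_right _ _).trans (min_le_right _ _)
  have basic' := fun r (hr : r ∈ Ioc 0 r₂) => basic r ⟨hr.1, hr.2.trans m₁⟩ (hr.2.trans m₂)
    (hδsub ⟨hr.1, hr.2.trans m₃⟩)
  obtain ⟨C₁, hC₁, hle₁⟩ := exists_pos_mul_rpow_le (R := Rg) (R' := R') (m := 2 + l) (κ := 0) r₂0
    le_rfl (fun r hr => hgeo r ⟨hr.1, hr.2.trans m₁⟩) (fun r hr => hpos r ⟨hr.1, hr.2.trans m₁⟩)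
    fun r hr => by
      have R0 := hpos r ⟨hr.1, hr.2.trans m₁⟩
      obtain ⟨u0, -, h⟩ := basic' r hr
      rw [zero_mul, add_zero]
      rcases h with h | ⟨hu, h⟩
      · exact h.trans (by positivity)
      · refine h.trans (mul_le_mul_of_nonneg_right ?_ R0.le)
        refine subcritical_bound hζ hζc u0 (mul_pos hκ hr.1).le ?_ hu ?_
        · have := hr.2.trans m₄
          rwa [le_div_iff₀ hκ, mul_comm] at this
        · have := hr.2.trans m₆
          rw [le_div_iff₀ (by positivity)] at this
          linarith
  have lim : Tendsto (fun r : ℝ => ζ * (C / C₁) * r ^ (1 - l)) (𝓝[>] 0) (𝓝 0) := by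
    have h : Tendsto (fun r : ℝ => ζ * (C / C₁) * r ^ (1 - l)) (𝓝 0)
        (𝓝 (ζ * (C / C₁) * 0 ^ (1 - l))) :=
      ((Real.continuousAt_rpow_const 0 (1 - l) (Or.inr l1'.le)).const_mul _).tendsto
    rw [Real.zero_rpow l1'.ne', mul_zero] at h
    exact h.mono_left nhdsWithin_le_nhds
  obtain ⟨δ', hδ', hδ'sub⟩ := mem_nhdsGT_iff_exists_Ioc_subset.1
    (lim.eventually (gt_mem_nhds zero_lt_one))
  have hδ'0 : 0 < δ' := hδ'
  set r₃ := min r₂ δ' with hr₃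
  have r₃0 : 0 < r₃ := lt_min r₂0 hδ'0
  have n₁ : r₃ ≤ r₂ := min_le_left _ _
  obtain ⟨C₂, hC₂, hle₂⟩ := exists_pos_mul_rpow_le (R := Rg) (R' := R') (m := 1)
    (κ := 2 * κ + κ ^ 2) r₃0 (by positivity)
    (fun r hr => hgeo r ⟨hr.1, hr.2.trans (n₁.trans m₁)⟩)
    (fun r hr => hpos r ⟨hr.1, hr.2.trans (n₁.trans m₁)⟩)
    fun r hr => by
      have r0 := hr.1
      have hr' : r ∈ Ioc 0 r₂ := ⟨hr.1, hr.2.trans n₁⟩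
      have hr1 : r ∈ Ioc 0 r₁ := ⟨hr.1, hr'.2.trans m₁⟩
      have R0 := hpos r hr1
      obtain ⟨u0, usq, h⟩ := basic' r hr'
      rcases h with h | ⟨hu, h⟩
      · exact h.trans (by positivity)
      · refine h.trans (mul_le_mul_of_nonneg_right ?_ R0.le)
        have hG := b.G_le r (Rg r) r0 (hr'.2.trans m₂) R0.le (hlt r hr1).le
        have hζ1 : ζ * (C / C₁) * r ^ (1 - l) < 1 := hδ'sub ⟨r0, hr.2.trans (min_le_right _ _)⟩
        have hR := hle₁ r hr'
        have p0 := Real.rpow_pos_of_pos r0 (2 + l)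
        have e : r ^ (1 - l) * r ^ (2 + l) = r ^ 3 := by
          rw [← Real.rpow_add r0, ← Real.rpow_natCast]
          norm_num
        set u := c.u r (Rg r)
        have hu2 : ζ * u ^ 2 ≤ 1 := by
          refine le_of_mul_le_mul_right ?_ R0
          calc ζ * u ^ 2 * Rg r = ζ * c.G r (Rg r) := by rw [← usq]; ring
            _ ≤ ζ * (C * r ^ 3) := by gcongr
            _ = (ζ * (C / C₁) * r ^ (1 - l)) * (C₁ * r ^ (2 + l)) := by
              rw [← e]; field_simp
            _ ≤ 1 * Rg r := mul_le_mul hζ1.le hR (by positivity) zero_le_one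
        have hu3 : ζ * u ^ 3 ≤ u := by
          calc ζ * u ^ 3 = ζ * u ^ 2 * u := by ring
            _ ≤ 1 * u := by gcongr
            _ = u := one_mul u
        have r1 : r ≤ 1 := hr'.2.trans m₅
        have f0 : 0 ≤ 1 + κ * r - u := by linarith
        calc (ζ * u ^ 3 + 1 + κ * r) * (1 + κ * r - u)
            ≤ (u + 1 + κ * r) * (1 + κ * r - u) := by gcongr
          _ = 1 + (2 * κ + κ ^ 2 * r) * r - u ^ 2 := by ring
          _ ≤ 1 + (2 * κ + κ ^ 2 * 1) * r := by
            have : (2 * κ + κ ^ 2 * r) * r ≤ (2 * κ + κ ^ 2 * 1) * r := by gcongr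
            nlinarith
          _ = 1 + (2 * κ + κ ^ 2) * r := by rw [mul_one]
  have ev := (hz.eventually (gt_mem_nhds hC₂)).and (small r₃0)
  obtain ⟨r, hr1, hr2⟩ := ev.exists
  have := hle₂ r hr2
  rw [Real.rpow_one, ← le_div_iff₀ hr2.1] at this
  linarith

/-- The collapse time along a locally naked geodesic vanishes only if `R_g / r → 0`. -/
lemma tendsto_div_of_tendsto_integral (c : CollapsingARS) {Gr GR : ℝ → ℝ → ℝ} {ρ K c₀ C : ℝ}
    (b : c.LocalBounds Gr GR ρ K c₀ C) {r₁ : ℝ} (hr₁ : 0 < r₁) {Rg : ℝ → ℝ}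
    (hpos : ∀ r ∈ Ioc (0:ℝ) r₁, 0 < Rg r) (hlt : ∀ r ∈ Ioc (0:ℝ) r₁, Rg r < r)
    (hint : Tendsto (fun r => ∫ σ in (0:ℝ)..(Rg r), c.H r σ) (𝓝[>] 0) (𝓝 0)) :
    Tendsto (fun r => Rg r / r) (𝓝[>] 0) (𝓝 0) := by
  have hmem : Ioc 0 (min r₁ ρ) ∈ 𝓝[>] (0:ℝ) := Ioc_mem_nhdsGT (lt_min hr₁ b.ρ_pos)
  have hlim : Tendsto (fun r => 4 * C * (∫ σ in (0:ℝ)..(Rg r), c.H r σ) ^ 2) (𝓝[>] 0) (𝓝 0) := by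
    simpa using (hint.pow 2).const_mul (4 * C)
  have hcube : Tendsto (fun r => (Rg r / r) ^ 3) (𝓝[>] 0) (𝓝 0) := by
    refine squeeze_zero' ?_ ?_ hlim
    · filter_upwards [hmem] with r hr
      have := hpos r ⟨hr.1, hr.2.trans (min_le_left _ _)⟩
      have := hr.1
      positivity
    · filter_upwards [hmem] with r hr
      have hr' : r ∈ Ioc 0 r₁ := ⟨hr.1, hr.2.trans (min_le_left _ _)⟩
      exact b.pow_three_le_integral_H hr.1 (hr.2.trans (min_le_right _ _)) (hpos r hr')
        (hlt r hr').le
  have hroot : Tendsto (fun x : ℝ => x ^ ((3 : ℕ) : ℝ)⁻¹) (𝓝 0) (𝓝 0) := by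
    have := (Real.continuousAt_rpow_const 0 ((3 : ℕ) : ℝ)⁻¹ (Or.inr (by positivity))).tendsto
    rwa [Real.zero_rpow (by positivity)] at this
  refine (hroot.comp hcube).congr' ?_
  filter_upwards [hmem] with r hr
  have h1 := hpos r ⟨hr.1, hr.2.trans (min_le_left _ _)⟩
  have h2 := hr.1
  exact Real.pow_rpow_inv_natCast (by positivity) three_ne_zero

lemma tendsto_G_div (c : CollapsingARS) {r₁ : ℝ} (hr₁ : 0 < r₁) {Rg : ℝ → ℝ}
    (hpos : ∀ r ∈ Ioc (0:ℝ) r₁, 0 < Rg r) (hlt : ∀ r ∈ Ioc (0:ℝ) r₁, Rg r < r)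
    (hz : Tendsto (fun r => Rg r / r) (𝓝[>] 0) (𝓝 0)) :
    Tendsto (fun r => c.G r (Rg r) / r ^ 3) (𝓝[>] 0) (𝓝 c.h30) := by
  have hc : Continuous c.P := by unfold ARSData.P; fun_prop
  have hP : Tendsto (fun r => c.P (Rg r / r)) (𝓝[>] 0) (𝓝 c.h30) := by
    have e : c.P 0 = c.h30 := by simp [ARSData.P]
    exact e ▸ (hc.tendsto 0).comp hz
  have hdiff : Tendsto (fun r => c.G r (Rg r) / r ^ 3 - c.P (Rg r / r)) (𝓝[>] 0) (𝓝 0) := by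
    rw [Metric.tendsto_nhds]
    intro ε hε
    obtain ⟨ρ, hρ, h⟩ := c.exists_abs_G_sub_P_le (half_pos hε)
    filter_upwards [Ioc_mem_nhdsGT (lt_min hr₁ hρ)] with r hr
    have hr' : r ∈ Ioc 0 r₁ := ⟨hr.1, hr.2.trans (min_le_left _ _)⟩
    have h1 := h r (Rg r) hr.1 (hr.2.trans (min_le_right _ _)) (hpos r hr').le (hlt r hr').le
    have r3 : 0 < r ^ 3 := pow_pos hr.1 3
    rw [Real.dist_eq, sub_zero]
    have e : c.G r (Rg r) / r ^ 3 - c.P (Rg r / r) =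
        (c.G r (Rg r) - r ^ 3 * c.P (Rg r / r)) / r ^ 3 := by
      rw [sub_div, mul_div_cancel_left₀ _ r3.ne']
    rw [e, abs_div, abs_of_pos r3, div_lt_iff₀ r3]
    nlinarith
  simpa using hdiff.add hP

lemma tendsto_mul_sqrtΔ_div (c : CollapsingARS) :
    Tendsto (fun r => r * c.sqrtΔ r 0 / r ^ c.n) (𝓝[>] 0) (𝓝 c.ξ) := by
  have h := c.sqrtΔ_asym.tendsto_div_nhds_zero.add_const c.ξ
  rw [zero_add] at h
  refine h.congr' ?_
  filter_upwards [self_mem_nhdsWithin] with r hr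
  have r0 : 0 < r := hr
  obtain ⟨k, hk⟩ := Nat.exists_eq_add_of_le' c.n_pos
  rw [hk, Nat.add_sub_cancel]
  field_simp
  ring

end CollapsingARS

/-- **Theorem (necessary conditions for nakedness).** In a collapsing ARS model,
if the central singularity is locally naked then `n ≤ 3`; moreover, if `n = 3`
then `ξ/α ≥ ξ_c`. -/
theorem n_le_three_and_supercritical_of_naked (c : CollapsingARS)
    (h : c.LocallyNaked) :
    c.n ≤ 3 ∧ (c.n = 3 → c.ξ / c.h30 ≥ ξc) := by
  obtain ⟨r₁, hr₁, Rg, hgeo, hRg, -, hint⟩ := h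
  obtain ⟨Gr, GR, ρ, K, c₀, C, b⟩ := c.exists_localBounds
  have hpos : ∀ r ∈ Ioc (0:ℝ) r₁, 0 < Rg r := fun r hr =>
    (c.Rh_pos r ⟨hr.1, hr.2.trans hr₁.2⟩).trans (hRg r hr).1
  have hlt : ∀ r ∈ Ioc (0:ℝ) r₁, Rg r < r := fun r hr => (hRg r hr).2
  have hz := c.tendsto_div_of_tendsto_integral b hr₁.1 hpos hlt hint
  have hG := c.tendsto_G_div hr₁.1 hpos hlt hz
  have hΔ := c.tendsto_mul_sqrtΔ_div
  have hα := c.α_pos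
  have sub : ∀ {x ζ : ℝ}, 0 < ζ → ζ < ξc → x < ζ * c.h30 →
      Tendsto (fun r => r * c.sqrtΔ r 0 / r ^ 3) (𝓝[>] 0) (𝓝 x) → False := by
    intro x ζ hζ hζc hx ht
    refine c.false_of_subcritical b hr₁.1 hr₁.2 hgeo hpos hlt hz hζ hζc ?_
    filter_upwards [ht.eventually_lt (hG.const_mul ζ) hx, self_mem_nhdsWithin] with r hr hr0
    have r0 : 0 < r := hr0
    rw [← mul_div_assoc, div_lt_div_iff_of_pos_right (pow_pos r0 3)] at hr
    exact hr.le
  constructor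
  · by_contra! hn
    obtain ⟨k, hk⟩ := Nat.exists_eq_add_of_lt hn
    refine sub one_pos one_lt_ξc (x := 0) (by linarith) ?_
    have hp : Tendsto (fun r : ℝ => r ^ (k + 1)) (𝓝[>] 0) (𝓝 0) := by
      have : Tendsto (fun r : ℝ => r ^ (k + 1)) (𝓝 0) (𝓝 (0 ^ (k + 1))) :=
        (continuous_pow (k + 1)).tendsto 0
      rw [zero_pow (Nat.succ_ne_zero k)] at this
      exact this.mono_left nhdsWithin_le_nhds
    have hm := hΔ.mul hp
    rw [mul_zero] at hm
    refine hm.congr' ?_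
    filter_upwards [self_mem_nhdsWithin] with r hr
    have r0 : 0 < r := hr
    rw [hk]
    field_simp
    ring
  · intro hn
    by_contra! hlt'
    rw [hn] at hΔ
    have hξ : 0 < c.ξ / c.h30 := div_pos c.ξ_pos hα
    refine sub (x := c.ξ) (ζ := (c.ξ / c.h30 + ξc) / 2) (by linarith) (by linarith) ?_ hΔ
    rw [← div_lt_iff₀ hα]
    linarith
end
end

section
/- In a collapsing ARS model, the apparent horizon is a supersolution of the radial null geodesic equation near the center: for every r in (0,r₀], u(r,R_h(r)) = Y(r,R_h(r)), so that the right-hand side of the radial null geodesic equation vanishes along the apparent horizon; moreover R_h(r)/(α r³) → 1 as r → 0⁺, and there is r₁ ∈ (0,r₀] such that R_h is differentiable on (0,r₁] with R_h′(r) > 0 (indeed R_h′(r)/(3α r²) → 1 as r → 0⁺). -/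
noncomputable section

open Real Set Filter Topology Asymptotics MeasureTheory intervalIntegral

/-- If a `C³` function vanishes to second order at `0` and `f x / x ^ 3 → a` from the right,
then the cubic asymptotics may be differentiated. -/
theorem tendsto_deriv_div_sq_of_tendsto_div_cube {f : ℝ → ℝ} {a : ℝ} (hf : ContDiffAt ℝ 3 f 0)
    (h0 : f 0 = 0) (h1 : deriv f 0 = 0) (h2 : deriv (deriv f) 0 = 0)
    (h : Tendsto (fun x => f x / x ^ 3) (𝓝[>] 0) (𝓝 a)) :
    Tendsto (fun x => deriv f x / x ^ 2) (𝓝[>] 0) (𝓝 (3 * a)) := by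
  have hf1 : ContDiffAt ℝ 2 (deriv f) 0 :=
    (hf.fderiv_right (m := 2) (by norm_num)).clm_apply contDiffAt_const
  have hf2 : ContDiffAt ℝ 1 (deriv (deriv f)) 0 :=
    (hf1.fderiv_right (m := 1) (by norm_num)).clm_apply contDiffAt_const
  set L := deriv (deriv (deriv f)) 0
  have hne : ∀ᶠ x : ℝ in 𝓝[>] 0, x ≠ 0 := by
    filter_upwards [self_mem_nhdsWithin] with x hx using ne_of_gt hx
  have t2 : Tendsto (fun x => deriv (deriv f) x / x) (𝓝[>] 0) (𝓝 L) := by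
    have := (hf2.differentiableAt (by norm_num)).hasDerivAt.tendsto_slope_zero_right
    refine this.congr fun x => ?_
    simp [h2, div_eq_inv_mul]
  have t1 : Tendsto (fun x => deriv f x / x ^ 2) (𝓝[>] 0) (𝓝 (L / 2)) := by
    refine deriv.lhopital_zero_nhdsGT ?_ ?_ ?_ ?_ ?_
    · exact ((hf1.eventually (by simp)).filter_mono nhdsWithin_le_nhds).mono
        fun x hx => hx.differentiableAt (by norm_num)
    · filter_upwards [hne] with x hx
      simpa using hx
    · simpa [h1] using hf1.continuousAt.tendsto.mono_left nhdsWithin_le_nhds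
    · simpa using ((continuous_pow 2).tendsto (0 : ℝ)).mono_left nhdsWithin_le_nhds
    · refine (t2.div_const 2).congr fun x => ?_
      simp [div_div, mul_comm]
  have t0 : Tendsto (fun x => f x / x ^ 3) (𝓝[>] 0) (𝓝 (L / 2 / 3)) := by
    refine deriv.lhopital_zero_nhdsGT ?_ ?_ ?_ ?_ ?_
    · exact ((hf.eventually (by simp)).filter_mono nhdsWithin_le_nhds).mono
        fun x hx => hx.differentiableAt (by norm_num)
    · filter_upwards [hne] with x hx
      simpa using hx
    · simpa [h0] using hf.continuousAt.tendsto.mono_left nhdsWithin_le_nhds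
    · simpa using ((continuous_pow 3).tendsto (0 : ℝ)).mono_left nhdsWithin_le_nhds
    · refine (t1.div_const 3).congr fun x => ?_
      simp [div_div, mul_comm]
  rw [tendsto_nhds_unique h t0]
  convert t1 using 2
  ring

section FixedPoint

variable {F : ℝ × ℝ → ℝ} {ρ : ℝ → ℝ}

/-- A small solution of the fixed-point equation `ρ r = F (r, ρ r)` is differentiable
near `0` if `F` is smooth with vanishing derivative at the origin. -/
theorem eventually_differentiableAt_of_eventually_fixedPoint (hF : ContDiffAt ℝ 3 F (0, 0))
    (hF0 : F (0, 0) = 0) (hF' : fderiv ℝ F (0, 0) = 0) (hρ : Tendsto ρ (𝓝[>] 0) (𝓝 0))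
    (h : ∀ᶠ r in 𝓝[>] 0, ρ r = F (r, ρ r)) :
    ∀ᶠ r in 𝓝[>] 0, DifferentiableAt ℝ ρ r := by
  have hE : ContDiffAt ℝ 3 (fun p : ℝ × ℝ => p.2 - F p) (0, 0) := contDiffAt_snd.sub hF
  have hE' : HasFDerivAt (fun p : ℝ × ℝ => p.2 - F p) (ContinuousLinearMap.snd ℝ ℝ ℝ) (0, 0) := by
    have := hasFDerivAt_snd.sub (hF.differentiableAt (by norm_num)).hasFDerivAt
    rwa [hF', sub_zero] at this
  have hinv : (fderiv ℝ (fun p : ℝ × ℝ => p.2 - F p) (0, 0) ∘L .inr ℝ ℝ ℝ).IsInvertible := by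
    rw [hE'.fderiv, ContinuousLinearMap.snd_comp_inr]
    exact ⟨.refl ℝ ℝ, rfl⟩
  set g := hE.implicitFunction (by norm_num) hinv
  have hg : ∀ᶠ r in 𝓝 0, DifferentiableAt ℝ g r :=
    ((hE.contDiffAt_implicitFunction (by norm_num) hinv).eventually (by simp)).mono
      fun r hr => hr.differentiableAt (by norm_num)
  have hpair : Tendsto (fun r => (r, ρ r)) (𝓝[>] 0) (𝓝 (0, 0)) :=
    (tendsto_id.mono_left nhdsWithin_le_nhds).prodMk_nhds hρ
  have heq : ∀ᶠ r in 𝓝[>] 0, g r = ρ r := by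
    filter_upwards [hpair.eventually
      (hE.eventually_apply_eq_iff_implicitFunction (by norm_num) hinv), h] with r hr hr'
    exact hr.1 (by simp [hF0, ← hr'])
  filter_upwards [eventually_eventually_nhdsWithin.2 heq, hg.filter_mono nhdsWithin_le_nhds,
    self_mem_nhdsWithin] with r hr hgr hr0
  rw [isOpen_Ioi.nhdsWithin_eq hr0] at hr
  exact hgr.congr_of_eventuallyEq (hr.mono fun _ hx => hx.symm)

/-- The leading-order behaviour of a small solution of `ρ r = F (r, ρ r)` is that of `F (r, 0)`. -/
theorem tendsto_div_cube_of_eventually_fixedPoint {a : ℝ}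
    (hF : ContDiffAt ℝ 3 F (0, 0)) (hF' : fderiv ℝ F (0, 0) = 0) (hρ : Tendsto ρ (𝓝[>] 0) (𝓝 0))
    (h : ∀ᶠ r in 𝓝[>] 0, ρ r = F (r, ρ r))
    (hcube : Tendsto (fun r => F (r, 0) / r ^ 3) (𝓝[>] 0) (𝓝 a)) :
    Tendsto (fun r => ρ r / r ^ 3) (𝓝[>] 0) (𝓝 a) := by
  have hid : Tendsto (fun r : ℝ => r) (𝓝[>] 0) (𝓝 0) := tendsto_id.mono_left nhdsWithin_le_nhds
  have hpair : Tendsto (fun r => ((r, (0 : ℝ)), (r, ρ r))) (𝓝[>] 0) (𝓝 ((0, 0), (0, 0))) :=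
    (hid.prodMk_nhds tendsto_const_nhds).prodMk_nhds (hid.prodMk_nhds hρ)
  have hlo := ((hF.hasStrictFDerivAt (by norm_num)).isLittleO).comp_tendsto hpair
  have hlo' : (fun r => F (r, 0) - ρ r) =o[𝓝[>] 0] ρ := by
    refine (hlo.congr' ?_ .rfl).trans_isBigO ?_
    · filter_upwards [h] with r hr
      simp [hF', ← hr]
    · refine .of_bound 1 (.of_forall fun r => ?_)
      simp [Prod.norm_def]
  have hequiv : (fun r => F (r, 0)) ~[𝓝[>] 0] ρ := hlo'
  have hcube' : (fun r => F (r, 0) / r ^ 3) ~[𝓝[>] 0] fun r => ρ r / r ^ 3 :=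
    hequiv.div .refl
  exact (hcube'.tendsto_nhds_iff).1 hcube

/-- The derivative of a small solution of `ρ r = F (r, ρ r)` with cubic leading order. -/
theorem tendsto_deriv_div_sq_of_eventually_fixedPoint {a : ℝ}
    (hF : ContDiffAt ℝ 3 F (0, 0)) (hF0 : F (0, 0) = 0) (hF' : fderiv ℝ F (0, 0) = 0)
    (hF'' : deriv (deriv fun r => F (r, 0)) 0 = 0) (hρ : Tendsto ρ (𝓝[>] 0) (𝓝 0))
    (h : ∀ᶠ r in 𝓝[>] 0, ρ r = F (r, ρ r))
    (hcube : Tendsto (fun r => F (r, 0) / r ^ 3) (𝓝[>] 0) (𝓝 a)) :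
    Tendsto (fun r => deriv ρ r / r ^ 2) (𝓝[>] 0) (𝓝 (3 * a)) := by
  have hid : Tendsto (fun r : ℝ => r) (𝓝[>] 0) (𝓝 0) := tendsto_id.mono_left nhdsWithin_le_nhds
  have hpos : ∀ᶠ r : ℝ in 𝓝[>] 0, 0 < r := self_mem_nhdsWithin
  have hpair : Tendsto (fun r => (r, ρ r)) (𝓝[>] 0) (𝓝 (0, 0)) := hid.prodMk_nhds hρ
  have hpair0 : Tendsto (fun r : ℝ => (r, (0 : ℝ))) (𝓝[>] 0) (𝓝 (0, 0)) :=
    hid.prodMk_nhds tendsto_const_nhds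
  have hD : ContDiffAt ℝ 2 (fderiv ℝ F) (0, 0) := hF.fderiv_right (by norm_num)
  have hdiff : ∀ᶠ p in 𝓝 (0, 0), DifferentiableAt ℝ F p :=
    (hF.eventually (by simp)).mono fun p hp => hp.differentiableAt (by norm_num)
  have hslice : ∀ {r s : ℝ}, DifferentiableAt ℝ F (r, s) →
      HasDerivAt (fun x => F (x, s)) (fderiv ℝ F (r, s) (1, 0)) r := fun {r s} hd =>
    hd.hasFDerivAt.comp_hasDerivAt r ((hasDerivAt_id r).prodMk (hasDerivAt_const r s))
  have haxis : Tendsto (fun r => fderiv ℝ F (r, 0) (1, 0) / r ^ 2) (𝓝[>] 0) (𝓝 (3 * a)) := by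
    have hf : ContDiffAt ℝ 3 (fun r => F (r, 0)) 0 :=
      ContDiffAt.comp (0 : ℝ) hF (contDiffAt_id.prodMk contDiffAt_const)
    have hf1 : deriv (fun r => F (r, 0)) 0 = 0 := by
      rw [(hslice hdiff.self_of_nhds).deriv, hF']
      rfl
    refine (tendsto_deriv_div_sq_of_tendsto_div_cube hf hF0 hf1 hF'' hcube).congr' ?_
    filter_upwards [hpair0.eventually hdiff] with r hr
    rw [(hslice hr).deriv]
  have hdev : Tendsto (fun r => (fderiv ℝ F (r, ρ r) (1, 0) - fderiv ℝ F (r, 0) (1, 0)) / r ^ 2)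
      (𝓝[>] 0) (𝓝 0) := by
    have hO : (fun r => fderiv ℝ F (r, ρ r) (1, 0) - fderiv ℝ F (r, 0) (1, 0))
        =O[𝓝[>] 0] ρ := by
      have hr := (hD.clm_apply (contDiffAt_const (c := ((1 : ℝ), (0 : ℝ))))).hasStrictFDerivAt
        (by norm_num)
      refine (hr.isBigO_sub.comp_tendsto (hpair.prodMk_nhds hpair0)).trans ?_
      refine .of_bound 1 (.of_forall fun r => ?_)
      simp [Prod.norm_def]
    have hρ3 : ρ =O[𝓝[>] 0] fun r => r ^ 3 := by
      refine isBigO_of_div_tendsto_nhds ?_ a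
        (tendsto_div_cube_of_eventually_fixedPoint hF hF' hρ h hcube)
      filter_upwards [hpos] with r hr hr0
      exact absurd hr0 (by positivity)
    have h32 : (fun r : ℝ => r ^ 3) =o[𝓝[>] 0] fun r => r ^ 2 :=
      (isLittleO_pow_pow (by norm_num)).mono nhdsWithin_le_nhds
    exact ((hO.trans hρ3).trans_isLittleO h32).tendsto_div_nhds_zero
  have hnum : Tendsto (fun r => fderiv ℝ F (r, ρ r) (1, 0) / r ^ 2) (𝓝[>] 0) (𝓝 (3 * a)) := by
    refine (zero_add (3 * a) ▸ hdev.add haxis).congr fun r => ?_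
    ring
  have hFR : Tendsto (fun r => fderiv ℝ F (r, ρ r) (0, 1)) (𝓝[>] 0) (𝓝 0) := by
    have := ((hD.clm_apply (contDiffAt_const (c := ((0 : ℝ), (1 : ℝ))))).continuousAt.tendsto).comp
      hpair
    simpa [hF', Function.comp_def] using this
  have hden : Tendsto (fun r => 1 - fderiv ℝ F (r, ρ r) (0, 1)) (𝓝[>] 0) (𝓝 1) := by
    simpa using tendsto_const_nhds.sub hFR
  refine (div_one (3 * a) ▸ hnum.div hden one_ne_zero).congr' ?_
  filter_upwards [eventually_differentiableAt_of_eventually_fixedPoint hF hF0 hF' hρ h,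
    hpair.eventually hdiff, eventually_eventually_nhdsWithin.2 h, hpos,
    hden.eventually_ne one_ne_zero] with r hρr hFr hr hr0 hne
  rw [isOpen_Ioi.nhdsWithin_eq hr0] at hr
  have hderiv := hFr.hasFDerivAt.comp_hasDerivAt r ((hasDerivAt_id r).prodMk hρr.hasDerivAt)
  have hchain : deriv ρ r = fderiv ℝ F (r, ρ r) (1, deriv ρ r) :=
    hρr.hasDerivAt.unique (hderiv.congr_of_eventuallyEq hr)
  have hsplit : ((1 : ℝ), deriv ρ r) = (1, 0) + deriv ρ r • (0, 1) := by simp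
  rw [hsplit, map_add, map_smul, smul_eq_mul] at hchain
  have : fderiv ℝ F (r, ρ r) (1, 0) = deriv ρ r * (1 - fderiv ℝ F (r, ρ r) (0, 1)) := by linarith
  simp only [Pi.div_apply]
  rw [this]
  field_simp

end FixedPoint

namespace CollapsingARS

theorem u_apply_Rh (c : CollapsingARS) {r : ℝ} (hr : r ∈ Ioc (0 : ℝ) c.r₀) :
    c.u r (c.Rh r) = c.Y r (c.Rh r) := by
  have hpos := c.Rh_pos r hr
  have hY := c.Y_pos r ⟨hr.1.le, hr.2⟩ (c.Rh r) ⟨hpos.le, (c.Rh_lt r hr).le.trans hr.2⟩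
  have hG : c.G r (c.Rh r) / c.Rh r = c.Y r (c.Rh r) ^ 2 := by
    rw [ARSData.G, ← c.Rh_eq r hr]
    field_simp
    ring
  rw [ARSData.u, hG, Real.sqrt_sq hY.le]

theorem tendsto_Rh (c : CollapsingARS) : Tendsto c.Rh (𝓝[>] 0) (𝓝 0) := by
  have hmem : Ioc 0 c.r₀ ∈ 𝓝[>] (0 : ℝ) := Ioc_mem_nhdsGT c.r₀_pos
  refine tendsto_of_tendsto_of_tendsto_of_le_of_le' tendsto_const_nhds
    (tendsto_id.mono_left nhdsWithin_le_nhds) ?_ ?_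
  · filter_upwards [hmem] with r hr using (c.Rh_pos r hr).le
  · filter_upwards [hmem] with r hr using (c.Rh_lt r hr).le

end CollapsingARS

namespace ARSData

theorem contDiffAt_two_mul_Ψ (a : ARSData) :
    ContDiffAt ℝ 3 (fun p : ℝ × ℝ => 2 * a.Ψ p.1 p.2) (0, 0) := by
  obtain ⟨U, hU, hsub, hΨ, -⟩ := a.smooth
  have h0 : ((0 : ℝ), (0 : ℝ)) ∈ U :=
    hsub ⟨left_mem_Icc.2 a.r₀_pos.le, left_mem_Icc.2 a.r₀_pos.le⟩
  have h3 : ContDiffAt ℝ 3 (fun p : ℝ × ℝ => a.Ψ p.1 p.2) (0, 0) :=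
    (hΨ.contDiffAt (hU.mem_nhds h0)).of_le (WithTop.coe_le_coe.2 (le_top : (3 : ℕ∞) ≤ ⊤))
  exact contDiffAt_const.mul h3

theorem fderiv_two_mul_Ψ (a : ARSData) :
    fderiv ℝ (fun p : ℝ × ℝ => 2 * a.Ψ p.1 p.2) (0, 0) = 0 := by
  have hd := (a.contDiffAt_two_mul_Ψ.differentiableAt (by norm_num)).hasFDerivAt
  have hr := hd.comp_hasDerivAt (f := fun s : ℝ => (s, (0 : ℝ))) 0
    ((hasDerivAt_id (0 : ℝ)).prodMk (hasDerivAt_const (0 : ℝ) (0 : ℝ)))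
  have hR := hd.comp_hasDerivAt (f := fun s : ℝ => ((0 : ℝ), s)) 0
    ((hasDerivAt_const (0 : ℝ) (0 : ℝ)).prodMk (hasDerivAt_id (0 : ℝ)))
  have hr0 : deriv (fun s => 2 * a.Ψ s 0) 0 = 0 := by
    rw [deriv_const_mul_field, a.Ψr_origin, mul_zero]
  have hR0 : deriv (fun s => 2 * a.Ψ 0 s) 0 = 0 := by
    rw [deriv_const_mul_field, a.ΨR_origin, mul_zero]
  ext
  · simpa using hr.deriv.symm.trans hr0
  · simpa using hR.deriv.symm.trans hR0

theorem tendsto_two_mul_Ψ_div_cube_s2 (a : ARSData) :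
    Tendsto (fun r => 2 * a.Ψ r 0 / r ^ 3) (𝓝[>] 0) (𝓝 a.h30) := by
  have haxis : Tendsto (fun r : ℝ => (r, (0 : ℝ))) (𝓝[>] 0)
      (𝓝[Icc (0 : ℝ) a.r₀ ×ˢ Icc (0 : ℝ) a.r₀] (0, 0)) := by
    refine tendsto_nhdsWithin_iff.2
      ⟨(tendsto_id.mono_left nhdsWithin_le_nhds).prodMk_nhds tendsto_const_nhds, ?_⟩
    filter_upwards [Ioc_mem_nhdsGT a.r₀_pos] with r hr
    exact ⟨⟨hr.1.le, hr.2⟩, left_mem_Icc.2 a.r₀_pos.le⟩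
  have := (a.taylor.comp_tendsto haxis).tendsto_div_nhds_zero.add_const a.h30
  rw [zero_add] at this
  refine this.congr' ?_
  filter_upwards [self_mem_nhdsWithin] with r hr
  have : r ≠ 0 := ne_of_gt hr
  simp only [Function.comp_apply, add_zero]
  field_simp
  ring

end ARSData

/-- **Lemma (the apparent horizon is a supersolution).** In a collapsing ARS model:
`u = Y` along the apparent horizon (so the right-hand side of the radial null geodesic
equation vanishes there), `R_h(r)/(α r³) → 1` as `r → 0⁺`, and near the center `R_h`
is differentiable and increasing, with `R_h′(r)/(3α r²) → 1` as `r → 0⁺`. -/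
theorem apparentHorizon_supersolution (c : CollapsingARS) :
    (∀ r ∈ Ioc (0:ℝ) c.r₀, c.u r (c.Rh r) = c.Y r (c.Rh r)) ∧
    Tendsto (fun r : ℝ => c.Rh r / (c.h30 * r ^ 3)) (𝓝[>] 0) (𝓝 1) ∧
    ∃ r₁ ∈ Ioc (0:ℝ) c.r₀,
      (∀ r ∈ Ioc (0:ℝ) r₁, DifferentiableAt ℝ c.Rh r ∧ 0 < deriv c.Rh r) ∧
      Tendsto (fun r : ℝ => deriv c.Rh r / (3 * c.h30 * r ^ 2)) (𝓝[>] 0) (𝓝 1) := by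
  have hfix : ∀ᶠ r in 𝓝[>] (0 : ℝ), c.Rh r = 2 * c.Ψ r (c.Rh r) := by
    filter_upwards [Ioc_mem_nhdsGT c.r₀_pos] with r hr using c.Rh_eq r hr
  have hα := c.α_pos
  have hF := c.contDiffAt_two_mul_Ψ
  have hF0 : 2 * c.Ψ 0 0 = 0 := by rw [c.Ψ_origin, mul_zero]
  have hF' := c.fderiv_two_mul_Ψ
  have hF'' : deriv (deriv fun r => 2 * c.Ψ r 0) 0 = 0 := by
    have : (deriv fun r => 2 * c.Ψ r 0) = fun r => 2 * deriv (fun s => c.Ψ s 0) r :=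
      funext fun r => deriv_const_mul_field _
    rw [this, deriv_const_mul_field, c.Ψrr_origin, mul_zero]
  have hcube := c.tendsto_two_mul_Ψ_div_cube_s2
  have hRh' : Tendsto (fun r : ℝ => deriv c.Rh r / (3 * c.h30 * r ^ 2)) (𝓝[>] 0) (𝓝 1) := by
    have := (tendsto_deriv_div_sq_of_eventually_fixedPoint hF hF0 hF' hF'' c.tendsto_Rh
      hfix hcube).div_const (3 * c.h30)
    rw [div_self (by positivity)] at this
    exact this.congr fun r => by rw [div_div, mul_comm]
  refine ⟨fun r hr => c.u_apply_Rh hr, ?_, ?_⟩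
  · have := (tendsto_div_cube_of_eventually_fixedPoint hF hF' c.tendsto_Rh hfix
      hcube).div_const c.h30
    rw [div_self hα.ne'] at this
    exact this.congr fun r => by rw [div_div, mul_comm]
  · have hev : ∀ᶠ r in 𝓝[>] (0 : ℝ), r ≤ c.r₀ ∧ DifferentiableAt ℝ c.Rh r ∧ 0 < deriv c.Rh r := by
      filter_upwards [Ioc_mem_nhdsGT c.r₀_pos, hRh'.eventually_const_lt one_pos,
        eventually_differentiableAt_of_eventually_fixedPoint hF hF0 hF' c.tendsto_Rh hfix]
        with r hr hpos hdiff
      have := hr.1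
      exact ⟨hr.2, hdiff, (div_pos_iff_of_pos_right (by positivity)).1 hpos⟩
    obtain ⟨r₁, hr₁, hsub⟩ := mem_nhdsGT_iff_exists_Ioc_subset.1 hev
    exact ⟨r₁, ⟨hr₁, (hsub ⟨hr₁, le_rfl⟩).1⟩, fun r hr => (hsub hr).2, hRh'⟩
end
end
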